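/- arXiv:2603.24066 — 3 statements merged into one kernel-verified Lean document; each statement's English description precedes it below -/
import Mathlib

section
/- There exists an absolute constant c > 0 such that for every n ≥ 2 and every family A ⊆ {0,1}^n that is increasing, balanced, and regular, the covariance under the uniform measure μ satisfies Cov_μ(1_A, Maj) ≥ c · (log n)/√n. -/
open Finset

/-- Expectation of `f` under the uniform measure on the discrete cube `{0,1}^n`. -/
noncomputable def cubeE (n : ℕ) (f : (Fin n → Bool) → ℝ) : ℝ :=
  (∑ x : Fin n → Bool, f x) / 2 ^ n

/-- Covariance under the uniform measure on the discrete cube. -/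
noncomputable def cubeCov (n : ℕ) (f g : (Fin n → Bool) → ℝ) : ℝ :=
  cubeE n (fun x => f x * g x) - cubeE n f * cubeE n g

/-- Uniform measure of a family `A ⊆ {0,1}^n`. -/
noncomputable def cubeMu (n : ℕ) (A : Set (Fin n → Bool)) : ℝ :=
  cubeE n (A.indicator fun _ => 1)

/-- Influence of coordinate `k` on the family `A`. -/
noncomputable def influence (n : ℕ) (A : Set (Fin n → Bool)) (k : Fin n) : ℝ :=
  2 * cubeMu n {x | x ∈ A ∧ Function.update x k (!(x k)) ∉ A}

/-- The majority function `Maj(x) = 1` iff `∑ x_i > n/2`. -/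
noncomputable def Maj (n : ℕ) : (Fin n → Bool) → ℝ :=
  fun x => if (n : ℝ) / 2 < ∑ i, (if x i then (1 : ℝ) else 0) then 1 else 0


namespace KKLMaj

variable {n : ℕ}

/-- sign of a bit -/
noncomputable def sg (b : Bool) : ℝ := if b then 1 else -1

/-- flip coordinate `i` -/
def fl (i : Fin n) (x : Fin n → Bool) : Fin n → Bool := Function.update x i (!(x i))

/-- Walsh character -/
noncomputable def ch (S : Finset (Fin n)) (x : Fin n → Bool) : ℝ := ∏ i ∈ S, sg (x i)

/-- Fourier coefficient -/
noncomputable def fc (f : (Fin n → Bool) → ℝ) (S : Finset (Fin n)) : ℝ :=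
  cubeE n (fun x => f x * ch S x)

lemma le_of_sq'' {a b : ℝ} (h : a ^ 2 ≤ b ^ 2) (hb : 0 ≤ b) : a ≤ b :=
  (le_abs_self a).trans (abs_le_of_sq_le_sq h hb)

lemma sg_sq (b : Bool) : sg b * sg b = 1 := by cases b <;> simp [sg]

lemma sg_not (b : Bool) : sg (!b) = - sg b := by cases b <;> simp [sg]

lemma fl_fl (i : Fin n) (x : Fin n → Bool) : fl i (fl i x) = x := by
  funext j
  by_cases h : j = i
  · subst h; simp [fl]
  · simp [fl, h]

lemma fl_same (i : Fin n) (x : Fin n → Bool) : fl i x i = !(x i) := by simp [fl]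

lemma fl_ne {i j : Fin n} (h : j ≠ i) (x : Fin n → Bool) : fl i x j = x j := by simp [fl, h]

lemma E_add (f g : (Fin n → Bool) → ℝ) :
    cubeE n (fun x => f x + g x) = cubeE n f + cubeE n g := by
  simp [cubeE, Finset.sum_add_distrib, add_div]

lemma E_sub (f g : (Fin n → Bool) → ℝ) :
    cubeE n (fun x => f x - g x) = cubeE n f - cubeE n g := by
  simp [cubeE, Finset.sum_sub_distrib, sub_div]

lemma E_mul (c : ℝ) (f : (Fin n → Bool) → ℝ) :
    cubeE n (fun x => c * f x) = c * cubeE n f := by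
  simp [cubeE, ← Finset.mul_sum, mul_div_assoc]

lemma E_const (c : ℝ) : cubeE n (fun _ => c) = c := by
  simp [cubeE]

lemma E_mono {f g : (Fin n → Bool) → ℝ} (h : ∀ x, f x ≤ g x) : cubeE n f ≤ cubeE n g := by
  unfold cubeE
  gcongr with x
  exact h x

lemma E_nonneg {f : (Fin n → Bool) → ℝ} (h : ∀ x, 0 ≤ f x) : 0 ≤ cubeE n f := by
  unfold cubeE
  have := Finset.sum_nonneg (fun x (_ : x ∈ Finset.univ) => h x)
  positivity

lemma E_sum {ι : Type*} (s : Finset ι) (f : ι → (Fin n → Bool) → ℝ) :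
    cubeE n (fun x => ∑ i ∈ s, f i x) = ∑ i ∈ s, cubeE n (f i) := by
  unfold cubeE
  rw [Finset.sum_comm, Finset.sum_div]

lemma sum_fl (i : Fin n) (f : (Fin n → Bool) → ℝ) : ∑ x, f (fl i x) = ∑ x, f x := by
  refine Finset.sum_nbij' (fl i) (fl i) ?_ ?_ ?_ ?_ ?_ <;> simp [fl_fl]

lemma E_fl (i : Fin n) (f : (Fin n → Bool) → ℝ) : cubeE n (fun x => f (fl i x)) = cubeE n f := by
  unfold cubeE
  rw [sum_fl]

lemma E_cs (f g : (Fin n → Bool) → ℝ) :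
    cubeE n (fun x => f x * g x) ^ 2 ≤ cubeE n (fun x => f x ^ 2) * cubeE n (fun x => g x ^ 2) := by
  unfold cubeE
  rw [div_pow, div_mul_div_comm, ← sq]
  gcongr
  exact Finset.sum_mul_sq_le_sq_mul_sq _ _ _

lemma ch_fl (S : Finset (Fin n)) (i : Fin n) (x : Fin n → Bool) :
    ch S (fl i x) = if i ∈ S then - ch S x else ch S x := by
  unfold ch
  split_ifs with h
  · rw [← Finset.mul_prod_erase S _ h, ← Finset.mul_prod_erase S (fun j => sg (x j)) h, fl_same,
      sg_not, neg_mul]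
    congr 2
    refine Finset.prod_congr rfl fun j hj => ?_
    rw [fl_ne (Finset.ne_of_mem_erase hj)]
  · refine Finset.prod_congr rfl fun j hj => ?_
    rw [fl_ne]
    rintro rfl
    exact h hj

lemma bonami (r : ℝ) (hr : r ^ 2 = 1 / 3) (T : Finset (Fin n)) : ∀ c : Finset (Fin n) → ℝ,
    cubeE n (fun x => (∑ S ∈ T.powerset, c S * r ^ S.card * ch S x) ^ 4)
      ≤ (∑ S ∈ T.powerset, c S ^ 2) ^ 2 := by
  induction T using Finset.induction_on with
  | empty =>
    intro c
    simp [ch, E_const]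
    apply le_of_eq; ring
  | insert a T ha ih =>
    intro c
    set G : (Fin n → Bool) → ℝ := fun x => ∑ S ∈ T.powerset, c S * r ^ S.card * ch S x with hG
    set H : (Fin n → Bool) → ℝ :=
      fun x => ∑ S ∈ T.powerset, c (insert a S) * r ^ S.card * ch S x with hH
    have hmem : ∀ S ∈ T.powerset, a ∉ S := fun S hS h => ha (Finset.mem_powerset.1 hS h)
    have key : ∀ x, ∑ S ∈ (insert a T).powerset, c S * r ^ S.card * ch S x
        = G x + r * sg (x a) * H x := by
      intro x
      rw [Finset.sum_powerset_insert ha, hG, hH, Finset.mul_sum]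
      congr 1
      refine Finset.sum_congr rfl fun S hS => ?_
      rw [Finset.card_insert_of_notMem (hmem S hS)]
      have : ch (insert a S) x = sg (x a) * ch S x := by
        unfold ch
        rw [Finset.prod_insert (hmem S hS)]
      rw [this]; ring
    have hGf : ∀ x, G (fl a x) = G x := by
      intro x
      refine Finset.sum_congr rfl fun S hS => ?_
      rw [ch_fl, if_neg (hmem S hS)]
    have hHf : ∀ x, H (fl a x) = H x := by
      intro x
      refine Finset.sum_congr rfl fun S hS => ?_
      rw [ch_fl, if_neg (hmem S hS)]
    simp_rw [key]
    have h1 : cubeE n (fun x => (G x + r * sg (x a) * H x) ^ 4)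
        = cubeE n (fun x => G x ^ 4) + 2 * cubeE n (fun x => G x ^ 2 * H x ^ 2)
          + 1 / 9 * cubeE n (fun x => H x ^ 4) := by
      have e1 := E_fl a (fun x => (G x + r * sg (x a) * H x) ^ 4)
      have e2 : cubeE n (fun x => (G x + r * sg (x a) * H x) ^ 4)
          + cubeE n (fun x => (G (fl a x) + r * sg (fl a x a) * H (fl a x)) ^ 4)
          = 2 * (cubeE n (fun x => G x ^ 4) + 2 * cubeE n (fun x => G x ^ 2 * H x ^ 2)
          + 1 / 9 * cubeE n (fun x => H x ^ 4)) := by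
        rw [← E_add, ← E_mul, ← E_mul, ← E_add, ← E_add, ← E_mul]
        congr 1
        funext x
        rw [hGf, hHf, fl_same, sg_not]
        have h3 : sg (x a) ^ 2 = 1 := by rw [sq, sg_sq]
        have h4 : sg (x a) ^ 4 = 1 := by
          rw [show sg (x a) ^ 4 = (sg (x a) ^ 2) ^ 2 by ring, h3]; norm_num
        have h5 : r ^ 4 = 1 / 9 := by
          rw [show r ^ 4 = (r ^ 2) ^ 2 by ring, hr]; norm_num
        linear_combination (2 * G x ^ 2 * H x ^ 2 * 6 * r ^ 2) * h3 + 2 * r ^ 4 * H x ^ 4 * h4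
          + (2 * G x ^ 2 * H x ^ 2 * 6) * hr + 2 * H x ^ 4 * h5
      linarith
    rw [h1, Finset.sum_powerset_insert ha]
    have iG := ih c
    have iH := ih (fun S => c (insert a S))
    set A := ∑ S ∈ T.powerset, c S ^ 2
    set B := ∑ S ∈ T.powerset, c (insert a S) ^ 2
    have hA : 0 ≤ A := Finset.sum_nonneg fun _ _ => sq_nonneg _
    have hB : 0 ≤ B := Finset.sum_nonneg fun _ _ => sq_nonneg _
    have hcs := E_cs (fun x => G x ^ 2) (fun x => H x ^ 2)
    simp only [← pow_mul] at hcs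
    norm_num at hcs
    have hGH : cubeE n (fun x => G x ^ 2 * H x ^ 2) ≤ A * B := by
      refine le_of_sq'' ?_ (by positivity)
      calc _ ≤ _ := hcs
        _ ≤ A ^ 2 * B ^ 2 := by
          gcongr
          · exact E_nonneg fun x => by positivity
        _ = _ := by ring
    nlinarith [sq_nonneg B]

lemma fc_sum (u : (Fin n → Bool) → ℝ) (s : Finset (Finset (Fin n))) (c : Finset (Fin n) → ℝ) :
    cubeE n (fun x => u x * ∑ S ∈ s, c S * ch S x) = ∑ S ∈ s, c S * fc u S := by
  have : (fun x => u x * ∑ S ∈ s, c S * ch S x) = fun x => ∑ S ∈ s, c S * (u x * ch S x) := by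
    funext x
    rw [Finset.mul_sum]
    exact Finset.sum_congr rfl fun S _ => by ring
  rw [this, E_sum]
  exact Finset.sum_congr rfl fun S _ => E_mul _ _

set_option maxHeartbeats 1000000 in
lemma level_ineq (u : (Fin n → Bool) → ℝ) (hu : ∀ x, |u x| ≤ 1) (d : ℕ) :
    (∑ S : Finset (Fin n), if S.card ≤ d then fc u S ^ 2 else 0) ^ 2
      ≤ 9 ^ d * cubeE n (fun x => |u x|) ^ 3 := by
  set w := ∑ S : Finset (Fin n), if S.card ≤ d then fc u S ^ 2 else 0 with hw
  have hw0 : 0 ≤ w := Finset.sum_nonneg fun _ _ => by split_ifs <;> positivity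
  set e := cubeE n (fun x => |u x|) with he
  have he0 : 0 ≤ e := E_nonneg fun x => abs_nonneg _
  set c : Finset (Fin n) → ℝ := fun S => if S.card ≤ d then fc u S else 0 with hc
  set p : (Fin n → Bool) → ℝ := fun x => ∑ S, c S * ch S x with hp
  have h1 : cubeE n (fun x => u x * p x) = w := by
    rw [hp, fc_sum, hw]
    refine Finset.sum_congr rfl fun S _ => ?_
    simp only [hc]
    split_ifs <;> ring
  set r : ℝ := Real.sqrt (1 / 3) with hr
  have hr2 : r ^ 2 = 1 / 3 := Real.sq_sqrt (by norm_num)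
  have hr0 : 0 < r := Real.sqrt_pos.2 (by norm_num)
  have h2 : cubeE n (fun x => p x ^ 4) ≤ (3 ^ d * w) ^ 2 := by
    have hb := bonami r hr2 Finset.univ (fun S => c S / r ^ S.card)
    rw [Finset.powerset_univ] at hb
    have e1 : ∀ (x : Fin n → Bool) (S : Finset (Fin n)),
        c S / r ^ S.card * r ^ S.card * ch S x = c S * ch S x := by
      intro x S
      field_simp
    simp_rw [e1] at hb
    refine hb.trans ?_
    have : 0 ≤ ∑ S, (c S / r ^ S.card) ^ 2 := Finset.sum_nonneg fun _ _ => sq_nonneg _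
    gcongr
    rw [hw, Finset.mul_sum]
    refine Finset.sum_le_sum fun S _ => ?_
    simp only [hc]
    split_ifs with hS
    · rw [div_pow, ← pow_mul, mul_comm S.card 2, pow_mul, hr2, div_pow, one_pow, div_div_eq_mul_div,
        div_one, mul_comm]
      gcongr
      norm_num
    · simp
  have hp4 : 0 ≤ cubeE n (fun x => p x ^ 4) := E_nonneg fun x => by positivity
  have h3 : w ^ 2 ≤ e * cubeE n (fun x => |u x| * p x ^ 2) := by
    have hcs := E_cs (fun x => Real.sqrt |u x|) (fun x => Real.sqrt |u x| * |p x|)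
    have hle : w ≤ cubeE n (fun x => Real.sqrt |u x| * (Real.sqrt |u x| * |p x|)) := by
      rw [← h1]
      refine E_mono fun x => ?_
      rw [← mul_assoc, Real.mul_self_sqrt (abs_nonneg _), ← abs_mul]
      exact le_abs_self _
    have e2 : ∀ x, Real.sqrt |u x| ^ 2 = |u x| := fun x => Real.sq_sqrt (abs_nonneg _)
    simp only [mul_pow, e2, sq_abs] at hcs
    exact (pow_le_pow_left₀ hw0 hle 2).trans hcs
  have h4 : cubeE n (fun x => |u x| * p x ^ 2) ^ 2 ≤ e * cubeE n (fun x => p x ^ 4) := by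
    have hcs := E_cs (fun x => |u x|) (fun x => p x ^ 2)
    simp only [← pow_mul] at hcs
    norm_num at hcs
    refine hcs.trans ?_
    gcongr
    refine E_mono fun x => ?_
    have := hu x
    rw [← sq_abs]
    nlinarith [abs_nonneg (u x)]
  have hq0 : 0 ≤ cubeE n (fun x => |u x| * p x ^ 2) := E_nonneg fun x => by positivity
  have h5 : w ^ 4 ≤ e ^ 3 * (9 ^ d * w ^ 2) := by
    calc w ^ 4 = (w ^ 2) ^ 2 := by ring
      _ ≤ (e * cubeE n (fun x => |u x| * p x ^ 2)) ^ 2 := by gcongr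
      _ = e ^ 2 * cubeE n (fun x => |u x| * p x ^ 2) ^ 2 := by ring
      _ ≤ e ^ 2 * (e * (3 ^ d * w) ^ 2) := by
        gcongr
        exact h4.trans (by gcongr)
      _ = e ^ 3 * (9 ^ d * w ^ 2) := by
        rw [show (9 : ℝ) = 3 ^ 2 by norm_num, ← pow_mul, mul_comm 2 d, pow_mul]; ring
  rcases hw0.eq_or_lt with h | h
  · calc w ^ 2 = 0 := by rw [← h]; norm_num
      _ ≤ _ := by positivity
  · have h6 : 0 < w ^ 2 := by positivity
    refine le_of_mul_le_mul_right ?_ h6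
    linarith [h5, show w ^ 2 * w ^ 2 = w ^ 4 by ring,
      show 9 ^ d * e ^ 3 * w ^ 2 = e ^ 3 * (9 ^ d * w ^ 2) by ring]

lemma sum_ch_ch (x y : Fin n → Bool) :
    ∑ S : Finset (Fin n), ch S x * ch S y = if x = y then 2 ^ n else 0 := by
  have h : ∑ S : Finset (Fin n), ch S x * ch S y = ∏ i : Fin n, (1 + sg (x i) * sg (y i)) := by
    rw [Finset.prod_one_add, Finset.powerset_univ]
    refine Finset.sum_congr rfl fun S _ => ?_
    rw [ch, ch, Finset.prod_mul_distrib]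
  rw [h]
  split_ifs with hxy
  · subst hxy
    simp [sg_sq]
    norm_num
  · obtain ⟨i, hi⟩ := Function.ne_iff.1 hxy
    apply Finset.prod_eq_zero (Finset.mem_univ i)
    cases hx : x i <;> cases hy : y i <;> simp_all [sg]

lemma parseval (f : (Fin n → Bool) → ℝ) :
    ∑ S : Finset (Fin n), fc f S ^ 2 = cubeE n (fun x => f x ^ 2) := by
  have h : ∀ S, fc f S ^ 2 = (∑ x, ∑ y, f x * f y * (ch S x * ch S y)) / (2 ^ n * 2 ^ n) := by
    intro S
    rw [fc, cubeE, sq, div_mul_div_comm, Finset.sum_mul_sum]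
    congr 1
    refine Finset.sum_congr rfl fun x _ => Finset.sum_congr rfl fun y _ => by ring
  simp_rw [h]
  rw [← Finset.sum_div, Finset.sum_comm]
  have h2 : ∀ x, ∑ S : Finset (Fin n), ∑ y, f x * f y * (ch S x * ch S y) = f x ^ 2 * 2 ^ n := by
    intro x
    rw [Finset.sum_comm]
    simp_rw [← Finset.mul_sum, sum_ch_ch]
    simp
    ring
  simp_rw [h2]
  rw [← Finset.sum_mul, cubeE, mul_div_mul_right _ _ (by positivity)]

lemma fc_diff (h : (Fin n → Bool) → ℝ) (i : Fin n) (S : Finset (Fin n)) :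
    fc (fun x => (h x - h (fl i x)) / 2) S = if i ∈ S then fc h S else 0 := by
  have e1 : cubeE n (fun x => h (fl i x) * ch S x) = if i ∈ S then - fc h S else fc h S := by
    rw [← E_fl i]
    simp only [fl_fl, ch_fl]
    split_ifs
    · rw [fc, ← neg_one_mul, ← E_mul]
      congr 1; funext x; ring
    · rfl
  have e2 : fc (fun x => (h x - h (fl i x)) / 2) S
      = 1 / 2 * (fc h S - cubeE n (fun x => h (fl i x) * ch S x)) := by
    rw [fc, fc, ← E_sub, ← E_mul]
    congr 1; funext x; ring
  rw [e2, e1]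
  split_ifs <;> ring

lemma fc_add (f g : (Fin n → Bool) → ℝ) (S : Finset (Fin n)) :
    fc (fun x => f x + g x) S = fc f S + fc g S := by
  rw [fc, fc, fc, ← E_add]
  congr 1; funext x; ring

lemma fc_empty (f : (Fin n → Bool) → ℝ) : fc f ∅ = cubeE n f := by
  simp [fc, ch]

lemma kkl (h : (Fin n → Bool) → ℝ) (U V : Fin n → (Fin n → Bool) → ℝ)
    (hUV : ∀ i x, (h x - h (fl i x)) / 2 = U i x + V i x) (hU : ∀ i x, |U i x| ≤ 1)
    (m ε : ℝ) (hm : ∀ i, cubeE n (fun x => |U i x|) ≤ m)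
    (hV : ∑ i, cubeE n (fun x => V i x ^ 2) ≤ ε) (d : ℕ) (hd : 1 ≤ d) :
    cubeE n (fun x => h x ^ 2) - cubeE n h ^ 2 ≤
      2 * 3 ^ d * Real.sqrt m * ∑ i, cubeE n (fun x => |U i x|) + 2 * ε
        + (2 * ∑ i, cubeE n (fun x => |U i x|) + 2 * ε) / d := by
  have hd' : (1 : ℝ) ≤ d := by exact_mod_cast hd
  have swap : ∀ φ : Finset (Fin n) → ℝ, ∑ S : Finset (Fin n), φ S * ((S.card : ℝ) * fc h S ^ 2)
      = ∑ i, ∑ S, φ S * (fc (U i) S + fc (V i) S) ^ 2 := by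
    intro φ
    rw [Finset.sum_comm]
    refine Finset.sum_congr rfl fun S _ => ?_
    have : ∀ i, φ S * (fc (U i) S + fc (V i) S) ^ 2 = if i ∈ S then φ S * fc h S ^ 2 else 0 := by
      intro i
      rw [← fc_add]
      have e : (fun x => U i x + V i x) = fun x => (h x - h (fl i x)) / 2 := by
        funext x; rw [hUV]
      rw [e, fc_diff]
      split_ifs <;> simp
    simp_rw [this]
    rw [← Finset.sum_filter]
    simp
    ring
  have sqle : ∀ a b : ℝ, (a + b) ^ 2 ≤ 2 * a ^ 2 + 2 * b ^ 2 := fun a b => by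
    nlinarith [sq_nonneg (a - b)]
  have low : ∑ S : Finset (Fin n), (if S.card ≤ d then (1 : ℝ) else 0) * ((S.card : ℝ) * fc h S ^ 2)
      ≤ 2 * 3 ^ d * Real.sqrt m * ∑ i, cubeE n (fun x => |U i x|) + 2 * ε := by
    rw [swap]
    have : ∀ i, ∑ S : Finset (Fin n), (if S.card ≤ d then (1 : ℝ) else 0)
        * (fc (U i) S + fc (V i) S) ^ 2
        ≤ 2 * (3 ^ d * Real.sqrt m * cubeE n (fun x => |U i x|))
          + 2 * cubeE n (fun x => V i x ^ 2) := by
      intro i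
      have l1 := level_ineq (U i) (hU i) d
      have he0 : 0 ≤ cubeE n (fun x => |U i x|) := E_nonneg fun x => abs_nonneg _
      have hm0 : 0 ≤ m := he0.trans (hm i)
      have l2 : (∑ S : Finset (Fin n), if S.card ≤ d then fc (U i) S ^ 2 else 0)
          ≤ 3 ^ d * Real.sqrt m * cubeE n (fun x => |U i x|) := by
        refine le_of_sq'' ?_ (by positivity)
        refine l1.trans ?_
        rw [mul_pow, mul_pow, Real.sq_sqrt hm0, ← pow_mul, mul_comm d 2, pow_mul, mul_assoc]
        norm_num
        rw [pow_succ']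
        gcongr
        exact hm i
      rw [← parseval (V i)]
      refine le_trans ?_ (add_le_add (mul_le_mul_of_nonneg_left l2 (by norm_num)) le_rfl)
      rw [Finset.mul_sum, Finset.mul_sum, ← Finset.sum_add_distrib]
      refine Finset.sum_le_sum fun S _ => ?_
      split_ifs
      · rw [one_mul]; exact sqle _ _
      · nlinarith [sq_nonneg (fc (V i) S)]
    refine (Finset.sum_le_sum fun i _ => this i).trans ?_
    rw [Finset.sum_add_distrib, ← Finset.mul_sum, ← Finset.mul_sum, ← Finset.mul_sum]
    nlinarith
  have tot : ∑ S : Finset (Fin n), (1 : ℝ) * ((S.card : ℝ) * fc h S ^ 2)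
      ≤ 2 * ∑ i, cubeE n (fun x => |U i x|) + 2 * ε := by
    rw [swap]
    have : ∀ i, ∑ S : Finset (Fin n), (1 : ℝ) * (fc (U i) S + fc (V i) S) ^ 2
        ≤ 2 * cubeE n (fun x => |U i x|) + 2 * cubeE n (fun x => V i x ^ 2) := by
      intro i
      have l2 : ∑ S : Finset (Fin n), fc (U i) S ^ 2 ≤ cubeE n (fun x => |U i x|) := by
        rw [parseval]
        refine E_mono fun x => ?_
        rw [← sq_abs]
        nlinarith [hU i x, abs_nonneg (U i x)]
      rw [← parseval (V i)]
      refine le_trans ?_ (add_le_add (mul_le_mul_of_nonneg_left l2 (by norm_num)) le_rfl)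
      rw [Finset.mul_sum, Finset.mul_sum, ← Finset.sum_add_distrib]
      refine Finset.sum_le_sum fun S _ => ?_
      rw [one_mul]; exact sqle _ _
    refine (Finset.sum_le_sum fun i _ => this i).trans ?_
    rw [Finset.sum_add_distrib, ← Finset.mul_sum, ← Finset.mul_sum]
    linarith
  have var : cubeE n (fun x => h x ^ 2) - cubeE n h ^ 2 ≤
      ∑ S : Finset (Fin n), (if S.card ≤ d then (1 : ℝ) else 0) * ((S.card : ℝ) * fc h S ^ 2)
      + (∑ S : Finset (Fin n), (1 : ℝ) * ((S.card : ℝ) * fc h S ^ 2)) / d := by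
    rw [← parseval, ← fc_empty, ← Finset.add_sum_erase _ _ (Finset.mem_univ ∅), add_sub_cancel_left,
      Finset.sum_div, ← Finset.sum_add_distrib]
    refine le_trans (Finset.sum_le_sum (g := fun S : Finset (Fin n) =>
      (if S.card ≤ d then (1 : ℝ) else 0) * ((S.card : ℝ) * fc h S ^ 2)
        + (1 : ℝ) * ((S.card : ℝ) * fc h S ^ 2) / d) ?_) ?_
    · intro S hS
      have hS1 : (1 : ℝ) ≤ S.card := by
        exact_mod_cast Finset.card_pos.2 (Finset.nonempty_iff_ne_empty.2 (Finset.ne_of_mem_erase hS))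
      have h0 := sq_nonneg (fc h S)
      split_ifs with hc
      · have : 0 ≤ 1 * ((S.card : ℝ) * fc h S ^ 2) / d := by positivity
        nlinarith
      · have : (d : ℝ) ≤ S.card := by exact_mod_cast (not_le.1 hc).le
        rw [zero_mul, zero_add, one_mul, le_div_iff₀ (by linarith)]
        nlinarith
    · refine Finset.sum_le_sum_of_subset_of_nonneg (Finset.erase_subset _ _) fun S _ _ => ?_
      have h0 := sq_nonneg (fc h S)
      split_ifs <;> positivity
  have : (∑ S : Finset (Fin n), (1 : ℝ) * ((S.card : ℝ) * fc h S ^ 2)) / d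
      ≤ (2 * ∑ i, cubeE n (fun x => |U i x|) + 2 * ε) / d := by gcongr
  linarith


/-- Hamming weight -/
def wt (x : Fin n → Bool) : ℕ := (Finset.univ.filter fun i => x i = true).card

/-- layer sum -/
noncomputable def lay (f : (Fin n → Bool) → ℝ) (k : ℕ) : ℝ := ∑ x, if wt x = k then f x else 0

/-- layer average -/
noncomputable def av (f : (Fin n → Bool) → ℝ) (k : ℕ) : ℝ := lay f k / n.choose k

/-- edge boundary between layers -/
noncomputable def ed (f : (Fin n → Bool) → ℝ) (k : ℕ) : ℝ :=
  ∑ i, ∑ x, if wt x = k + 1 ∧ x i = true then f x - f (fl i x) else 0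

lemma wt_fl_true {i : Fin n} {x : Fin n → Bool} (h : x i = true) : wt (fl i x) + 1 = wt x := by
  have : (Finset.univ.filter fun j => x j = true)
      = insert i (Finset.univ.filter fun j => fl i x j = true) := by
    ext j
    by_cases hj : j = i
    · subst hj; simp [h]
    · simp [hj, fl_ne hj]
  rw [wt, wt, this, Finset.card_insert_of_notMem]
  simp [fl_same, h]

lemma wt_fl_false {i : Fin n} {x : Fin n → Bool} (h : x i = false) : wt (fl i x) = wt x + 1 := by
  have := wt_fl_true (i := i) (x := fl i x) (by simp [fl_same, h])
  rw [fl_fl] at this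
  exact this.symm

lemma wt_le (x : Fin n → Bool) : wt x ≤ n := by
  have := Finset.card_le_univ (Finset.univ.filter fun i => x i = true)
  simpa [wt] using this

lemma layer_id (f : (Fin n → Bool) → ℝ) (k : ℕ) :
    ((k : ℝ) + 1) * lay f (k + 1) - ((n : ℝ) - k) * lay f k = ed f k := by
  have e1 : ((k : ℝ) + 1) * lay f (k + 1) = ∑ i, ∑ x, if wt x = k + 1 ∧ x i = true then f x else 0 := by
    rw [Finset.sum_comm, lay, Finset.mul_sum]
    refine Finset.sum_congr rfl fun x _ => ?_
    split_ifs with h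
    · simp only [h, true_and]
      rw [← Finset.sum_filter, Finset.sum_const, nsmul_eq_mul]
      have : (Finset.univ.filter fun i => x i = true).card = k + 1 := h
      rw [this]; push_cast; ring
    · simp [h]
  have e2 : ((n : ℝ) - k) * lay f k
      = ∑ i, ∑ x, if wt x = k + 1 ∧ x i = true then f (fl i x) else 0 := by
    have : ∀ i : Fin n, (∑ x, if wt x = k + 1 ∧ x i = true then f (fl i x) else 0)
        = ∑ x, if wt x = k ∧ ¬ (x i = true) then f x else 0 := by
      intro i
      rw [← sum_fl i]
      refine Finset.sum_congr rfl fun x _ => ?_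
      rw [fl_fl, fl_same]
      cases hx : x i
      · simp [wt_fl_false hx]
      · simp
    simp_rw [this]
    rw [Finset.sum_comm, lay, Finset.mul_sum]
    refine Finset.sum_congr rfl fun x _ => ?_
    split_ifs with h
    · simp only [h, true_and]
      rw [← Finset.sum_filter, Finset.sum_const, nsmul_eq_mul]
      have h1 := Finset.card_filter_add_card_filter_not (s := (Finset.univ : Finset (Fin n)))
        (fun i => x i = true)
      have h2 : (Finset.univ.filter fun i => x i = true).card = k := h
      rw [h2, Finset.card_univ, Fintype.card_fin] at h1
      have h3 : (n : ℝ) = k + ((Finset.univ.filter fun i => ¬ (x i = true)).card : ℝ) := by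
        exact_mod_cast h1.symm
      rw [h3]; ring
    · simp [h]
  rw [e1, e2, ed, ← Finset.sum_sub_distrib]
  refine Finset.sum_congr rfl fun i _ => ?_
  rw [← Finset.sum_sub_distrib]
  refine Finset.sum_congr rfl fun x _ => ?_
  split_ifs <;> ring

lemma wt_eq_zero {x : Fin n → Bool} : wt x = 0 ↔ x = fun _ => false := by
  unfold wt
  rw [Finset.card_eq_zero, Finset.filter_eq_empty_iff]
  constructor
  · intro h; funext i; simpa using h (Finset.mem_univ i)
  · intro h; subst h; simp

lemma wt_eq_n {x : Fin n → Bool} : wt x = n ↔ x = fun _ => true := by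
  unfold wt
  constructor
  · intro h
    have h2 := (Finset.card_eq_iff_eq_univ _).1 (h.trans (Fintype.card_fin n).symm)
    funext i
    have : i ∈ (Finset.univ.filter fun i => x i = true) := by rw [h2]; simp
    simpa using this
  · intro h; subst h; simp

lemma lay_zero (f : (Fin n → Bool) → ℝ) : lay f 0 = f (fun _ => false) := by
  simp [lay, wt_eq_zero]

lemma lay_n (f : (Fin n → Bool) → ℝ) : lay f n = f (fun _ => true) := by
  simp [lay, wt_eq_n]

lemma lay_one (k : ℕ) (hk : k ≤ n) : lay (n := n) (fun _ => 1) k = n.choose k := by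
  induction k with
  | zero => simp [lay_zero]
  | succ k ih =>
    have h := layer_id (n := n) (fun _ => 1) k
    have h0 : ed (n := n) (fun _ => 1) k = 0 := by simp [ed]
    rw [h0, ih (by omega)] at h
    have hc := Nat.choose_succ_right_eq n k
    have hc' : (n.choose (k + 1) : ℝ) * (k + 1) = n.choose k * ((n : ℝ) - k) := by
      rw [← Nat.cast_sub (by omega : k ≤ n)]
      exact_mod_cast hc
    have hk1 : (0 : ℝ) < k + 1 := by positivity
    apply mul_left_cancel₀ hk1.ne'
    linarith

lemma choose_bound (n k : ℕ) : ((n.choose k : ℝ)) ^ 2 * n ≤ 4 ^ n := by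
  have cb : ∀ m : ℕ, (2 * m + 1) * (m.centralBinom : ℝ) ^ 2 ≤ 16 ^ m := by
    intro m
    induction m with
    | zero => simp
    | succ m ih =>
      have h : ((m : ℝ) + 1) * (m + 1).centralBinom = 2 * (2 * m + 1) * m.centralBinom := by
        exact_mod_cast Nat.succ_mul_centralBinom_succ m
      have hm : (0 : ℝ) < (m + 1) ^ 2 := by positivity
      refine le_of_mul_le_mul_left ?_ hm
      have e : ((m : ℝ) + 1) ^ 2 * ((2 * ((m + 1 : ℕ) : ℝ) + 1) * ((m + 1).centralBinom : ℝ) ^ 2)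
          = (2 * m + 3) * (2 * (2 * m + 1) * m.centralBinom) ^ 2 := by
        rw [← h]; push_cast; ring
      rw [e]
      have e2 : (2 * (m : ℝ) + 3) * (2 * (2 * m + 1) * m.centralBinom) ^ 2
          = 4 * ((2 * m + 3) * (2 * m + 1)) * ((2 * m + 1) * (m.centralBinom : ℝ) ^ 2) := by ring
      rw [e2, pow_succ (16 : ℝ)]
      have hm0 : (0 : ℝ) ≤ m := by positivity
      calc 4 * ((2 * (m : ℝ) + 3) * (2 * m + 1)) * ((2 * m + 1) * (m.centralBinom : ℝ) ^ 2)
          ≤ 4 * ((2 * (m : ℝ) + 3) * (2 * m + 1)) * 16 ^ m := by gcongr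
        _ ≤ 4 * (4 * (m + 1) ^ 2) * 16 ^ m := by 
            have hx : (2 * (m : ℝ) + 3) * (2 * m + 1) ≤ 4 * (m + 1) ^ 2 := by nlinarith
            exact mul_le_mul_of_nonneg_right (mul_le_mul_of_nonneg_left hx (by norm_num))
              (by positivity)
        _ = _ := by ring
  have h1 : (n.choose k : ℝ) ≤ n.choose (n / 2) := by exact_mod_cast Nat.choose_le_middle k n
  have h2 : ((n.choose (n / 2) : ℝ)) ^ 2 * n ≤ 4 ^ n := by
    rcases Nat.even_or_odd' n with ⟨m, rfl | rfl⟩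
    · have := cb m
      rw [Nat.mul_div_cancel_left m (by norm_num), ← Nat.centralBinom_eq_two_mul_choose, pow_mul]
      push_cast
      norm_num
      nlinarith [sq_nonneg (m.centralBinom : ℝ)]
    · have h3 := cb (m + 1)
      have h4 : (m + 1).centralBinom = 2 * (2 * m + 1).choose m := by
        rw [Nat.centralBinom_eq_two_mul_choose, show 2 * (m + 1) = 2 * m + 1 + 1 by ring,
          Nat.choose_succ_succ, Nat.choose_symm_half]
        ring
      rw [show (2 * m + 1) / 2 = m by omega]
      rw [h4] at h3
      push_cast at h3 ⊢
      rw [pow_succ (4 : ℝ), pow_mul]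
      rw [pow_succ (16 : ℝ)] at h3
      norm_num
      nlinarith [sq_nonneg ((2 * m + 1).choose m : ℝ)]
  refine le_trans ?_ h2
  gcongr

lemma ed_nonneg {f : (Fin n → Bool) → ℝ} (hf : ∀ i x, x i = true → f (fl i x) ≤ f x) (k : ℕ) :
    0 ≤ ed f k := by
  refine Finset.sum_nonneg fun i _ => Finset.sum_nonneg fun x _ => ?_
  split_ifs with h
  · linarith [hf i x h.2]
  · exact le_rfl

lemma av_step {f : (Fin n → Bool) → ℝ} (hf : ∀ i x, x i = true → f (fl i x) ≤ f x) (k : ℕ)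
    (hk : k < n) : ed f k / 2 ^ n / Real.sqrt n ≤ av f (k + 1) - av f k := by
  have hn : 0 < n := by omega
  have hc1 : (0 : ℝ) < n.choose (k + 1) := by exact_mod_cast Nat.choose_pos (by omega)
  have hc0 : (0 : ℝ) < n.choose k := by exact_mod_cast Nat.choose_pos (by omega)
  have hc := Nat.choose_succ_right_eq n k
  have hc' : (n.choose (k + 1) : ℝ) * (k + 1) = n.choose k * ((n : ℝ) - k) := by
    rw [← Nat.cast_sub (by omega : k ≤ n)]
    exact_mod_cast hc
  have hid := layer_id f k
  have e : av f (k + 1) - av f k = ed f k / (n.choose (k + 1) * (k + 1)) := by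
    have hnk : (0 : ℝ) < (n : ℝ) - k := by
      have : (k : ℝ) < n := by exact_mod_cast hk
      linarith
    have e0 : av f k = ((n : ℝ) - k) * lay f k / (n.choose (k + 1) * (k + 1)) := by
      rw [hc', av]
      field_simp
    rw [e0, av, ← hid]
    field_simp
  rw [e, div_div]
  have hsq : (0 : ℝ) < Real.sqrt n := Real.sqrt_pos.2 (by exact_mod_cast hn)
  refine div_le_div_of_nonneg_left (ed_nonneg hf k) (by positivity) ?_
  have hb : (n.choose (k + 1) : ℝ) * Real.sqrt n ≤ 2 ^ n := by
    refine le_of_sq'' ?_ (by positivity)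
    rw [mul_pow, Real.sq_sqrt (by positivity), ← pow_mul, mul_comm n 2, pow_mul]
    norm_num
    exact choose_bound n (k + 1)
  have hk' : (k : ℝ) + 1 ≤ n := by exact_mod_cast hk
  have hs2 : Real.sqrt n * Real.sqrt n = n := Real.mul_self_sqrt (by positivity)
  calc (n.choose (k + 1) : ℝ) * (k + 1) ≤ n.choose (k + 1) * (Real.sqrt n * Real.sqrt n) := by
        rw [hs2]; gcongr
    _ = (n.choose (k + 1) * Real.sqrt n) * Real.sqrt n := by ring
    _ ≤ _ := by gcongr

lemma av_diff {f : (Fin n → Bool) → ℝ} (hf : ∀ i x, x i = true → f (fl i x) ≤ f x) (k0 k1 : ℕ)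
    (h01 : k0 ≤ k1) (hk : k1 ≤ n) :
    (∑ k ∈ Finset.Ico k0 k1, ed f k) / 2 ^ n / Real.sqrt n ≤ av f k1 - av f k0 := by
  rw [← Finset.sum_Ico_sub (av f) h01, Finset.sum_div, Finset.sum_div]
  refine Finset.sum_le_sum fun k hk' => av_step hf k ?_
  have := (Finset.mem_Ico.1 hk').2
  omega

lemma av_mono {f : (Fin n → Bool) → ℝ} (hf : ∀ i x, x i = true → f (fl i x) ≤ f x) {k0 k1 : ℕ}
    (h01 : k0 ≤ k1) (hk : k1 ≤ n) : av f k0 ≤ av f k1 := by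
  have h := av_diff hf k0 k1 h01 hk
  have : 0 ≤ ∑ k ∈ Finset.Ico k0 k1, ed f k := Finset.sum_nonneg fun k _ => ed_nonneg hf k
  have : 0 ≤ (∑ k ∈ Finset.Ico k0 k1, ed f k) / 2 ^ n / Real.sqrt n := by positivity
  linarith

lemma E_av (f : (Fin n → Bool) → ℝ) (g : ℕ → ℝ) :
    cubeE n (fun x => f x * g (wt x)) = cubeE n (fun x => av f (wt x) * g (wt x)) := by
  have key : ∀ F : (Fin n → Bool) → ℝ, ∑ x, F x * g (wt x)
      = ∑ k ∈ Finset.range (n + 1), lay F k * g k := by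
    intro F
    simp_rw [lay, Finset.sum_mul]
    rw [Finset.sum_comm]
    refine Finset.sum_congr rfl fun x _ => ?_
    have hx : wt x ∈ Finset.range (n + 1) := by simpa [Nat.lt_succ_iff] using wt_le x
    rw [Finset.sum_eq_single_of_mem (wt x) hx]
    · simp
    · intro b _ hb
      simp [Ne.symm hb]
  unfold cubeE
  rw [key, key (fun x => av f (wt x))]
  congr 1
  refine Finset.sum_congr rfl fun k hk => ?_
  congr 1
  have hk' : k ≤ n := by simpa [Nat.lt_succ_iff] using hk
  have e : lay (fun x : Fin n → Bool => av f (wt x)) k = av f k * lay (n := n) (fun _ => 1) k := by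
    rw [lay, lay, Finset.mul_sum]
    refine Finset.sum_congr rfl fun x _ => ?_
    split_ifs with h
    · rw [h, mul_one]
    · simp
  have hc0 : (0 : ℝ) < n.choose k := by exact_mod_cast Nat.choose_pos hk'
  rw [e, lay_one k hk', av]
  field_simp

lemma Maj_eq (x : Fin n → Bool) : Maj n x = if n < 2 * wt x then 1 else 0 := by
  have h : (∑ i, (if x i then (1 : ℝ) else 0)) = wt x := by
    simp [wt]
  unfold Maj
  rw [h]
  have : (n : ℝ) / 2 < wt x ↔ n < 2 * wt x := by
    rw [div_lt_iff₀ (by norm_num)]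
    constructor
    · intro h; have : (n : ℝ) < ((2 * wt x : ℕ) : ℝ) := by push_cast; linarith
      exact_mod_cast this
    · intro h; have : (n : ℝ) < ((2 * wt x : ℕ) : ℝ) := by exact_mod_cast h
      push_cast at this; linarith
  simp [this]

lemma cov_lower {f : (Fin n → Bool) → ℝ} (hf : ∀ i x, x i = true → f (fl i x) ≤ f x) (k0 k1 : ℕ)
    (h0 : 2 * k0 ≤ n) (h1 : n < 2 * k1) (hk : k1 ≤ n) :
    cubeE n (fun x => if k1 ≤ wt x then 1 else 0) * cubeE n (fun x => if wt x ≤ k0 then 1 else 0)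
      * (av f k1 - av f k0) ≤ cubeCov n f (Maj n) := by
  set φ : ℕ → ℝ := fun k => if n < 2 * k then 1 else 0 with hφ
  have hM : Maj n = fun x => φ (wt x) := by funext x; rw [Maj_eq]
  set q := cubeE n (fun x => φ (wt x)) with hq
  set P1 := cubeE n (fun x => if k1 ≤ wt x then (1 : ℝ) else 0) with hP1
  set P0 := cubeE n (fun x => if wt x ≤ k0 then (1 : ℝ) else 0) with hP0
  set τ := av f (n / 2) with hτ
  have hn2 : n / 2 ≤ n := Nat.div_le_self _ _
  have hqP1 : P1 ≤ q := by
    refine E_mono fun x => ?_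
    simp only [hφ]
    split_ifs <;> first | omega | norm_num
  have hqP0 : P0 ≤ 1 - q := by
    rw [hq, ← E_const (n := n) 1, ← E_sub]
    refine E_mono fun x => ?_
    simp only [hφ]
    split_ifs <;> first | omega | norm_num
  have hP00 : 0 ≤ P0 := E_nonneg fun x => by split_ifs <;> norm_num
  have hP10 : 0 ≤ P1 := E_nonneg fun x => by split_ifs <;> norm_num
  have m1 : τ ≤ av f k1 := av_mono hf (by omega) hk
  have m0 : av f k0 ≤ τ := av_mono hf (by omega) (by omega)
  have hcov : cubeCov n f (Maj n) = cubeE n (fun x => (av f (wt x) - τ) * (φ (wt x) - q)) := by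
    have e1 : cubeCov n f (Maj n) = cubeE n (fun x => f x * (φ (wt x) - q)) := by
      rw [cubeCov, hM, mul_comm (cubeE n f), ← E_mul, ← E_sub]
      congr 1; funext x; ring
    rw [e1, E_av f (fun k => φ k - q)]
    have e2 : cubeE n (fun x => (av f (wt x) - τ) * (φ (wt x) - q))
        = cubeE n (fun x => av f (wt x) * (φ (wt x) - q)) - τ * (q - cubeE n (fun _ => q)) := by
      rw [hq, ← E_sub, ← E_mul, ← E_sub]
      congr 1; funext x; ring
    rw [e2, E_const]; ring
  have hlow : (av f k1 - τ) * (1 - q) * P1 + (τ - av f k0) * q * P0 ≤ cubeCov n f (Maj n) := by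
    rw [hcov, hP1, hP0, ← E_mul, ← E_mul, ← E_add]
    refine E_mono fun x => ?_
    have hq0 : 0 ≤ q := hP10.trans hqP1
    have hq1 : 0 ≤ 1 - q := hP00.trans hqP0
    have hx := wt_le x
    by_cases hw : n < 2 * wt x
    · have hφx : φ (wt x) = 1 := if_pos hw
      have hn0 : ¬ wt x ≤ k0 := by omega
      rw [hφx, if_neg hn0]
      have m2 : τ ≤ av f (wt x) := av_mono hf (by omega) hx
      split_ifs with h
      · have : av f k1 ≤ av f (wt x) := av_mono hf h hx
        nlinarith
      · nlinarith
    · have hφx : φ (wt x) = 0 := if_neg hw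
      have hn0 : ¬ k1 ≤ wt x := by omega
      rw [hφx, if_neg hn0]
      have m2 : av f (wt x) ≤ τ := av_mono hf (by omega) hn2
      split_ifs with h
      · have : av f (wt x) ≤ av f k0 := av_mono hf h (by omega)
        nlinarith
      · nlinarith
  refine le_trans ?_ hlow
  have t1 : (av f k1 - τ) * P0 * P1 ≤ (av f k1 - τ) * (1 - q) * P1 := by
    gcongr
  have t2 : (τ - av f k0) * P1 * P0 ≤ (τ - av f k0) * q * P0 := by
    gcongr
  nlinarith

/-- complement of a point -/
def cpl (x : Fin n → Bool) : Fin n → Bool := fun i => !(x i)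

lemma wt_cpl (x : Fin n → Bool) : wt (cpl x) + wt x = n := by
  have h1 := Finset.card_filter_add_card_filter_not (s := (Finset.univ : Finset (Fin n)))
    (fun i => x i = true)
  rw [Finset.card_univ, Fintype.card_fin] at h1
  have h2 : wt (cpl x) = (Finset.univ.filter fun i => ¬ (x i = true)).card := by
    simp [wt, cpl]
  rw [h2, add_comm]
  exact h1

lemma P_symm (k : ℕ) (hk : k ≤ n) : cubeE n (fun x => if wt x ≤ n - k then (1 : ℝ) else 0)
    = cubeE n (fun x => if k ≤ wt x then (1 : ℝ) else 0) := by
  unfold cubeE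
  congr 1
  refine Finset.sum_nbij' cpl cpl ?_ ?_ ?_ ?_ ?_
  · simp
  · simp
  · intro x _; funext i; simp [cpl]
  · intro x _; funext i; simp [cpl]
  · intro x _
    have := wt_cpl x
    have : wt x ≤ n - k ↔ k ≤ wt (cpl x) := by omega
    simp [this]


/-- sum of signs -/
noncomputable def Sm (x : Fin n → Bool) : ℝ := ∑ i, sg (x i)

lemma Sm_eq (x : Fin n → Bool) : Sm x = 2 * wt x - n := by
  have h : ∀ i, sg (x i) = 2 * (if x i = true then (1 : ℝ) else 0) - 1 := by
    intro i; cases x i <;> simp [sg]; norm_num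
  unfold Sm
  simp_rw [h]
  rw [Finset.sum_sub_distrib, ← Finset.mul_sum]
  simp [wt]

lemma E_prod (g : Bool → ℝ) :
    cubeE n (fun x => ∏ i, g (x i)) = ((g true + g false) / 2) ^ n := by
  have h := Finset.prod_univ_sum (fun _ : Fin n => (Finset.univ : Finset Bool)) (fun _ b => g b)
  rw [Fintype.piFinset_univ] at h
  unfold cubeE
  rw [← h]
  simp [div_pow]

lemma E_exp (t : ℝ) : cubeE n (fun x => Real.exp (t * Sm x)) = Real.cosh t ^ n := by
  have : (fun x : Fin n → Bool => Real.exp (t * Sm x))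
      = fun x => ∏ i, (fun b => Real.exp (t * sg b)) (x i) := by
    funext x
    rw [Sm, Finset.mul_sum, Real.exp_sum]
  rw [this, E_prod (fun b => Real.exp (t * sg b)), Real.cosh_eq]
  simp [sg]

lemma cosh_lower (t : ℝ) : 1 + t ^ 2 / 2 ≤ Real.cosh t := by
  have h1 : Real.cosh t = 1 + 2 * Real.sinh (t / 2) ^ 2 := by
    have h2 := Real.cosh_two_mul (t / 2)
    rw [show 2 * (t / 2) = t by ring] at h2
    have h3 := Real.cosh_sq (t / 2)
    linarith
  have h4 : (t / 2) ^ 2 ≤ Real.sinh (t / 2) ^ 2 := by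
    rw [sq_le_sq]
    rcases le_total 0 (t / 2) with h | h
    · have := Real.self_le_sinh_iff.2 h
      rw [abs_of_nonneg h, abs_of_nonneg (h.trans this)]; exact this
    · have := Real.sinh_le_self_iff.2 h
      rw [abs_of_nonpos h, abs_of_nonpos (this.trans h)]; linarith
  rw [h1]; nlinarith

lemma tail (L : ℝ) (hL : 0 ≤ L) (hn : (4 * L + 4) ^ 2 ≤ n) :
    Real.exp (-2 * (4 * L + 4) ^ 2)
      ≤ cubeE n (fun x => if L * Real.sqrt n ≤ Sm x then (1 : ℝ) else 0) := by
  set l := 4 * L + 4 with hl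
  have hl4 : 4 ≤ l := by linarith
  have hn0 : (0 : ℝ) < n := by nlinarith
  set s := Real.sqrt n with hs
  have hs0 : 0 < s := Real.sqrt_pos.2 hn0
  have hs2 : s ^ 2 = n := Real.sq_sqrt hn0.le
  set t := l / s with ht
  have ht0 : 0 < t := by positivity
  have ht2 : t ^ 2 * n = l ^ 2 := by rw [ht, div_pow, hs2]; field_simp
  set Q : (Fin n → Bool) → ℝ := fun x => if L * s ≤ Sm x then (1 : ℝ) else 0 with hQ
  have hlow : Real.exp (l * (L + 1)) ≤ cubeE n (fun x => Real.exp (t * Sm x)) := by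
    rw [E_exp]
    have hy1 : t ^ 2 ≤ 1 := by
      rw [ht, div_pow, hs2, div_le_one hn0]; exact hn
    have h1 : Real.exp (t ^ 2 / 4) ≤ Real.cosh t := by
      refine le_trans ?_ (cosh_lower t)
      have hy : 0 < 1 + t ^ 2 / 2 := by positivity
      rw [← Real.le_log_iff_exp_le hy]
      refine le_trans ?_ (Real.one_sub_inv_le_log_of_pos hy)
      rw [← sub_nonneg]
      have : 1 - (1 + t ^ 2 / 2)⁻¹ - t ^ 2 / 4 = (t ^ 2 / 4 * (1 - t ^ 2 / 2)) / (1 + t ^ 2 / 2) := by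
        field_simp; ring
      rw [this]
      apply div_nonneg _ hy.le
      apply mul_nonneg (by positivity)
      linarith
    calc Real.exp (l * (L + 1)) = Real.exp (t ^ 2 / 4) ^ n := by
          rw [← Real.exp_nat_mul]
          congr 1
          have : (n : ℝ) * (t ^ 2 / 4) = (t ^ 2 * n) / 4 := by ring
          rw [this, ht2, hl]; ring
      _ ≤ _ := by gcongr
  have hsplit : cubeE n (fun x => Real.exp (t * Sm x))
      ≤ Real.exp (l * L) + cubeE n (fun x => Real.exp (t * Sm x) * Q x) := by
    rw [← E_const (n := n) (Real.exp (l * L)), ← E_add]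
    refine E_mono fun x => ?_
    simp only [hQ]
    split_ifs with h
    · rw [mul_one]; linarith [Real.exp_pos (l * L)]
    · rw [mul_zero, add_zero, Real.exp_le_exp]
      have e : t * (L * s) = l * L := by rw [ht]; field_simp
      nlinarith [not_le.1 h]
  have hone : 1 ≤ cubeE n (fun x => Real.exp (t * Sm x) * Q x) := by
    have e1 : Real.exp (l * (L + 1)) = Real.exp (l * L) * Real.exp l := by
      rw [← Real.exp_add]; congr 1; ring
    have e2 : 2 ≤ Real.exp l := by linarith [Real.add_one_le_exp l]
    have e3 : 1 ≤ Real.exp (l * L) := Real.one_le_exp (by positivity)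
    nlinarith
  have hcs := E_cs (fun x => Real.exp (t * Sm x)) Q
  have hZ : cubeE n (fun x => Real.exp (t * Sm x) ^ 2) ≤ Real.exp (2 * l ^ 2) := by
    have e : (fun x : Fin n → Bool => Real.exp (t * Sm x) ^ 2)
        = fun x => Real.exp ((2 * t) * Sm x) := by
      funext x
      rw [← Real.exp_nat_mul]; congr 1; push_cast; ring
    rw [e, E_exp]
    calc Real.cosh (2 * t) ^ n ≤ Real.exp ((2 * t) ^ 2 / 2) ^ n := by
          have := Real.cosh_le_exp_half_sq (2 * t)
          have h0 := Real.cosh_pos (2 * t)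
          gcongr
      _ = _ := by
          rw [← Real.exp_nat_mul]
          congr 1
          linear_combination 2 * ht2
  have hQ2 : (fun x => Q x ^ 2) = Q := by
    funext x; simp only [hQ]; split_ifs <;> norm_num
  rw [hQ2] at hcs
  have hQ0 : 0 ≤ cubeE n Q := E_nonneg fun x => by simp only [hQ]; split_ifs <;> norm_num
  have h1 : 1 ≤ Real.exp (2 * l ^ 2) * cubeE n Q := by
    calc (1 : ℝ) ≤ cubeE n (fun x => Real.exp (t * Sm x) * Q x) ^ 2 := one_le_pow₀ hone
      _ ≤ _ := hcs
      _ ≤ _ := by gcongr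
  rw [neg_mul, Real.exp_neg, inv_le_iff_one_le_mul₀' (Real.exp_pos _)]
  exact h1

lemma E_Sm_sq : cubeE n (fun x => Sm x ^ 2) = n := by
  have h : (fun x : Fin n → Bool => Sm x ^ 2)
      = fun x => ∑ i, ∑ j, sg (x i) * sg (x j) := by
    funext x; rw [Sm, sq, Finset.sum_mul_sum]
  have h2 : ∀ i j : Fin n, cubeE n (fun x => sg (x i) * sg (x j)) = if i = j then 1 else 0 := by
    intro i j
    split_ifs with hij
    · subst hij; simp_rw [sg_sq]; exact E_const 1
    · have h3 := E_fl i (fun x => sg (x i) * sg (x j))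
      simp only [fl_same, fl_ne (Ne.symm hij), sg_not] at h3
      have h4 : cubeE n (fun x => -sg (x i) * sg (x j))
          = -1 * cubeE n (fun x => sg (x i) * sg (x j)) := by
        rw [← E_mul]; congr 1; funext x; ring
      linarith
  rw [h, E_sum]
  simp_rw [E_sum, h2]
  simp

lemma E_abs_Sm : cubeE n (fun x => |Sm x|) ≤ Real.sqrt n := by
  apply Real.le_sqrt_of_sq_le
  have h := E_cs (n := n) (fun x => |Sm x|) (fun _ => 1)
  simp only [mul_one, sq_abs, one_pow, E_const, E_Sm_sq] at h
  exact h


lemma abs_diff_eq {f : (Fin n → Bool) → ℝ} (hf : ∀ i x, x i = true → f (fl i x) ≤ f x)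
    (i : Fin n) (x : Fin n → Bool) : |f x - f (fl i x)| = (f x - f (fl i x)) * sg (x i) := by
  cases hx : x i
  · have h := hf i (fl i x) (by simp [fl_same, hx])
    rw [fl_fl] at h
    rw [abs_of_nonpos (by linarith)]
    simp [sg]
  · have h := hf i x hx
    rw [abs_of_nonneg (by linarith)]
    simp [sg]

lemma inf_bound {f : (Fin n → Bool) → ℝ} (hf : ∀ i x, x i = true → f (fl i x) ≤ f x)
    (h01 : ∀ x, f x = 0 ∨ f x = 1) (I : ℝ)
    (hI : ∀ i, cubeE n (fun x => |f x - f (fl i x)|) = I) (hn : 0 < n) :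
    I / 2 ≤ 1 / Real.sqrt n := by
  have h1 : ∀ i, fc f {i} = I / 2 := by
    intro i
    have h := fc_diff f i {i}
    rw [if_pos (Finset.mem_singleton_self i)] at h
    rw [← h, ← hI i, fc, div_eq_inv_mul, ← E_mul]
    congr 1
    funext x
    rw [abs_diff_eq hf]
    simp [ch]
    ring
  have h2 : ∑ i : Fin n, fc f {i} ^ 2 ≤ ∑ S : Finset (Fin n), fc f S ^ 2 := by
    rw [← Finset.sum_image (s := Finset.univ) (g := fun i : Fin n => ({i} : Finset (Fin n)))
      (f := fun S => fc f S ^ 2) (by intro a _ b _ hab; simpa using hab)]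
    exact Finset.sum_le_sum_of_subset_of_nonneg (Finset.subset_univ _) fun _ _ _ => sq_nonneg _
  have h3 : cubeE n (fun x => f x ^ 2) ≤ 1 := by
    rw [← E_const (n := n) 1]
    refine E_mono fun x => ?_
    rcases h01 x with h | h <;> rw [h] <;> norm_num
  rw [parseval] at h2
  simp_rw [h1] at h2
  rw [Finset.sum_const, Finset.card_univ, Fintype.card_fin, nsmul_eq_mul] at h2
  have hn' : (0 : ℝ) < n := by exact_mod_cast hn
  refine le_of_sq'' ?_ (by positivity)
  rw [div_pow 1, Real.sq_sqrt hn'.le, one_pow, le_div_iff₀ hn']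
  linarith

/-- tent function -/
noncomputable def tent (x : Fin n → Bool) : ℝ := max 0 (1 - |Sm x| / (16 * Real.sqrt n))

lemma tent_nonneg (x : Fin n → Bool) : 0 ≤ tent x := le_max_left _ _

lemma tent_le_one (x : Fin n → Bool) : tent x ≤ 1 := by
  refine max_le (by norm_num) ?_
  have : 0 ≤ |Sm x| / (16 * Real.sqrt n) := by positivity
  linarith

lemma Sm_fl (i : Fin n) (x : Fin n → Bool) : |Sm x - Sm (fl i x)| = 2 := by
  rw [Sm_eq, Sm_eq]
  cases hx : x i
  · rw [wt_fl_false hx]; push_cast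
    rw [show 2 * (wt x : ℝ) - n - (2 * (wt x + 1) - n) = -2 by ring]; norm_num
  · rw [← wt_fl_true hx]; push_cast
    rw [show 2 * ((wt (fl i x) : ℝ) + 1) - n - (2 * wt (fl i x) - n) = 2 by ring]; norm_num

lemma tent_fl (i : Fin n) (x : Fin n → Bool) (hn : 0 < n) :
    |tent x - tent (fl i x)| ≤ 1 / (8 * Real.sqrt n) := by
  have hs : 0 < Real.sqrt n := Real.sqrt_pos.2 (by exact_mod_cast hn)
  unfold tent
  refine (abs_max_sub_max_le_max _ _ _ _).trans ?_
  rw [sub_self, abs_zero, max_eq_right (abs_nonneg _)]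
  rw [show 1 - |Sm x| / (16 * Real.sqrt n) - (1 - |Sm (fl i x)| / (16 * Real.sqrt n))
    = -((|Sm x| - |Sm (fl i x)|) / (16 * Real.sqrt n)) by ring, abs_neg, abs_div,
    abs_of_pos (show 0 < 16 * Real.sqrt n by positivity)]
  have h := (abs_abs_sub_abs_le (Sm x) (Sm (fl i x))).trans (Sm_fl i x).le
  rw [div_le_div_iff₀ (by positivity) (by positivity)]
  nlinarith

set_option maxHeartbeats 1000000 in
lemma local_inf {f : (Fin n → Bool) → ℝ} (hf : ∀ i x, x i = true → f (fl i x) ≤ f x)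
    (h01 : ∀ x, f x = 0 ∨ f x = 1) (hE : cubeE n f = 1 / 2) (I : ℝ)
    (hI : ∀ i, cubeE n (fun x => |f x - f (fl i x)|) = I) (d : ℕ) (hd : 1 ≤ d)
    (hdn : 9 ^ (4 * d) ≤ n) :
    (d : ℝ) / 40 ≤ ∑ i, cubeE n (fun x => |f x - f (fl i x)| * tent x / 2) := by
  have hn : 0 < n := lt_of_lt_of_le (by positivity) hdn
  have hn' : (0 : ℝ) < n := by exact_mod_cast hn
  have hs : 0 < Real.sqrt n := Real.sqrt_pos.2 hn'
  have hf0 : ∀ x, 0 ≤ f x := fun x => by rcases h01 x with h | h <;> rw [h]; norm_num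
  have hf1 : ∀ x, f x ≤ 1 := fun x => by rcases h01 x with h | h <;> rw [h]; norm_num
  have hff : ∀ x, f x ^ 2 = f x := fun x => by rcases h01 x with h | h <;> rw [h] <;> norm_num
  have habs1 : ∀ i x, |f x - f (fl i x)| ≤ 1 := fun i x => by
    rw [abs_le]; constructor <;> linarith [hf0 x, hf1 x, hf0 (fl i x), hf1 (fl i x)]
  have hUabs : ∀ i x, |(f x - f (fl i x)) * tent x / 2| = |f x - f (fl i x)| * tent x / 2 := by
    intro i x
    rw [abs_div, abs_mul, abs_of_nonneg (tent_nonneg x), abs_two]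
  have hk := kkl (fun x => f x * tent x) (fun i x => (f x - f (fl i x)) * tent x / 2)
    (fun i x => f (fl i x) * (tent x - tent (fl i x)) / 2) (fun i x => by ring)
    (fun i x => by
      rw [hUabs]
      nlinarith [habs1 i x, abs_nonneg (f x - f (fl i x)), tent_nonneg x, tent_le_one x])
    (1 / Real.sqrt n) (1 / 256)
    (fun i => by
      simp_rw [hUabs]
      refine le_trans ?_ (inf_bound hf h01 I hI hn)
      rw [← hI i, div_eq_inv_mul _ (2 : ℝ), ← E_mul]
      refine E_mono fun x => ?_
      nlinarith [abs_nonneg (f x - f (fl i x)), tent_nonneg x, tent_le_one x])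
    (by
      have hb : ∀ i, cubeE n (fun x => (f (fl i x) * (tent x - tent (fl i x)) / 2) ^ 2)
          ≤ 1 / (256 * n) := by
        intro i
        rw [← E_const (n := n) (1 / (256 * (n : ℝ)))]
        refine E_mono fun x => ?_
        have h1 := tent_fl i x hn
        have h2 : (tent x - tent (fl i x)) ^ 2 ≤ (1 / (8 * Real.sqrt n)) ^ 2 := by
          rw [← sq_abs]; gcongr
        have h3 : (1 / (8 * Real.sqrt n)) ^ 2 = 4 * (1 / (256 * (n : ℝ))) := by
          rw [div_pow, mul_pow, Real.sq_sqrt hn'.le]; field_simp; norm_num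
        rw [h3] at h2
        have h4 : (f (fl i x) * (tent x - tent (fl i x)) / 2) ^ 2
            = f (fl i x) * (tent x - tent (fl i x)) ^ 2 / 4 := by
          rw [div_pow, mul_pow, hff]; norm_num
        rw [h4]
        nlinarith [hf0 (fl i x), hf1 (fl i x), sq_nonneg (tent x - tent (fl i x))]
      refine (Finset.sum_le_sum fun i _ => hb i).trans ?_
      rw [Finset.sum_const, Finset.card_univ, Fintype.card_fin, nsmul_eq_mul]
      apply le_of_eq; field_simp)
    d hd
  simp_rw [hUabs] at hk
  set W := ∑ i, cubeE n (fun x => |f x - f (fl i x)| * tent x / 2) with hW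
  have hW0 : 0 ≤ W := Finset.sum_nonneg fun i _ => E_nonneg fun x => by
    have := tent_nonneg x; positivity
  have hvar : 1 / 8 ≤ cubeE n (fun x => (f x * tent x) ^ 2) - cubeE n (fun x => f x * tent x) ^ 2 := by
    have a1 : cubeE n (fun x => f x * tent x) ≤ 1 / 2 := by
      rw [← hE]
      exact E_mono fun x => by nlinarith [hf0 x, tent_le_one x]
    have a0 : 0 ≤ cubeE n (fun x => f x * tent x) :=
      E_nonneg fun x => mul_nonneg (hf0 x) (tent_nonneg x)
    have a2 : 1 / 2 - 1 / 8 ≤ cubeE n (fun x => (f x * tent x) ^ 2) := by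
      have b1 : cubeE n f - (1 / (8 * Real.sqrt n)) * cubeE n (fun x => |Sm x|)
          ≤ cubeE n (fun x => (f x * tent x) ^ 2) := by
        rw [← E_mul, ← E_sub]
        refine E_mono fun x => ?_
        rw [mul_pow, hff]
        have c1 : 1 - |Sm x| / (16 * Real.sqrt n) ≤ tent x := le_max_right _ _
        have c2 : 1 / (8 * Real.sqrt n) * |Sm x| = 2 * (|Sm x| / (16 * Real.sqrt n)) := by
          field_simp; ring
        have c3 : 0 ≤ |Sm x| / (16 * Real.sqrt n) := by positivity
        rw [c2]
        rcases h01 x with h | h <;> rw [h]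
        · nlinarith
        · nlinarith [sq_nonneg (tent x - 1)]
      have b2 : (1 / (8 * Real.sqrt n)) * cubeE n (fun x => |Sm x|) ≤ 1 / 8 := by
        calc (1 / (8 * Real.sqrt n)) * cubeE n (fun x => |Sm x|)
            ≤ (1 / (8 * Real.sqrt n)) * Real.sqrt n := by
              gcongr
              exact E_abs_Sm
          _ = 1 / 8 := by field_simp
      rw [hE] at b1
      linarith
    nlinarith
  have hd' : (1 : ℝ) ≤ d := by exact_mod_cast hd
  have hcoef : 3 ^ d * Real.sqrt (1 / Real.sqrt n) ≤ 1 / d := by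
    have e1 : (81 : ℝ) ^ d ≤ Real.sqrt n := by
      apply Real.le_sqrt_of_sq_le
      rw [← pow_mul, mul_comm d 2, pow_mul]
      have : ((9 ^ (4 * d) : ℕ) : ℝ) ≤ n := by exact_mod_cast hdn
      push_cast at this
      rw [pow_mul] at this
      norm_num at this ⊢
      exact this
    have e2 : Real.sqrt (1 / Real.sqrt n) ≤ 1 / 9 ^ d := by
      apply Real.sqrt_le_iff.2
      refine ⟨by positivity, ?_⟩
      rw [div_pow, one_pow, ← pow_mul, mul_comm d 2, pow_mul]
      norm_num
      gcongr
    have e3 : (d : ℝ) ≤ 3 ^ d := by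
      exact_mod_cast (Nat.lt_pow_self (by norm_num : 1 < 3)).le
    calc 3 ^ d * Real.sqrt (1 / Real.sqrt n) ≤ 3 ^ d * (1 / 9 ^ d) := by gcongr
      _ = 1 / 3 ^ d := by
        rw [show (9 : ℝ) = 3 * 3 by norm_num, mul_pow]; field_simp
      _ ≤ 1 / d := by gcongr
  have hfin : 1 / 8 ≤ 2 * (1 / d) * W + 2 * (1 / 256) + (2 * W + 2 * (1 / 256)) / d := by
    refine hvar.trans (hk.trans ?_)
    have : 2 * 3 ^ d * Real.sqrt (1 / Real.sqrt n) * W ≤ 2 * (1 / d) * W := by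
      rw [mul_assoc 2]
      gcongr
    linarith
  have h2 : (1 / 8 : ℝ) * d ≤ 4 * W + 2 / 256 * d + 2 / 256 := by
    calc (1 / 8 : ℝ) * d ≤ (2 * (1 / d) * W + 2 * (1 / 256) + (2 * W + 2 * (1 / 256)) / d) * d := by
          gcongr
      _ = _ := by field_simp; ring
  linarith

lemma half_sum (i : Fin n) (g : (Fin n → Bool) → ℝ) :
    ∑ x, g x = ∑ x, if x i = true then g x + g (fl i x) else 0 := by
  have h1 : ∑ x, g x = ∑ x, (if x i = true then g x else 0) + ∑ x, (if x i = true then 0 else g x) := by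
    rw [← Finset.sum_add_distrib]
    refine Finset.sum_congr rfl fun x _ => ?_
    split_ifs <;> simp
  rw [h1, ← sum_fl i (fun x => if x i = true then 0 else g x), ← Finset.sum_add_distrib]
  refine Finset.sum_congr rfl fun x _ => ?_
  rw [fl_same]
  cases x i <;> simp

lemma tent_window (x : Fin n → Bool) (k1 : ℕ) (hk1 : (n : ℝ) + 16 * Real.sqrt n ≤ 2 * k1)
    (hn : 0 < n) (h : tent x ≠ 0) : n < wt x + k1 ∧ wt x < k1 := by
  have hs : 0 < Real.sqrt n := Real.sqrt_pos.2 (by exact_mod_cast hn)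
  have h1 : |Sm x| < 16 * Real.sqrt n := by
    by_contra hc
    apply h
    unfold tent
    apply max_eq_left
    have : 1 ≤ |Sm x| / (16 * Real.sqrt n) := by
      rw [le_div_iff₀ (by positivity)]; linarith
    linarith
  rw [Sm_eq, abs_lt] at h1
  constructor
  · have : (n : ℝ) < wt x + k1 := by linarith
    exact_mod_cast this
  · have : (wt x : ℝ) < k1 := by linarith
    exact_mod_cast this

lemma window_sum {f : (Fin n → Bool) → ℝ} (hf : ∀ i x, x i = true → f (fl i x) ≤ f x) (k1 : ℕ)
    (hk1 : (n : ℝ) + 16 * Real.sqrt n ≤ 2 * k1) (hn : 0 < n) :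
    ∑ i, cubeE n (fun x => |f x - f (fl i x)| * tent x / 2)
      ≤ (∑ k ∈ Finset.Ico (n - k1) k1, ed f k) / 2 ^ n := by
  unfold cubeE
  rw [← Finset.sum_div]
  gcongr
  unfold ed
  rw [Finset.sum_comm (s := Finset.Ico (n - k1) k1)]
  refine Finset.sum_le_sum fun i _ => ?_
  rw [half_sum i, Finset.sum_comm (s := Finset.Ico (n - k1) k1)]
  refine Finset.sum_le_sum fun x _ => ?_
  by_cases hx : x i = true
  · simp only [hx, if_true, and_true, fl_fl]
    have hd := hf i x hx
    rw [abs_sub_comm (f (fl i x)), abs_of_nonneg (by linarith : 0 ≤ f x - f (fl i x))]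
    have hw := wt_fl_true hx
    by_cases ht : tent x = 0 ∧ tent (fl i x) = 0
    · rw [ht.1, ht.2]
      simp only [mul_zero, zero_div, add_zero]
      refine Finset.sum_nonneg fun k _ => ?_
      split_ifs <;> linarith
    · have hmem : wt (fl i x) ∈ Finset.Ico (n - k1) k1 := by
        rw [Finset.mem_Ico]
        rw [not_and_or] at ht
        rcases ht with ht | ht
        · have := tent_window x k1 hk1 hn ht
          omega
        · have := tent_window (fl i x) k1 hk1 hn ht
          omega
      have : f x - f (fl i x) ≤ ∑ k ∈ Finset.Ico (n - k1) k1,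
          if wt x = k + 1 then f x - f (fl i x) else 0 := by
        refine le_trans (le_of_eq ?_) (Finset.single_le_sum (f := fun k =>
          if wt x = k + 1 then f x - f (fl i x) else 0) (fun k _ => ?_) hmem)
        · simp [hw]
        · split_ifs <;> linarith
      refine le_trans ?_ this
      nlinarith [tent_le_one x, tent_le_one (fl i x)]
  · simp [hx]


lemma fl_le {i : Fin n} {x : Fin n → Bool} (h : x i = true) (j : Fin n) : fl i x j ≤ x j := by
  by_cases hj : j = i
  · subst hj; rw [h]; exact Bool.le_true _
  · rw [fl_ne hj]

lemma ind_01 (A : Set (Fin n → Bool)) (x : Fin n → Bool) :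
    A.indicator (fun _ => (1 : ℝ)) x = 0 ∨ A.indicator (fun _ => (1 : ℝ)) x = 1 := by
  by_cases h : x ∈ A <;> simp [h]

lemma ind_mono (A : Set (Fin n → Bool))
    (hA : ∀ x y : Fin n → Bool, (∀ i, x i ≤ y i) → x ∈ A → y ∈ A) :
    ∀ (i : Fin n) (x : Fin n → Bool), x i = true →
      A.indicator (fun _ => (1 : ℝ)) (fl i x) ≤ A.indicator (fun _ => (1 : ℝ)) x := by
  intro i x hx
  by_cases h : fl i x ∈ A
  · have : x ∈ A := hA _ _ (fl_le hx) h
    simp [h, this]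
  · rw [Set.indicator_of_notMem h]
    exact Set.indicator_nonneg (fun _ _ => by norm_num) _

lemma influence_eq (A : Set (Fin n → Bool)) (k : Fin n) :
    cubeE n (fun x => |A.indicator (fun _ => (1 : ℝ)) x - A.indicator (fun _ => (1 : ℝ)) (fl k x)|)
      = influence n A k := by
  set B : Set (Fin n → Bool) := {x | x ∈ A ∧ fl k x ∉ A} with hB
  have e0 : influence n A k = 2 * cubeE n (B.indicator fun _ => 1) := rfl
  have e1 := E_fl k (B.indicator fun _ => (1 : ℝ))
  have e2 : cubeE n (fun x => |A.indicator (fun _ => (1 : ℝ)) x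
      - A.indicator (fun _ => (1 : ℝ)) (fl k x)|)
      = cubeE n (B.indicator fun _ => 1) + cubeE n (fun x => B.indicator (fun _ => 1) (fl k x)) := by
    rw [← E_add]
    congr 1
    funext x
    by_cases h1 : x ∈ A <;> by_cases h2 : fl k x ∈ A <;>
      simp [hB, h1, h2, fl_fl, Set.indicator]
  rw [e2, e1, e0]; ring

lemma small_n {f : (Fin n → Bool) → ℝ} (hn : 1 ≤ n) (hf : ∀ i x, x i = true → f (fl i x) ≤ f x)
    (h01 : ∀ x, f x = 0 ∨ f x = 1) (hE : cubeE n f = 1 / 2) :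
    1 / 4 ^ n ≤ cubeCov n f (Maj n) := by
  have h := cov_lower hf 0 n (by omega) (by omega) le_rfl
  have hs := P_symm (n := n) n le_rfl
  rw [Nat.sub_self] at hs
  rw [hs] at h
  have hP : (1 : ℝ) / 2 ^ n ≤ cubeE n (fun x => if n ≤ wt x then (1 : ℝ) else 0) := by
    unfold cubeE
    gcongr
    refine le_trans (le_of_eq ?_) (Finset.single_le_sum (f := fun x : Fin n → Bool =>
      if n ≤ wt x then (1 : ℝ) else 0) (fun x _ => ?_) (Finset.mem_univ (fun _ => true)))
    · have : wt (fun _ : Fin n => true) = n := wt_eq_n.2 rfl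
      simp [this]
    · split_ifs <;> norm_num
  have hmean : cubeE n f = cubeE n (fun x => av f (wt x)) := by
    have := E_av f (fun _ => 1)
    simpa using this
  have ha0 : av f 0 = f (fun _ => false) := by simp [av, lay_zero]
  have han : av f n = f (fun _ => true) := by simp [av, lay_n]
  have hd : av f n - av f 0 = 1 := by
    have b0 : av f 0 ≤ 1 / 2 := by
      rw [← hE, hmean, ← E_const (n := n) (av f 0)]
      exact E_mono fun x => av_mono hf (Nat.zero_le _) (wt_le x)
    have b1 : 1 / 2 ≤ av f n := by
      rw [← hE, hmean, ← E_const (n := n) (av f n)]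
      exact E_mono fun x => av_mono hf (wt_le x) le_rfl
    rw [ha0] at b0 ⊢
    rw [han] at b1 ⊢
    rcases h01 (fun _ => false) with h0 | h0 <;> rcases h01 (fun _ => true) with h1 | h1 <;>
      rw [h0] at b0 ⊢ <;> rw [h1] at b1 ⊢ <;> norm_num at *
  rw [hd, mul_one] at h
  refine le_trans ?_ h
  calc (1 : ℝ) / 4 ^ n = (1 / 2 ^ n) * (1 / 2 ^ n) := by
        rw [show (4 : ℝ) = 2 * 2 by norm_num, mul_pow]; field_simp
    _ ≤ _ := mul_le_mul hP hP (by positivity) (le_trans (by positivity) hP)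

lemma large_n : ∃ c : ℝ, 0 < c ∧ ∀ n : ℕ, 6561 ≤ n → ∀ f : (Fin n → Bool) → ℝ,
    (∀ i x, x i = true → f (fl i x) ≤ f x) → (∀ x, f x = 0 ∨ f x = 1) → cubeE n f = 1 / 2 →
    ∀ I : ℝ, (∀ i, cubeE n (fun x => |f x - f (fl i x)|) = I) →
    c * Real.log n / Real.sqrt n ≤ cubeCov n f (Maj n) := by
  set p : ℝ := Real.exp (-2 * (4 * 17 + 4) ^ 2) with hp
  have hp0 : 0 < p := Real.exp_pos _
  clear_value p
  refine ⟨p * p / 720, by positivity, ?_⟩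
  intro n hn f hf h01 hE I hI
  have hn' : (6561 : ℝ) ≤ n := by exact_mod_cast hn
  have hs81 : 81 ≤ Real.sqrt n := by
    apply Real.le_sqrt_of_sq_le; norm_num; exact hn
  set s := Real.sqrt n with hs
  have hss : s * s = n := Real.mul_self_sqrt (by linarith)
  -- the window
  set k1 := ⌈((n : ℝ) + 16 * s) / 2⌉₊ with hk1
  have hk1a : ((n : ℝ) + 16 * s) / 2 ≤ k1 := Nat.le_ceil _
  have hk1b : (k1 : ℝ) < ((n : ℝ) + 16 * s) / 2 + 1 := Nat.ceil_lt_add_one (by positivity)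
  have hk1n : k1 ≤ n := by
    have : (k1 : ℝ) ≤ n := by nlinarith
    exact_mod_cast this
  have hk1h : n < 2 * k1 := by
    have : (n : ℝ) < ((2 * k1 : ℕ) : ℝ) := by push_cast; linarith
    exact_mod_cast this
  -- the degree
  set d := Nat.log 6561 n with hd
  have hd1 : 1 ≤ d := Nat.log_pos (by norm_num) hn
  have hdn : 9 ^ (4 * d) ≤ n := by
    rw [pow_mul]
    exact Nat.pow_log_le_self 6561 (by omega)
  have hdlog : Real.log n / 18 ≤ d := by
    have h1 : n < 6561 ^ (d + 1) := Nat.lt_pow_succ_log_self (by norm_num) n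
    have h2 : (n : ℝ) < Real.exp 9 ^ (d + 1) := by
      calc (n : ℝ) < ((6561 ^ (d + 1) : ℕ) : ℝ) := by exact_mod_cast h1
        _ = 6561 ^ (d + 1) := by push_cast; ring
        _ ≤ _ := by
          gcongr
          have h3 : (2.7 : ℝ) ^ 9 ≤ Real.exp 1 ^ 9 := by
            have := Real.exp_one_gt_d9
            gcongr
            linarith
          rw [← Real.exp_nat_mul] at h3
          norm_num at h3 ⊢
          linarith
    rw [← Real.exp_nat_mul] at h2
    have h4 := (Real.log_lt_iff_lt_exp (by linarith)).2 h2
    push_cast at h4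
    have hd1' : (1 : ℝ) ≤ d := by exact_mod_cast hd1
    linarith
  have hloc := local_inf hf h01 hE I hI d hd1 hdn
  have hwin := window_sum hf k1 (by linarith) (by omega)
  have hav := av_diff hf (n - k1) k1 (by omega) hk1n
  have hcov := cov_lower hf (n - k1) k1 (by omega) hk1h hk1n
  rw [P_symm k1 hk1n] at hcov
  have htail := tail (n := n) 17 (by norm_num) (by norm_num; linarith)
  have hP : p ≤ cubeE n (fun x => if k1 ≤ wt x then (1 : ℝ) else 0) := by
    rw [hp]
    refine htail.trans (E_mono fun x => ?_)
    split_ifs with h1 h2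
    · exact le_rfl
    · exfalso
      apply h2
      rw [Sm_eq] at h1
      have : (k1 : ℝ) ≤ wt x := by linarith
      exact_mod_cast this
    · norm_num
    · exact le_rfl
  have hdiff : Real.log n / 720 / s ≤ av f k1 - av f (n - k1) := by
    refine le_trans ?_ hav
    rw [← hs]
    exact div_le_div_of_nonneg_right (by linarith) (by linarith)
  have hlog : 0 ≤ Real.log n := Real.log_nonneg (by linarith)
  have hP0 := hp0.le.trans hP
  refine le_trans ?_ hcov
  calc p * p / 720 * Real.log n / s = p * p * (Real.log n / 720 / s) := by ring
    _ ≤ _ := mul_le_mul (mul_le_mul hP hP hp0.le hP0) hdiff (by positivity) (mul_nonneg hP0 hP0)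

end KKLMaj

/-- For every increasing, balanced, regular family `A ⊆ {0,1}^n`,
`Cov_μ(1_A, Maj) ≥ c log n / √n`. -/
theorem stmt0 :
    ∃ c : ℝ, 0 < c ∧ ∀ (n : ℕ), 2 ≤ n → ∀ A : Set (Fin n → Bool),
      (∀ x y : Fin n → Bool, (∀ i, x i ≤ y i) → x ∈ A → y ∈ A) →
      cubeMu n A = 1 / 2 →
      (∀ k l : Fin n, influence n A k = influence n A l) →
      cubeCov n (A.indicator fun _ => 1) (Maj n) ≥ c * Real.log n / Real.sqrt n := by
  obtain ⟨c1, hc1, H1⟩ := KKLMaj.large_n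
  refine ⟨min c1 (1 / 4 ^ 6561 / 2), by positivity, fun n hn A hA hE hreg => ?_⟩
  set f : (Fin n → Bool) → ℝ := A.indicator fun _ => 1 with hfdef
  have hf := KKLMaj.ind_mono A hA
  have h01 := KKLMaj.ind_01 A
  have hn' : (0 : ℝ) < n := by exact_mod_cast (by omega : 0 < n)
  have hs : 0 < Real.sqrt n := Real.sqrt_pos.2 hn'
  have hlog : 0 ≤ Real.log n := Real.log_nonneg (by exact_mod_cast (by omega : 1 ≤ n))
  have hI : ∀ k, cubeE n (fun x => |f x - f (KKLMaj.fl k x)|) = influence n A k :=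
    fun k => KKLMaj.influence_eq A k
  by_cases hbig : 6561 ≤ n
  · have h := H1 n hbig f hf h01 hE (influence n A ⟨0, by omega⟩)
      (fun i => (hI i).trans (hreg _ _))
    refine le_trans ?_ h
    gcongr
    exact min_le_left _ _
  · have h := KKLMaj.small_n (by omega : 1 ≤ n) hf h01 hE
    refine le_trans ?_ h
    have hl : Real.log n ≤ 2 * Real.sqrt n := by
      have h2 := Real.log_le_sub_one_of_pos hs
      rw [Real.log_sqrt hn'.le] at h2
      linarith
    have h3 : Real.log n / Real.sqrt n ≤ 2 := by rw [div_le_iff₀ hs]; exact hl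
    have h30 : 0 ≤ Real.log n / Real.sqrt n := by positivity
    have h4 : (1 : ℝ) / 4 ^ 6561 ≤ 1 / 4 ^ n := by
      apply one_div_le_one_div_of_le (by positivity)
      exact pow_le_pow_right₀ (by norm_num) (by omega)
    rw [mul_div_assoc]
    generalize (1 : ℝ) / 4 ^ 6561 = e at h4 ⊢
    have h5 : min c1 (e / 2) ≤ e / 2 := min_le_right _ _
    rcases le_total 0 e with he | he
    · nlinarith
    · have h6 : (0 : ℝ) ≤ 1 / 4 ^ n := by positivity
      nlinarith
end

section
/- There exists an absolute constant c > 0 such that for every n ≥ 2 and every increasing and balanced family A ⊆ {0,1}^n, there exists a Boolean function h belonging to the set {x ↦ x_1, ..., x ↦ x_n, Maj} (i.e., h is some coordinate projection or the majority function) with Cov_μ(1_A, h) ≥ c · (log n)/√n. -/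
open Finset

/-! ### Basic facts on expectations -/

lemma cubeE_add (n : ℕ) (f g : (Fin n → Bool) → ℝ) :
    cubeE n (fun x => f x + g x) = cubeE n f + cubeE n g := by
  simp only [cubeE, Finset.sum_add_distrib, add_div]

lemma cubeE_sub (n : ℕ) (f g : (Fin n → Bool) → ℝ) :
    cubeE n (fun x => f x - g x) = cubeE n f - cubeE n g := by
  simp only [cubeE, Finset.sum_sub_distrib, sub_div]

lemma cubeE_mul_left (n : ℕ) (c : ℝ) (f : (Fin n → Bool) → ℝ) :
    cubeE n (fun x => c * f x) = c * cubeE n f := by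
  simp only [cubeE, ← Finset.mul_sum, mul_div_assoc]

lemma cubeE_sum (n : ℕ) {ι : Type*} (s : Finset ι) (f : ι → (Fin n → Bool) → ℝ) :
    cubeE n (fun x => ∑ i ∈ s, f i x) = ∑ i ∈ s, cubeE n (f i) := by
  simp only [cubeE]
  rw [Finset.sum_comm, Finset.sum_div]

lemma cubeE_mono (n : ℕ) {f g : (Fin n → Bool) → ℝ} (h : ∀ x, f x ≤ g x) :
    cubeE n f ≤ cubeE n g := by
  unfold cubeE
  gcongr with x
  exact h x

lemma cubeE_const (n : ℕ) (c : ℝ) : cubeE n (fun _ => c) = c := by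
  simp [cubeE]

lemma cubeE_nonneg (n : ℕ) {f : (Fin n → Bool) → ℝ} (h : ∀ x, 0 ≤ f x) :
    0 ≤ cubeE n f := by
  have := cubeE_mono n (f := fun _ => 0) h
  rwa [cubeE_const] at this

lemma cubeE_cs (n : ℕ) (f g : (Fin n → Bool) → ℝ) :
    (cubeE n (fun x => f x * g x)) ^ 2 ≤
      cubeE n (fun x => f x ^ 2) * cubeE n (fun x => g x ^ 2) := by
  have h := Finset.sum_mul_sq_le_sq_mul_sq Finset.univ f g
  simp only [cubeE]
  rw [div_pow, div_mul_div_comm, ← sq]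
  gcongr

/-- Flip coordinate `i`. -/
def cflip {n : ℕ} (i : Fin n) (x : Fin n → Bool) : Fin n → Bool :=
  Function.update x i (!x i)

lemma cflip_cflip {n : ℕ} (i : Fin n) (x : Fin n → Bool) : cflip i (cflip i x) = x := by
  funext j
  by_cases h : j = i
  · subst h; simp [cflip]
  · simp [cflip, h]

lemma cflip_same {n : ℕ} (i : Fin n) (x : Fin n → Bool) : cflip i x i = !x i := by
  simp [cflip]

lemma cflip_ne {n : ℕ} {i j : Fin n} (h : j ≠ i) (x : Fin n → Bool) : cflip i x j = x j := by
  simp [cflip, h]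

lemma sum_cflip {n : ℕ} (i : Fin n) (f : (Fin n → Bool) → ℝ) :
    ∑ x, f (cflip i x) = ∑ x, f x :=
  Equiv.sum_comp (Function.Involutive.toPerm (cflip i) (cflip_cflip i)) f

lemma cubeE_cflip {n : ℕ} (i : Fin n) (f : (Fin n → Bool) → ℝ) :
    cubeE n (fun x => f (cflip i x)) = cubeE n f := by
  simp only [cubeE, sum_cflip i f]

/-- Sign of a bit. -/
def sg (b : Bool) : ℝ := if b then 1 else -1

lemma sg_not (b : Bool) : sg (!b) = - sg b := by cases b <;> simp [sg]
lemma sg_sq (b : Bool) : sg b ^ 2 = 1 := by cases b <;> simp [sg]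

/-- Walsh functions. -/
def wal {n : ℕ} (S : Finset (Fin n)) (x : Fin n → Bool) : ℝ := ∏ i ∈ S, sg (x i)

lemma wal_insert {n : ℕ} {i : Fin n} {S : Finset (Fin n)} (h : i ∉ S) (x : Fin n → Bool) :
    wal (insert i S) x = sg (x i) * wal S x := by
  simp [wal, Finset.prod_insert h]

lemma wal_cflip_notMem {n : ℕ} {i : Fin n} {S : Finset (Fin n)} (h : i ∉ S)
    (x : Fin n → Bool) : wal S (cflip i x) = wal S x := by
  unfold wal
  refine Finset.prod_congr rfl fun j hj => ?_
  rw [cflip_ne]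
  rintro rfl
  exact h hj

lemma wal_cflip_mem {n : ℕ} {i : Fin n} {S : Finset (Fin n)} (h : i ∈ S)
    (x : Fin n → Bool) : wal S (cflip i x) = - wal S x := by
  obtain ⟨T, hT, rfl⟩ : ∃ T, i ∉ T ∧ S = insert i T :=
    ⟨S.erase i, Finset.notMem_erase i S, (Finset.insert_erase h).symm⟩
  rw [wal_insert hT, wal_insert hT, wal_cflip_notMem hT, cflip_same, sg_not]
  ring

lemma wal_kernel {n : ℕ} (x y : Fin n → Bool) :
    ∑ S : Finset (Fin n), wal S x * wal S y = if x = y then 2 ^ n else 0 := by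
  have h : ∑ S : Finset (Fin n), wal S x * wal S y = ∏ i : Fin n, (1 + sg (x i) * sg (y i)) := by
    rw [Finset.prod_one_add, Finset.powerset_univ]
    refine Finset.sum_congr rfl fun S _ => ?_
    simp [wal, Finset.prod_mul_distrib]
  rw [h]
  split_ifs with hxy
  · subst hxy
    have : ∀ i, 1 + sg (x i) * sg (x i) = 2 := fun i => by
      rw [← sq, sg_sq]; norm_num
    simp [this]
  · obtain ⟨i, hi⟩ := Function.ne_iff.mp hxy
    refine Finset.prod_eq_zero (Finset.mem_univ i) ?_
    revert hi
    cases x i <;> cases y i <;> simp [sg]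

/-- Fourier coefficients. -/
noncomputable def hat {n : ℕ} (f : (Fin n → Bool) → ℝ) (S : Finset (Fin n)) : ℝ :=
  cubeE n (fun x => f x * wal S x)

lemma hat_inv {n : ℕ} (f : (Fin n → Bool) → ℝ) (x : Fin n → Bool) :
    f x = ∑ S, hat f S * wal S x := by
  have : ∑ S, hat f S * wal S x
      = (∑ y, f y * ∑ S, wal S y * wal S x) / 2 ^ n := by
    simp only [hat, cubeE, Finset.mul_sum, div_mul_eq_mul_div, Finset.sum_mul]
    rw [← Finset.sum_div, Finset.sum_comm]
    simp only [mul_assoc]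
  rw [this]
  simp [wal_kernel]

lemma parseval {n : ℕ} (f g : (Fin n → Bool) → ℝ) :
    cubeE n (fun x => f x * g x) = ∑ S, hat f S * hat g S := by
  have : (fun x => f x * g x) = fun x => ∑ S, hat g S * (f x * wal S x) := by
    funext x
    conv_lhs => rw [hat_inv g x]
    rw [Finset.mul_sum]
    refine Finset.sum_congr rfl fun S _ => by ring
  rw [this, cubeE_sum]
  refine Finset.sum_congr rfl fun S _ => ?_
  rw [cubeE_mul_left, mul_comm]
  rfl

lemma parseval_sq {n : ℕ} (f : (Fin n → Bool) → ℝ) :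
    cubeE n (fun x => f x ^ 2) = ∑ S, hat f S ^ 2 := by
  simp only [sq]; exact parseval f f

lemma hat_empty {n : ℕ} (f : (Fin n → Bool) → ℝ) : hat f ∅ = cubeE n f := by
  simp [hat, wal]

lemma hat_add {n : ℕ} (f g : (Fin n → Bool) → ℝ) (S : Finset (Fin n)) :
    hat (fun x => f x + g x) S = hat f S + hat g S := by
  simp only [hat, add_mul, cubeE_add]

/-- The Laplacian-type difference in direction `i`. -/
noncomputable def lap {n : ℕ} (i : Fin n) (f : (Fin n → Bool) → ℝ) (x : Fin n → Bool) : ℝ :=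
  (f x - f (cflip i x)) / 2

lemma hat_lap {n : ℕ} (i : Fin n) (f : (Fin n → Bool) → ℝ) (S : Finset (Fin n)) :
    hat (lap i f) S = if i ∈ S then hat f S else 0 := by
  have h1 : hat (lap i f) S = (1/2) * (cubeE n (fun x => f x * wal S x)
      - cubeE n (fun x => f (cflip i x) * wal S x)) := by
    rw [← cubeE_sub, ← cubeE_mul_left]
    unfold hat lap
    congr 1; funext x; ring
  have h2 : cubeE n (fun x => f (cflip i x) * wal S x)
      = cubeE n (fun x => f x * wal S (cflip i x)) := by
    rw [← cubeE_cflip i]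
    simp only [cflip_cflip]
  rw [h1, h2]
  split_ifs with h
  · simp only [wal_cflip_mem h]
    have : cubeE n (fun x => f x * - wal S x) = - hat f S := by
      have := cubeE_mul_left n (-1) (fun x => f x * wal S x)
      unfold hat
      rw [← neg_one_mul, ← this]
      congr 1; funext x; ring
    rw [this]
    unfold hat; ring
  · simp only [wal_cflip_notMem h]
    ring

lemma energy {n : ℕ} (f : (Fin n → Bool) → ℝ) :
    ∑ i, cubeE n (fun x => lap i f x ^ 2) = ∑ S, (S.card : ℝ) * hat f S ^ 2 := by
  simp only [parseval_sq, hat_lap]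
  rw [Finset.sum_comm]
  refine Finset.sum_congr rfl fun S _ => ?_
  simp [ite_pow]

lemma cubeE_odd {n : ℕ} (i : Fin n) (h : (Fin n → Bool) → ℝ)
    (hh : ∀ x, h (cflip i x) = h x) : cubeE n (fun x => sg (x i) * h x) = 0 := by
  have h1 := cubeE_cflip i (fun x => sg (x i) * h x)
  simp only [cflip_same, sg_not, hh] at h1
  have h2 := cubeE_mul_left n (-1) (fun x => sg (x i) * h x)
  have h3 : (fun x : Fin n → Bool => -sg (x i) * h x) = fun x => -1 * (sg (x i) * h x) := by
    funext x; ring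
  rw [h3, h2] at h1
  linarith

/-- Bonami's hypercontractive lemma. -/
lemma bonami {n : ℕ} (U : Finset (Fin n)) : ∀ c : Finset (Fin n) → ℝ,
    cubeE n (fun x => (∑ S ∈ U.powerset, c S * wal S x) ^ 4) ≤
      (∑ S ∈ U.powerset, 3 ^ S.card * c S ^ 2) ^ 2 := by
  induction U using Finset.induction_on with
  | empty =>
    intro c
    simp [wal, cubeE_const]
    exact le_of_eq (by ring)
  | insert i U hi ih =>
    intro c
    set g0 : (Fin n → Bool) → ℝ := fun x => ∑ S ∈ U.powerset, c S * wal S x with hg0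
    set g1 : (Fin n → Bool) → ℝ := fun x => ∑ S ∈ U.powerset, c (insert i S) * wal S x with hg1
    set A := ∑ S ∈ U.powerset, 3 ^ S.card * c S ^ 2 with hA
    set B := ∑ S ∈ U.powerset, 3 ^ S.card * c (insert i S) ^ 2 with hB
    have hni : ∀ S ∈ U.powerset, i ∉ S := fun S hS hiS => hi (Finset.mem_powerset.mp hS hiS)
    have h0 : cubeE n (fun x => g0 x ^ 4) ≤ A ^ 2 := ih c
    have h1 : cubeE n (fun x => g1 x ^ 4) ≤ B ^ 2 := ih (fun S => c (insert i S))
    have hA0 : 0 ≤ A := Finset.sum_nonneg fun S _ => by positivity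
    have hB0 : 0 ≤ B := Finset.sum_nonneg fun S _ => by positivity
    have hsum : ∀ x, ∑ S ∈ (insert i U).powerset, c S * wal S x = g0 x + sg (x i) * g1 x := by
      intro x
      rw [Finset.sum_powerset_insert hi, hg1, Finset.mul_sum]
      congr 1
      refine Finset.sum_congr rfl fun S hS => ?_
      rw [wal_insert (hni S hS)]; ring
    have hcoef : ∑ S ∈ (insert i U).powerset, 3 ^ S.card * c S ^ 2 = A + 3 * B := by
      rw [Finset.sum_powerset_insert hi, hB, Finset.mul_sum]
      congr 1
      refine Finset.sum_congr rfl fun S hS => ?_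
      rw [Finset.card_insert_of_notMem (hni S hS)]; ring
    have hf0 : ∀ x, g0 (cflip i x) = g0 x := fun x => by
      refine Finset.sum_congr rfl fun S hS => ?_
      rw [wal_cflip_notMem (hni S hS)]
    have hf1 : ∀ x, g1 (cflip i x) = g1 x := fun x => by
      refine Finset.sum_congr rfl fun S hS => ?_
      rw [wal_cflip_notMem (hni S hS)]
    have hexp : (fun x => (∑ S ∈ (insert i U).powerset, c S * wal S x) ^ 4)
        = fun x => (g0 x ^ 4 + 6 * (g0 x ^ 2 * g1 x ^ 2) + g1 x ^ 4)
          + sg (x i) * (4 * g0 x ^ 3 * g1 x + 4 * g0 x * g1 x ^ 3) := by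
      funext x
      rw [hsum x]
      have h2 := sg_sq (x i)
      have h3 : sg (x i) ^ 3 = sg (x i) := by rw [pow_succ, h2, one_mul]
      have h4 : sg (x i) ^ 4 = 1 := by
        rw [show (4:ℕ) = 2 * 2 from rfl, pow_mul, h2, one_pow]
      linear_combination (6 * g0 x ^ 2 * g1 x ^ 2) * h2 + 4 * g0 x * g1 x ^ 3 * h3
        + g1 x ^ 4 * h4
    have hmix : cubeE n (fun x => g0 x ^ 2 * g1 x ^ 2) ≤ A * B := by
      have hcs := cubeE_cs n (fun x => g0 x ^ 2) (fun x => g1 x ^ 2)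
      simp only [← pow_mul] at hcs
      norm_num at hcs
      refine abs_le_of_sq_le_sq' ?_ (by positivity) |>.2
      calc _ ≤ _ := hcs
        _ ≤ A ^ 2 * B ^ 2 := by
          gcongr
          exact cubeE_nonneg n fun x => by positivity
        _ = (A * B) ^ 2 := by ring
    rw [hexp, hcoef, cubeE_add, cubeE_odd i _ (fun x => by rw [hf0, hf1]), cubeE_add, cubeE_add,
      cubeE_mul_left]
    nlinarith [sq_nonneg B]

lemma level_alg (d : ℕ) {P W : ℝ} (hP0 : 0 ≤ P) (hW0 : 0 ≤ W)
    (e3 : W ^ 4 ≤ P ^ 3 * 9 ^ d * W ^ 2) : W ≤ 3 ^ d * (P * √P) := by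
  rcases hW0.eq_or_lt with h | h
  · rw [← h]; positivity
  · have e4 : W ^ 2 ≤ P ^ 3 * 9 ^ d := by
      have : W ^ 2 * W ^ 2 ≤ P ^ 3 * 9 ^ d * W ^ 2 := by nlinarith
      exact le_of_mul_le_mul_right this (by positivity)
    have hR : 0 ≤ 3 ^ d * (P * √P) := by positivity
    have e5 : P ^ 3 * 9 ^ d = (3 ^ d * (P * √P)) ^ 2 := by
      have h9 : (9:ℝ) ^ d = (3 ^ d) ^ 2 := by
        rw [← pow_mul, mul_comm d 2, pow_mul]; norm_num
      have hs := Real.sq_sqrt hP0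
      rw [h9]
      linear_combination (-(3 ^ d) ^ 2 * P ^ 2) * hs
    rw [e5] at e4
    exact (pow_le_pow_iff_left₀ hW0 hR two_ne_zero).1 e4

/-- Level inequality for functions supported on a small set. -/
lemma level_ineq {n : ℕ} (d : ℕ) (a b : (Fin n → Bool) → ℝ) (hb : ∀ x, b x = 0 ∨ b x = 1)
    (hab : ∀ x, |a x| ≤ b x) :
    ∑ S with S.card ≤ d, hat a S ^ 2 ≤ 3 ^ d * (cubeE n b * √(cubeE n b)) := by
  set P := cubeE n b with hP
  have hP0 : 0 ≤ P := cubeE_nonneg n fun x => by rcases hb x with h | h <;> rw [h] <;> norm_num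
  set W := ∑ S with S.card ≤ d, hat a S ^ 2 with hW
  have hW0 : 0 ≤ W := Finset.sum_nonneg fun S _ => sq_nonneg _
  set c : Finset (Fin n) → ℝ := fun S => if S.card ≤ d then hat a S else 0 with hc
  set g : (Fin n → Bool) → ℝ := fun x => ∑ S, c S * wal S x with hg
  have h4 : cubeE n (fun x => g x ^ 4) ≤ (3 ^ d * W) ^ 2 := by
    have := bonami (Finset.univ) c
    rw [Finset.powerset_univ] at this
    refine this.trans ?_
    gcongr
    rw [hW, Finset.mul_sum, Finset.sum_filter]
    refine Finset.sum_le_sum fun S _ => ?_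
    simp only [hc]
    split_ifs with h
    · gcongr
      norm_num
    · simp
  have hWE : W = cubeE n (fun x => a x * g x) := by
    have : (fun x => a x * g x) = fun x => ∑ S, c S * (a x * wal S x) := by
      funext x
      rw [hg, Finset.mul_sum]
      exact Finset.sum_congr rfl fun S _ => by ring
    rw [this, cubeE_sum, hW, Finset.sum_filter]
    refine Finset.sum_congr rfl fun S _ => ?_
    rw [cubeE_mul_left]
    simp only [hc]
    split_ifs
    · rw [sq]; rfl
    · simp
  have hbb : ∀ x, b x ^ 2 = b x := fun x => by rcases hb x with h | h <;> rw [h] <;> norm_num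
  set Q := cubeE n (fun x => b x * g x ^ 2) with hQ
  have hQ0 : 0 ≤ Q := cubeE_nonneg n fun x => by
    have := (abs_nonneg _).trans (hab x)
    positivity
  have e1 : W ^ 2 ≤ P * Q := by
    have h1 : W ≤ cubeE n (fun x => b x * (b x * |g x|)) := by
      rw [hWE]
      refine cubeE_mono n fun x => ?_
      rw [← mul_assoc, ← sq, hbb]
      calc a x * g x ≤ |a x * g x| := le_abs_self _
        _ = |a x| * |g x| := abs_mul _ _
        _ ≤ _ := by gcongr; exact hab x
    have h2 := cubeE_cs n b (fun x => b x * |g x|)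
    simp only [mul_pow, sq_abs, hbb] at h2
    exact (pow_le_pow_left₀ hW0 h1 2).trans h2
  have e2 : Q ^ 2 ≤ P * (3 ^ d * W) ^ 2 := by
    have h2 := cubeE_cs n b (fun x => g x ^ 2)
    simp only [hbb, ← pow_mul] at h2
    norm_num at h2
    exact h2.trans (by gcongr)
  have e3 : W ^ 4 ≤ P ^ 3 * 9 ^ d * W ^ 2 := by
    calc W ^ 4 = (W ^ 2) ^ 2 := by ring
      _ ≤ (P * Q) ^ 2 := by gcongr
      _ = P ^ 2 * Q ^ 2 := by ring
      _ ≤ P ^ 2 * (P * (3 ^ d * W) ^ 2) := by gcongr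
      _ = _ := by
        rw [show (9:ℝ) = 3 ^ 2 by norm_num, ← pow_mul]; ring
  exact level_alg d hP0 hW0 e3

/-! ### The localized KKL argument -/

/-- The signed sum `2 |x| - n`. -/
def ms {n : ℕ} (x : Fin n → Bool) : ℝ := ∑ i, sg (x i)

lemma ms_cflip {n : ℕ} (i : Fin n) (x : Fin n → Bool) :
    ms (cflip i x) = ms x - 2 * sg (x i) := by
  unfold ms
  rw [← Finset.add_sum_erase _ _ (Finset.mem_univ i),
    ← Finset.add_sum_erase (a := i) _ (fun i => sg (x i)) (Finset.mem_univ i), cflip_same, sg_not]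
  have : ∑ j ∈ Finset.univ.erase i, sg (cflip i x j) = ∑ j ∈ Finset.univ.erase i, sg (x j) :=
    Finset.sum_congr rfl fun j hj => by rw [cflip_ne (Finset.ne_of_mem_erase hj)]
  rw [this]; ring

lemma cubeE_ms_sq (n : ℕ) : cubeE n (fun x => ms x ^ 2) = n := by
  have h : (fun x : Fin n → Bool => ms x ^ 2) = fun x => ∑ i, ∑ j, sg (x i) * sg (x j) := by
    funext x
    rw [sq, ms, Finset.sum_mul_sum]
  rw [h, cubeE_sum]
  have h2 : ∀ i j : Fin n, cubeE n (fun x => sg (x i) * sg (x j)) = if i = j then 1 else 0 := by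
    intro i j
    split_ifs with hij
    · subst hij
      simp only [← sq, sg_sq, cubeE_const]
    · exact cubeE_odd i _ fun x => by rw [cflip_ne (Ne.symm hij)]
  simp only [cubeE_sum, h2]
  simp

lemma cubeE_abs_ms (n : ℕ) : cubeE n (fun x => |ms x|) ≤ √n := by
  have h := cubeE_cs n (fun x => |ms x|) (fun _ => 1)
  simp only [mul_one, sq_abs, cubeE_ms_sq, one_pow, cubeE_const] at h
  exact Real.le_sqrt_of_sq_le h

/-- Cutoff function. -/
noncomputable def chi {n : ℕ} (x : Fin n → Bool) : ℝ := max 0 (1 - |ms x| / (4 * √n))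

lemma chi_nonneg {n : ℕ} (x : Fin n → Bool) : 0 ≤ chi x := le_max_left _ _

lemma chi_le_one {n : ℕ} (x : Fin n → Bool) : chi x ≤ 1 :=
  max_le zero_le_one (sub_le_self _ (by positivity))

lemma chi_lip {n : ℕ} (i : Fin n) (x : Fin n → Bool) :
    |chi x - chi (cflip i x)| ≤ 1 / (2 * √n) := by
  unfold chi
  refine (abs_max_sub_max_le_max _ _ _ _).trans ?_
  have h1 : |(1 - |ms x| / (4 * √(n:ℝ))) - (1 - |ms (cflip i x)| / (4 * √(n:ℝ)))|
      = |(|ms (cflip i x)| - |ms x|)| / (4 * √n) := by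
    have e : (1 - |ms x| / (4 * √(n:ℝ))) - (1 - |ms (cflip i x)| / (4 * √(n:ℝ)))
        = (|ms (cflip i x)| - |ms x|) / (4 * √(n:ℝ)) := by ring
    rw [e, abs_div, abs_of_nonneg (show 0 ≤ 4 * √(n:ℝ) by positivity)]
  rw [h1]
  have h2 : |(|ms (cflip i x)| - |ms x|)| ≤ 2 := by
    refine (abs_abs_sub_abs_le _ _).trans ?_
    rw [ms_cflip]
    cases x i <;> simp [sg]
  have h3 : (0:ℝ) ≤ 1 / (2 * √n) := by positivity
  simp only [sub_self, abs_zero]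
  refine max_le h3 ?_
  calc _ ≤ 2 / (4 * √(n:ℝ)) := by gcongr
    _ = 1 / (2 * √n) := by
      rw [show (4:ℝ) * √n = 2 * (2 * √n) by ring, ← div_div]; norm_num

lemma chi_eq_zero {n : ℕ} (hn : 0 < n) (x : Fin n → Bool) (h : ¬ |ms x| < 4 * √n) :
    chi x = 0 := by
  unfold chi
  have hp : 0 < 4 * √(n:ℝ) := by positivity
  refine max_eq_left ?_
  have : 1 ≤ |ms x| / (4 * √(n:ℝ)) := by
    rw [le_div_iff₀ hp]; linarith
  linarith

lemma cubeE_chi {n : ℕ} (hn : 0 < n) : 3 / 4 ≤ cubeE n chi := by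
  have h1 : cubeE n (fun x => 1 - (1 / (4 * √(n:ℝ))) * |ms x|) ≤ cubeE n chi :=
    cubeE_mono n fun x => by
      unfold chi
      refine le_trans (le_of_eq ?_) (le_max_right _ _)
      ring
  rw [cubeE_sub, cubeE_const, cubeE_mul_left] at h1
  have h2 := cubeE_abs_ms n
  have hp : 0 < √(n:ℝ) := by positivity
  have h3 : 1 / (4 * √(n:ℝ)) * cubeE n (fun x => |ms x|) ≤ 1 / (4 * √(n:ℝ)) * √n := by
    gcongr
  have h4 : 1 / (4 * √(n:ℝ)) * √n = 1 / 4 := by field_simp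
  linarith

open Classical in
/-- Indicator of the part of the boundary in direction `j` inside the middle band. -/
noncomputable def bdy {n : ℕ} (f : (Fin n → Bool) → ℝ) (j : Fin n) (x : Fin n → Bool) : ℝ :=
  if f x ≠ f (cflip j x) ∧ |ms x| < 4 * √n then 1 else 0

lemma bdy_cases {n : ℕ} (f : (Fin n → Bool) → ℝ) (j : Fin n) (x : Fin n → Bool) :
    bdy f j x = 0 ∨ bdy f j x = 1 := by
  unfold bdy; split_ifs <;> simp

lemma var_bound {n : ℕ} (hn : 0 < n) (f : (Fin n → Bool) → ℝ) (hf : ∀ x, f x = 0 ∨ f x = 1)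
    (hE : cubeE n f = 1 / 2) :
    7 / 64 ≤ cubeE n (fun x => ((f x - 1 / 2) * chi x) ^ 2)
      - cubeE n (fun x => (f x - 1 / 2) * chi x) ^ 2 := by
  have hc := cubeE_chi hn
  have hc1 : cubeE n chi ≤ 1 := by
    have := cubeE_mono n (chi_le_one (n := n)); rwa [cubeE_const] at this
  have h1 : cubeE n (fun x => ((f x - 1 / 2) * chi x) ^ 2)
      = 1 / 4 * cubeE n (fun x => chi x ^ 2) := by
    rw [← cubeE_mul_left]
    congr 1; funext x
    rcases hf x with h | h <;> rw [h] <;> ring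
  have h2 := cubeE_cs n chi (fun _ => 1)
  simp only [mul_one, one_pow, cubeE_const] at h2
  have h2' : cubeE n (fun x => chi x) = cubeE n chi := rfl
  rw [h2'] at h2
  have h3 : |cubeE n (fun x => (f x - 1 / 2) * chi x)| ≤ 1 / 8 := by
    have e1 : cubeE n (fun x => (f x - 1 / 2) * chi x)
        = cubeE n (fun x => (f x - 1 / 2) * (chi x - 1)) + (cubeE n f - 1 / 2) := by
      rw [show cubeE n f - 1 / 2 = cubeE n (fun x => f x - 1 / 2) by
        rw [cubeE_sub, cubeE_const], ← cubeE_add]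
      congr 1; funext x; ring
    rw [e1, hE, sub_self, add_zero]
    have up : ∀ x, (f x - 1 / 2) * (chi x - 1) ≤ 1 / 2 * (1 - chi x) := fun x => by
      have := chi_le_one x
      rcases hf x with h | h <;> rw [h] <;> linarith
    have lo : ∀ x, -(1 / 2) * (1 - chi x) ≤ (f x - 1 / 2) * (chi x - 1) := fun x => by
      have := chi_le_one x
      rcases hf x with h | h <;> rw [h] <;> linarith
    have u1 := cubeE_mono n up
    have l1 := cubeE_mono n lo
    rw [cubeE_mul_left, cubeE_sub, cubeE_const, h2'] at u1 l1
    rw [abs_le]; constructor <;> linarith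
  have h4 : cubeE n (fun x => (f x - 1 / 2) * chi x) ^ 2 ≤ 1 / 64 := by
    rw [← sq_abs]
    nlinarith [abs_nonneg (cubeE n (fun x => (f x - 1 / 2) * chi x))]
  rw [h1]
  nlinarith

lemma spectral {n : ℕ} (d : ℕ) (F : (Fin n → Bool) → ℝ) :
    (d + 1) * (cubeE n (fun x => F x ^ 2) - cubeE n F ^ 2) ≤
      ∑ S, (S.card : ℝ) * hat F S ^ 2
        + (d + 1) * ∑ S with S.card ≤ d, (S.card : ℝ) * hat F S ^ 2 := by
  have h0 : cubeE n F ^ 2 = ∑ S : Finset (Fin n), if S = ∅ then hat F S ^ 2 else 0 := by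
    rw [Finset.sum_ite_eq' Finset.univ ∅ (fun S => hat F S ^ 2)]
    simp [hat_empty]
  rw [parseval_sq, h0, ← Finset.sum_sub_distrib, Finset.mul_sum, Finset.sum_filter,
    Finset.mul_sum, ← Finset.sum_add_distrib]
  refine Finset.sum_le_sum fun S _ => ?_
  have hs := sq_nonneg (hat F S)
  have hd : (0:ℝ) ≤ d := Nat.cast_nonneg d
  by_cases hS : S = ∅
  · simp [hS]
  · have hc : (1:ℝ) ≤ S.card := by
      exact_mod_cast Finset.card_pos.mpr (Finset.nonempty_iff_ne_empty.mpr hS)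
    rw [if_neg hS, sub_zero]
    split_ifs with h
    · have h1 : hat F S ^ 2 ≤ (S.card : ℝ) * hat F S ^ 2 := by nlinarith
      have h2 : ((d:ℝ) + 1) * hat F S ^ 2 ≤ ((d:ℝ) + 1) * ((S.card : ℝ) * hat F S ^ 2) := by
        gcongr
      have : 0 ≤ (S.card : ℝ) * hat F S ^ 2 := by positivity
      linarith
    · have h1 : (d:ℝ) + 1 ≤ S.card := by exact_mod_cast not_le.mp h
      rw [mul_zero, add_zero]
      gcongr

lemma local_kkl {n : ℕ} (hn : 0 < n) (f : (Fin n → Bool) → ℝ) (hf : ∀ x, f x = 0 ∨ f x = 1)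
    (hE : cubeE n f = 1 / 2) (d : ℕ)
    (hs : ∑ j, 3 ^ d * (cubeE n (bdy f j) * √(cubeE n (bdy f j))) ≤ 1 / 64) :
    3 * (d : ℝ) / 32 ≤ ∑ j, cubeE n (bdy f j) := by
  let F : (Fin n → Bool) → ℝ := fun x => (f x - 1 / 2) * chi x
  let a : Fin n → (Fin n → Bool) → ℝ := fun j x => (f x - f (cflip j x)) * chi x / 2
  let b : Fin n → (Fin n → Bool) → ℝ := fun j x =>
    (f (cflip j x) - 1 / 2) * (chi x - chi (cflip j x)) / 2
  have hnR : (0:ℝ) < n := by exact_mod_cast hn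
  have hlap : ∀ j, lap j F = fun x => a j x + b j x := fun j => by
    funext x; simp only [lap, F, a, b]; ring
  have ha : ∀ j x, |a j x| ≤ bdy f j x ∧ a j x ^ 2 ≤ 1 / 4 * bdy f j x := by
    intro j x
    have c0 := chi_nonneg x
    have c1 := chi_le_one x
    simp only [a, bdy]
    split_ifs with h
    · have hsq : (f x - f (cflip j x)) ^ 2 ≤ 1 := by
        rcases hf x with h | h <;> rcases hf (cflip j x) with h' | h' <;> rw [h, h'] <;> norm_num
      have h2 : ((f x - f (cflip j x)) * chi x / 2) ^ 2 ≤ 1 / 4 := by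
        have : chi x ^ 2 ≤ 1 := by nlinarith
        calc _ = (f x - f (cflip j x)) ^ 2 * chi x ^ 2 / 4 := by ring
          _ ≤ 1 * 1 / 4 := by gcongr
          _ = _ := by norm_num
      refine ⟨?_, by linarith⟩
      rw [← sq_le_one_iff_abs_le_one]; linarith
    · have h0 : (f x - f (cflip j x)) * chi x / 2 = 0 := by
        rw [not_and_or, not_not] at h
        rcases h with h | h
        · rw [h]; ring
        · rw [chi_eq_zero hn x h]; ring
      rw [h0]; simp
  have hb : ∀ j x, b j x ^ 2 ≤ 1 / (64 * n) := by
    intro j x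
    have hq : (f (cflip j x) - 1 / 2) ^ 2 = 1 / 4 := by
      rcases hf (cflip j x) with h | h <;> rw [h] <;> norm_num
    have hl : (chi x - chi (cflip j x)) ^ 2 ≤ 1 / (4 * n) := by
      rw [← sq_abs]
      refine (pow_le_pow_left₀ (abs_nonneg _) (chi_lip j x) 2).trans (le_of_eq ?_)
      rw [div_pow, mul_pow, Real.sq_sqrt hnR.le]; norm_num
    calc b j x ^ 2 = ((f (cflip j x) - 1 / 2) ^ 2 * (chi x - chi (cflip j x)) ^ 2 / 4 : ℝ) := by
          simp only [b]; ring
      _ ≤ 1 / 4 * (1 / (4 * (n:ℝ))) / 4 := by rw [hq]; gcongr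
      _ = _ := by field_simp; norm_num
  have hbs : ∑ j, cubeE n (fun x => b j x ^ 2) ≤ 1 / 64 := by
    have : ∀ j ∈ Finset.univ, cubeE n (fun x => b j x ^ 2) ≤ 1 / (64 * (n:ℝ)) := fun j _ => by
      have := cubeE_mono n (hb j); rwa [cubeE_const] at this
    refine (Finset.sum_le_sum this).trans (le_of_eq ?_)
    simp; field_simp
  have hen : ∑ S, (S.card : ℝ) * hat F S ^ 2 ≤ 1 / 2 * ∑ j, cubeE n (bdy f j) + 1 / 32 := by
    rw [← energy]
    have : ∀ j ∈ Finset.univ, cubeE n (fun x => lap j F x ^ 2) ≤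
        1 / 2 * cubeE n (bdy f j) + 2 * cubeE n (fun x => b j x ^ 2) := fun j _ => by
      rw [← cubeE_mul_left, ← cubeE_mul_left, ← cubeE_add]
      refine cubeE_mono n fun x => ?_
      rw [hlap]
      have := (ha j x).2
      nlinarith [sq_nonneg (a j x - b j x)]
    refine (Finset.sum_le_sum this).trans ?_
    rw [Finset.sum_add_distrib, ← Finset.mul_sum, ← Finset.mul_sum]
    linarith
  have hlow : ∑ S with S.card ≤ d, (S.card : ℝ) * hat F S ^ 2 ≤ 1 / 16 := by
    have e1 : ∑ S with S.card ≤ d, (S.card : ℝ) * hat F S ^ 2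
        = ∑ j, ∑ S with S.card ≤ d, hat (lap j F) S ^ 2 := by
      rw [Finset.sum_comm]
      refine Finset.sum_congr rfl fun S _ => ?_
      simp [hat_lap, ite_pow]
    have e2 : ∀ j ∈ Finset.univ, ∑ S with S.card ≤ d, hat (lap j F) S ^ 2 ≤
        2 * (3 ^ d * (cubeE n (bdy f j) * √(cubeE n (bdy f j))))
          + 2 * cubeE n (fun x => b j x ^ 2) := fun j _ => by
      have l1 := level_ineq d (a j) (bdy f j) (bdy_cases f j) (fun x => (ha j x).1)
      have l2 : ∑ S with S.card ≤ d, hat (b j) S ^ 2 ≤ cubeE n (fun x => b j x ^ 2) := by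
        rw [parseval_sq]
        exact Finset.sum_le_sum_of_subset_of_nonneg (Finset.filter_subset _ _)
          fun S _ _ => sq_nonneg _
      have l3 : ∑ S with S.card ≤ d, hat (lap j F) S ^ 2 ≤
          2 * ∑ S with S.card ≤ d, hat (a j) S ^ 2 + 2 * ∑ S with S.card ≤ d, hat (b j) S ^ 2 := by
        rw [Finset.mul_sum, Finset.mul_sum, ← Finset.sum_add_distrib]
        refine Finset.sum_le_sum fun S _ => ?_
        rw [hlap, hat_add]
        nlinarith [sq_nonneg (hat (a j) S - hat (b j) S)]
      linarith
    rw [e1]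
    refine (Finset.sum_le_sum e2).trans ?_
    rw [Finset.sum_add_distrib, ← Finset.mul_sum _ _ (2:ℝ), ← Finset.mul_sum _ _ (2:ℝ)]
    linarith
  have hv := var_bound hn f hf hE
  have hsp := spectral d F
  have hd : (0:ℝ) ≤ d := Nat.cast_nonneg d
  have k1 : ((d:ℝ) + 1) * (7 / 64) ≤ (d + 1) * (cubeE n (fun x => F x ^ 2) - cubeE n F ^ 2) := by
    gcongr
  have k2 : ((d:ℝ) + 1) * ∑ S with S.card ≤ d, (S.card : ℝ) * hat F S ^ 2
      ≤ (d + 1) * (1 / 16) := by gcongr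
  linarith

/-- Total influence is at least one for balanced Boolean functions. -/
lemma poincare {n : ℕ} (f : (Fin n → Bool) → ℝ) (hf : ∀ x, f x = 0 ∨ f x = 1)
    (hE : cubeE n f = 1 / 2) :
    1 ≤ ∑ j, cubeE n (fun x => (f x - f (cflip j x)) ^ 2) := by
  have h1 := energy f
  have h2 := spectral 0 f
  have h3 : cubeE n (fun x => f x ^ 2) = 1 / 2 := by
    rw [← hE]; congr 1; funext x
    rcases hf x with h | h <;> rw [h] <;> norm_num
  have h4 : ∑ S : Finset (Fin n) with S.card ≤ 0, (S.card : ℝ) * hat f S ^ 2 = 0 := by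
    refine Finset.sum_eq_zero fun S hS => ?_
    have : S.card = 0 := by simpa using hS
    simp [this]
  rw [h3, hE, h4, ← h1] at h2
  have h5 : ∑ i, cubeE n (fun x => lap i f x ^ 2)
      = 1 / 4 * ∑ j, cubeE n (fun x => (f x - f (cflip j x)) ^ 2) := by
    rw [Finset.mul_sum]
    refine Finset.sum_congr rfl fun i _ => ?_
    rw [← cubeE_mul_left]
    congr 1; funext x; unfold lap; ring
  rw [h5] at h2
  norm_num at h2
  linarith

/-! ### Gaussian-type lower tail bound -/

lemma cosh_lower {x : ℝ} (hx : 0 ≤ x) : 1 + x ^ 2 / 2 ≤ Real.cosh x := by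
  have h1 : Real.cosh x = 1 + 2 * Real.sinh (x / 2) ^ 2 := by
    have h := Real.cosh_two_mul (x / 2)
    rw [show 2 * (x / 2) = x by ring] at h
    rw [h, Real.cosh_sq]; ring
  have h2 : x / 2 ≤ Real.sinh (x / 2) := Real.self_le_sinh_iff.2 (by linarith)
  rw [h1]
  nlinarith

lemma cubeE_exp_ms (n : ℕ) (t : ℝ) :
    cubeE n (fun x => Real.exp (t * ms x)) = Real.cosh t ^ n := by
  have h1 : ∀ x : Fin n → Bool, Real.exp (t * ms x) = ∏ i, Real.exp (t * sg (x i)) := fun x => by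
    rw [ms, Finset.mul_sum, Real.exp_sum]
  have h2 := Finset.prod_univ_sum (fun _ : Fin n => (Finset.univ : Finset Bool))
    (fun _ b => Real.exp (t * sg b))
  rw [Fintype.piFinset_univ] at h2
  simp only [cubeE, h1]
  rw [← h2]
  simp only [Fintype.sum_bool, Finset.prod_const, Finset.card_univ, Fintype.card_fin]
  rw [← div_pow]
  congr 1
  rw [Real.cosh_eq]
  simp [sg]

lemma tail_bound (n : ℕ) (hn : 288 ≤ n) (e : ℝ) (he : e = 1 ∨ e = -1) :
    Real.exp (-1152) ≤ cubeE n (fun x => if 5 * √n ≤ e * ms x then 1 else 0) := by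
  have hnR : (288:ℝ) ≤ n := by exact_mod_cast hn
  have hs : 0 < √(n:ℝ) := Real.sqrt_pos.2 (by linarith)
  have hss : √(n:ℝ) ^ 2 = n := Real.sq_sqrt (by linarith)
  set t : ℝ := 24 / √n with ht
  have ht0 : 0 ≤ t := by positivity
  have hts : t * √n = 24 := by rw [ht]; field_simp
  have ht2 : t ^ 2 * n = 576 := by rw [← hss, ← mul_pow, hts]; norm_num
  have ht3 : t ^ 2 ≤ 2 := by
    rw [ht, div_pow, hss, div_le_iff₀ (by linarith)]; linarith
  have hc : ∀ u : ℝ, Real.cosh (u * e) = Real.cosh u := fun u => by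
    rcases he with h | h <;> rw [h] <;> simp
  have hEY : cubeE n (fun x => Real.exp (t * (e * ms x))) = Real.cosh t ^ n := by
    simp only [← mul_assoc]; rw [cubeE_exp_ms, hc]
  have hEY2 : cubeE n (fun x => Real.exp (t * (e * ms x)) ^ 2) = Real.cosh (2 * t) ^ n := by
    have : ∀ x : Fin n → Bool, Real.exp (t * (e * ms x)) ^ 2 = Real.exp ((2 * t * e) * ms x) :=
      fun x => by rw [← Real.exp_nat_mul]; congr 1; push_cast; ring
    simp only [this]
    rw [cubeE_exp_ms, hc]
  have hlow : Real.exp 144 ≤ Real.cosh t ^ n := by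
    have h1 : Real.exp (t ^ 2 / 4) ≤ Real.cosh t := by
      refine le_trans ?_ (cosh_lower ht0)
      have h2 : 1 - t ^ 2 / 4 ≤ Real.exp (-(t ^ 2 / 4)) := by
        have := Real.add_one_le_exp (-(t ^ 2 / 4)); linarith
      have h3 : Real.exp (t ^ 2 / 4) * Real.exp (-(t ^ 2 / 4)) = 1 := by
        rw [← Real.exp_add]; simp
      have h4 := Real.exp_pos (t ^ 2 / 4)
      have h5 : Real.exp (t ^ 2 / 4) * (1 - t ^ 2 / 4) ≤ 1 := by
        exact (mul_le_mul_of_nonneg_left h2 h4.le).trans h3.le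
      have h6 : 1 ≤ (1 + t ^ 2 / 2) * (1 - t ^ 2 / 4) := by nlinarith [sq_nonneg t]
      have h7 : 0 < 1 - t ^ 2 / 4 := by linarith
      exact le_of_mul_le_mul_right (h5.trans h6) h7
    calc Real.exp 144 = Real.exp (t ^ 2 / 4) ^ n := by
          rw [← Real.exp_nat_mul]; congr 1; linarith
      _ ≤ _ := by gcongr
  have hup : Real.cosh (2 * t) ^ n ≤ Real.exp 1152 := by
    calc Real.cosh (2 * t) ^ n ≤ Real.exp ((2 * t) ^ 2 / 2) ^ n := by
          gcongr
          exact Real.cosh_le_exp_half_sq _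
      _ = Real.exp 1152 := by
          rw [← Real.exp_nat_mul]; congr 1; linarith
  set g : (Fin n → Bool) → ℝ := fun x => if 5 * √n ≤ e * ms x then 1 else 0 with hg
  have hgg : ∀ x, g x ^ 2 = g x := fun x => by simp only [hg]; split_ifs <;> norm_num
  have hsplit : Real.cosh t ^ n ≤ Real.exp 120
      + cubeE n (fun x => Real.exp (t * (e * ms x)) * g x) := by
    rw [← hEY, ← cubeE_const n (Real.exp 120), ← cubeE_add]
    refine cubeE_mono n fun x => ?_
    simp only [hg]
    split_ifs with h
    · have := Real.exp_pos 120; linarith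
    · rw [mul_zero, add_zero]
      apply Real.exp_le_exp.2
      calc t * (e * ms x) ≤ t * (5 * √n) :=
            mul_le_mul_of_nonneg_left (not_le.1 h).le ht0
        _ = 120 := by linarith
  have hcs := cubeE_cs n (fun x => Real.exp (t * (e * ms x))) g
  rw [hEY2] at hcs
  simp only [hgg] at hcs
  have hgE : 0 ≤ cubeE n g := cubeE_nonneg n fun x => by simp only [hg]; split_ifs <;> norm_num
  have hgE' : cubeE n (fun x => g x) = cubeE n g := rfl
  rw [hgE'] at hcs
  have hone : 1 ≤ cubeE n (fun x => Real.exp (t * (e * ms x)) * g x) := by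
    have h1 : Real.exp 144 = Real.exp 120 * Real.exp 24 := by rw [← Real.exp_add]; norm_num
    have h2 := Real.add_one_le_exp (24:ℝ)
    have h3 := Real.one_le_exp (show (0:ℝ) ≤ 120 by norm_num)
    nlinarith
  have h1 : 1 ≤ Real.exp 1152 * cubeE n g := by
    calc (1:ℝ) ≤ (cubeE n (fun x => Real.exp (t * (e * ms x)) * g x)) ^ 2 := by nlinarith
      _ ≤ _ := hcs
      _ ≤ _ := by gcongr
  rw [Real.exp_neg, inv_le_iff_one_le_mul₀' (Real.exp_pos _)]
  exact h1

/-! ### Slices -/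

/-- Number of ones. -/
def wt {n : ℕ} (x : Fin n → Bool) : ℕ := (Finset.univ.filter fun i => x i = true).card

lemma wt_eq_sum {n : ℕ} (x : Fin n → Bool) :
    (wt x : ℝ) = ∑ i, (if x i then (1 : ℝ) else 0) := by
  simp [wt]

lemma wt_zeros {n : ℕ} (x : Fin n → Bool) :
    (n : ℝ) - wt x = ∑ i, (if x i = false then (1 : ℝ) else 0) := by
  rw [wt_eq_sum, sub_eq_iff_eq_add, ← Finset.sum_add_distrib]
  have : ∀ i, ((if x i = false then (1 : ℝ) else 0) + if x i then (1 : ℝ) else 0) = 1 := by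
    intro i; cases x i <;> simp
  simp [this]

lemma wt_le {n : ℕ} (x : Fin n → Bool) : wt x ≤ n := by
  unfold wt
  exact (Finset.card_le_univ _).trans (by simp)

lemma ms_eq {n : ℕ} (x : Fin n → Bool) : ms x = 2 * wt x - n := by
  have h1 : ms x = ∑ i, (if x i then (1 : ℝ) else 0) - ∑ i, (if x i = false then (1 : ℝ) else 0) := by
    rw [ms, ← Finset.sum_sub_distrib]
    refine Finset.sum_congr rfl fun i _ => ?_
    cases x i <;> simp [sg]
  rw [h1, ← wt_zeros, ← wt_eq_sum]; ring

lemma wt_cflip {n : ℕ} {i : Fin n} {x : Fin n → Bool} (h : x i = false) :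
    wt (cflip i x) = wt x + 1 := by
  have h1 := ms_cflip i x
  rw [ms_eq, ms_eq, h] at h1
  simp only [sg] at h1
  have : (wt (cflip i x) : ℝ) = wt x + 1 := by norm_num at h1; linarith
  exact_mod_cast this

/-- Swap the sum over up-edges seen from below to the sum seen from above. -/
lemma sum_swap {n : ℕ} (G : Fin n → (Fin n → Bool) → ℝ) :
    ∑ x, ∑ i, (if x i = false then G i (cflip i x) else 0)
      = ∑ x, ∑ i, (if x i = true then G i x else 0) := by
  rw [Finset.sum_comm, Finset.sum_comm (f := fun x i => if x i = true then G i x else 0)]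
  refine Finset.sum_congr rfl fun i _ => ?_
  rw [← sum_cflip i (fun x => if x i = true then G i x else 0)]
  refine Finset.sum_congr rfl fun x _ => ?_
  rw [cflip_same]
  cases x i <;> simp

/-- Sum over a slice. -/
def slN {n : ℕ} (f : (Fin n → Bool) → ℝ) (k : ℕ) : ℝ := ∑ x, if wt x = k then f x else 0

/-- Boundary above a slice. -/
def slB {n : ℕ} (f : (Fin n → Bool) → ℝ) (k : ℕ) : ℝ :=
  ∑ x, if wt x = k then ∑ i, (if x i = false then f (cflip i x) - f x else 0) else 0

lemma slB_eq {n : ℕ} (f : (Fin n → Bool) → ℝ) (k : ℕ) :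
    slB f k = (k + 1) * slN f (k + 1) - (n - k) * slN f k := by
  have h1 : slB f k = ∑ x, ∑ i, (if x i = false then
      (if wt (cflip i x) = k + 1 then f (cflip i x) else 0) else 0)
      - ∑ x, ∑ i, (if x i = false then (if wt x = k then f x else 0) else 0) := by
    unfold slB
    rw [← Finset.sum_sub_distrib]
    refine Finset.sum_congr rfl fun x _ => ?_
    rw [← Finset.sum_sub_distrib]
    by_cases hx : wt x = k
    · rw [if_pos hx]
      refine Finset.sum_congr rfl fun i _ => ?_
      split_ifs with h h2
      · rfl
      · exact absurd (by rw [wt_cflip h, hx]) h2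
      · simp
    · rw [if_neg hx]
      symm
      refine Finset.sum_eq_zero fun i _ => ?_
      by_cases h : x i = false
      · simp only [if_pos h, if_neg hx, wt_cflip h]
        simp [hx]
      · simp [h]
  rw [h1, sum_swap (fun i x => if wt x = k + 1 then f x else 0)]
  unfold slN
  rw [Finset.mul_sum, Finset.mul_sum]
  congr 1
  · refine Finset.sum_congr rfl fun x _ => ?_
    by_cases hx : wt x = k + 1
    · simp only [if_pos hx]
      have : ((k:ℝ) + 1) = wt x := by rw [hx]; push_cast; ring
      rw [this, wt_eq_sum, Finset.sum_mul]
      refine Finset.sum_congr rfl fun i _ => ?_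
      cases x i <;> simp
    · simp [hx]
  · refine Finset.sum_congr rfl fun x _ => ?_
    by_cases hx : wt x = k
    · simp only [if_pos hx]
      rw [← hx, wt_zeros, Finset.sum_mul]
      refine Finset.sum_congr rfl fun i _ => ?_
      cases x i <;> simp
    · simp [hx]

lemma choose_rec (n k : ℕ) (hk : k < n) :
    ((k:ℝ) + 1) * (n.choose (k + 1) : ℝ) = (n - k) * n.choose k := by
  have h := Nat.choose_succ_right_eq n k
  have h2 : ((n.choose (k + 1) * (k + 1) : ℕ) : ℝ) = ((n.choose k * (n - k) : ℕ) : ℝ) := by rw [h]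
  push_cast [Nat.cast_sub hk.le] at h2
  linarith

lemma slN_one {n : ℕ} (k : ℕ) (hk : k ≤ n) :
    slN (n := n) (fun _ => 1) k = n.choose k := by
  induction k with
  | zero =>
    unfold slN
    rw [Finset.sum_eq_single (fun _ => false)]
    · simp [wt]
    · intro x _ hx
      rw [if_neg]
      intro h
      apply hx
      funext i
      simp [wt, Finset.filter_eq_empty_iff] at h
      exact @h i
    · simp
  | succ k ih =>
    have h1 := slB_eq (n := n) (fun _ => 1) k
    have h2 : slB (n := n) (fun _ => 1) k = 0 := by simp [slB]
    rw [h2, ih (by omega), ← choose_rec n k (by omega), ← mul_sub] at h1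
    have h3 : (k:ℝ) + 1 ≠ 0 := by positivity
    have := (mul_eq_zero.1 h1.symm).resolve_left h3
    linarith

/-- Density on a slice. -/
noncomputable def slA {n : ℕ} (f : (Fin n → Bool) → ℝ) (k : ℕ) : ℝ := slN f k / n.choose k

lemma slB_eq_diff {n : ℕ} (f : (Fin n → Bool) → ℝ) (k : ℕ) (hk : k < n) :
    slB f k = ((n - k) * n.choose k) * (slA f (k + 1) - slA f k) := by
  have h0 : (n.choose k : ℝ) ≠ 0 := by exact_mod_cast (Nat.choose_pos hk.le).ne'
  have h1 : (n.choose (k + 1) : ℝ) ≠ 0 := by exact_mod_cast (Nat.choose_pos hk).ne'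
  have e0 : slN f k = slA f k * n.choose k := by unfold slA; field_simp
  have e1 : slN f (k + 1) = slA f (k + 1) * n.choose (k + 1) := by unfold slA; field_simp
  rw [slB_eq, e0, e1]
  linear_combination slA f (k + 1) * choose_rec n k hk

lemma slB_nonneg {n : ℕ} (f : (Fin n → Bool) → ℝ)
    (hm : ∀ x i, x i = false → f x ≤ f (cflip i x)) (k : ℕ) : 0 ≤ slB f k := by
  unfold slB
  refine Finset.sum_nonneg fun x _ => ?_
  split_ifs
  · refine Finset.sum_nonneg fun i _ => ?_
    split_ifs with h
    · linarith [hm x i h]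
    · exact le_rfl
  · exact le_rfl

lemma slA_step {n : ℕ} (f : (Fin n → Bool) → ℝ)
    (hm : ∀ x i, x i = false → f x ≤ f (cflip i x)) (k : ℕ) (hk : k < n) :
    slA f k ≤ slA f (k + 1) := by
  have h := slB_nonneg f hm k
  rw [slB_eq_diff f k hk] at h
  have h0 : (0:ℝ) < n.choose k := by exact_mod_cast (Nat.choose_pos hk.le)
  have h1 : (0:ℝ) < n - k := by rw [sub_pos]; exact_mod_cast hk
  have := nonneg_of_mul_nonneg_right h (mul_pos h1 h0)
  linarith

lemma slA_mono {n : ℕ} (f : (Fin n → Bool) → ℝ)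
    (hm : ∀ x i, x i = false → f x ≤ f (cflip i x)) {j k : ℕ} (hjk : j ≤ k) (hk : k ≤ n) :
    slA f j ≤ slA f k := by
  induction k, hjk using Nat.le_induction with
  | base => exact le_rfl
  | succ k _ ih => exact (ih (by omega)).trans (slA_step f hm k (by omega))

lemma central_bound (m : ℕ) : (2 * m + 1) * m.centralBinom ^ 2 ≤ 16 ^ m := by
  induction m with
  | zero => simp
  | succ m ih =>
    have h := Nat.succ_mul_centralBinom_succ m
    have h2 : (m + 1) ^ 2 * ((2 * (m + 1) + 1) * (m + 1).centralBinom ^ 2)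
        ≤ (m + 1) ^ 2 * 16 ^ (m + 1) := by
      calc (m + 1) ^ 2 * ((2 * (m + 1) + 1) * (m + 1).centralBinom ^ 2)
          = (2 * m + 3) * ((m + 1) * (m + 1).centralBinom) ^ 2 := by ring
        _ = (4 * (2 * m + 3) * (2 * m + 1)) * ((2 * m + 1) * m.centralBinom ^ 2) := by rw [h]; ring
        _ ≤ (16 * (m + 1) ^ 2) * 16 ^ m := by
          apply Nat.mul_le_mul _ ih
          nlinarith
        _ = _ := by ring
    exact Nat.le_of_mul_le_mul_left h2 (by positivity)

lemma middle_bound (n : ℕ) : n * (n.choose (n / 2)) ^ 2 ≤ 4 ^ n := by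
  rcases Nat.even_or_odd' n with ⟨m, h | h⟩
  · subst h
    have := central_bound m
    rw [Nat.mul_div_cancel_left m two_pos, ← Nat.centralBinom_eq_two_mul_choose, pow_mul]
    norm_num
    nlinarith [sq_nonneg m.centralBinom]
  · subst h
    have h1 := central_bound (m + 1)
    have h2 : (2 * m + 1) / 2 = m := by omega
    have h3 : (m + 1).centralBinom = 2 * (2 * m + 1).choose m := by
      rw [Nat.centralBinom_eq_two_mul_choose, show 2 * (m + 1) = (2 * m + 1) + 1 by ring,
        Nat.choose_succ_succ, Nat.choose_symm_half]; ring
    rw [h2]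
    rw [h3] at h1
    have h4 : 4 ^ (2 * m + 1) = 4 * 16 ^ m := by rw [pow_succ, pow_mul]; norm_num; ring
    rw [h4]
    rw [pow_succ 16 m] at h1
    nlinarith [sq_nonneg ((2 * m + 1).choose m)]

lemma middle_bound_real (n k : ℕ) : (n:ℝ) * n.choose k ≤ √n * 2 ^ n := by
  have h1 : (n:ℝ) * (n.choose (n / 2) : ℝ) ^ 2 ≤ 4 ^ n := by exact_mod_cast middle_bound n
  have h2 : (n.choose k : ℝ) ≤ n.choose (n / 2) := by exact_mod_cast Nat.choose_le_middle k n
  have hs : √(n:ℝ) * √n = n := Real.mul_self_sqrt (Nat.cast_nonneg n)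
  have h3 : √(n:ℝ) * n.choose (n / 2) ≤ 2 ^ n := by
    refine (pow_le_pow_iff_left₀ (by positivity) (by positivity) two_ne_zero).1 ?_
    calc (√(n:ℝ) * n.choose (n / 2)) ^ 2 = (√(n:ℝ) * √n) * (n.choose (n / 2) : ℝ) ^ 2 := by ring
      _ ≤ 4 ^ n := by rw [hs]; exact h1
      _ = (2 ^ n) ^ 2 := by rw [← pow_mul, mul_comm n 2, pow_mul]; norm_num
  calc (n:ℝ) * n.choose k ≤ (√(n:ℝ) * √n) * n.choose (n / 2) := by rw [hs]; gcongr
    _ = √n * (√(n:ℝ) * n.choose (n / 2)) := by ring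
    _ ≤ _ := by gcongr

/-- The local boundary is controlled by the density increment. -/
lemma bdy_sum_le {n : ℕ} (f : (Fin n → Bool) → ℝ) (hf : ∀ x, f x = 0 ∨ f x = 1)
    (hm : ∀ x i, x i = false → f x ≤ f (cflip i x)) (bot top : ℕ) (hbt : bot ≤ top)
    (htop : top ≤ n)
    (hband : ∀ k : ℕ, |2 * (k:ℝ) - n| < 4 * √n → bot + 1 ≤ k ∧ k < top) :
    ∑ j, cubeE n (bdy f j) ≤ 2 * √n * (slA f top - slA f bot) := by
  have e1 : ∑ j, cubeE n (bdy f j) = (∑ x, ∑ j, bdy f j x) / 2 ^ n := by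
    rw [Finset.sum_comm, Finset.sum_div]; rfl
  have e2 : ∑ x, ∑ j, bdy f j x
      = ∑ x, ∑ j, (if x j = false then bdy f j x + bdy f j (cflip j x) else 0) := by
    have s1 : ∀ x : Fin n → Bool, ∀ j, bdy f j x = (if x j = false then bdy f j x else 0)
        + (if x j = true then bdy f j x else 0) := fun x j => by cases x j <;> simp
    have s2 : ∀ x : Fin n → Bool, ∀ j, (if x j = false then bdy f j x + bdy f j (cflip j x) else 0)
        = (if x j = false then bdy f j x else 0)
        + (if x j = false then bdy f j (cflip j x) else 0) := fun x j => by
      cases x j <;> simp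
    simp only [s2, Finset.sum_add_distrib]
    rw [sum_swap (fun j x => bdy f j x)]
    rw [← Finset.sum_add_distrib]
    refine Finset.sum_congr rfl fun x _ => ?_
    rw [← Finset.sum_add_distrib]
    exact Finset.sum_congr rfl fun j _ => s1 x j
  have e3 : ∑ x, ∑ j, (if x j = false then bdy f j x + bdy f j (cflip j x) else 0)
      ≤ 2 * ∑ k ∈ Finset.Ico bot top, slB f k := by
    unfold slB
    rw [Finset.sum_comm (s := Finset.Ico bot top), Finset.mul_sum]
    refine Finset.sum_le_sum fun x _ => ?_
    rw [Finset.sum_ite_eq]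
    have key : ∀ j, x j = false → bdy f j x + bdy f j (cflip j x) ≤
        if wt x ∈ Finset.Ico bot top then 2 * (f (cflip j x) - f x) else 0 := by
      intro j hj
      have hmj := hm x j hj
      have hw := wt_cflip hj
      have gap : f x ≠ f (cflip j x) → 1 ≤ f (cflip j x) - f x := by
        intro h
        rcases hf x with g | g <;> rcases hf (cflip j x) with g2 | g2 <;>
          rw [g, g2] at h hmj ⊢ <;> first | exact absurd rfl h | linarith
      have b1 : bdy f j x ≤ if wt x ∈ Finset.Ico bot top then f (cflip j x) - f x else 0 := by
        unfold bdy
        split_ifs with h h' h'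
        · exact gap h.1
        · exfalso; apply h'
          rw [ms_eq] at h
          have := hband _ h.2
          rw [Finset.mem_Ico]; omega
        · linarith
        · exact le_rfl
      have b2 : bdy f j (cflip j x) ≤
          if wt x ∈ Finset.Ico bot top then f (cflip j x) - f x else 0 := by
        unfold bdy
        rw [cflip_cflip]
        split_ifs with h h' h'
        · exact gap (Ne.symm h.1)
        · exfalso; apply h'
          rw [ms_eq] at h
          have := hband _ h.2
          rw [Finset.mem_Ico]; omega
        · linarith
        · exact le_rfl
      split_ifs at b1 b2 ⊢ <;> linarith
    split_ifs with hx
    · rw [Finset.mul_sum]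
      refine Finset.sum_le_sum fun j _ => ?_
      split_ifs with hj
      · have := key j hj
        rwa [if_pos hx] at this
      · simp
    · rw [mul_zero]
      refine Finset.sum_nonpos fun j _ => ?_
      split_ifs with hj
      · have := key j hj
        rwa [if_neg hx] at this
      · exact le_rfl
  have e4 : ∑ k ∈ Finset.Ico bot top, slB f k ≤ √n * 2 ^ n * (slA f top - slA f bot) := by
    rw [← Finset.sum_Ico_sub (slA f) hbt, Finset.mul_sum]
    refine Finset.sum_le_sum fun k hk => ?_
    have hk' : k < n := by rw [Finset.mem_Ico] at hk; omega
    rw [slB_eq_diff f k hk']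
    have h1 := slA_step f hm k hk'
    have h2 := middle_bound_real n k
    have h3 : ((n:ℝ) - k) * n.choose k ≤ n * n.choose k := by
      gcongr
      exact sub_le_self _ (Nat.cast_nonneg k)
    exact mul_le_mul_of_nonneg_right (h3.trans h2) (by linarith)
  rw [e1, e2, div_le_iff₀ (by positivity)]
  linarith

/-! ### Covariances -/

lemma sum_slice {n : ℕ} (f : (Fin n → Bool) → ℝ) (φ : ℕ → ℝ) :
    ∑ x, f x * φ (wt x) = ∑ k ∈ Finset.range (n + 1), slN f k * φ k := by
  unfold slN
  simp only [Finset.sum_mul]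
  rw [Finset.sum_comm]
  refine Finset.sum_congr rfl fun x _ => ?_
  rw [Finset.sum_eq_single (wt x)]
  · simp
  · intro b _ hb
    rw [if_neg (Ne.symm hb), zero_mul]
  · intro h
    exact absurd (Finset.mem_range.2 (Nat.lt_succ_of_le (wt_le x))) h

lemma sum_slA {n : ℕ} (f : (Fin n → Bool) → ℝ) (φ : ℕ → ℝ) :
    ∑ x : Fin n → Bool, f x * φ (wt x) = ∑ x : Fin n → Bool, slA f (wt x) * φ (wt x) := by
  have h := sum_slice (n := n) (fun _ => 1) (fun k => slA f k * φ k)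
  simp only [one_mul] at h
  rw [sum_slice, h]
  refine Finset.sum_congr rfl fun k hk => ?_
  have hk2 : k ≤ n := by rw [Finset.mem_range] at hk; omega
  rw [slN_one k hk2]
  have : (n.choose k : ℝ) ≠ 0 := by exact_mod_cast (Nat.choose_pos hk2).ne'
  unfold slA
  field_simp

lemma Maj_eq {n : ℕ} (x : Fin n → Bool) : Maj n x = if n / 2 < wt x then 1 else 0 := by
  unfold Maj
  rw [← wt_eq_sum]
  congr 1
  rw [div_lt_iff₀ (by norm_num : (0:ℝ) < 2)]
  have : ((n:ℝ) < wt x * 2) ↔ n < wt x * 2 := by exact_mod_cast Iff.rfl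
  rw [this, eq_iff_iff]
  omega

lemma cov_maj {n : ℕ} (f : (Fin n → Bool) → ℝ)
    (hm : ∀ x i, x i = false → f x ≤ f (cflip i x)) (bot top : ℕ) (hb : bot ≤ n / 2)
    (ht : n / 2 < top) (htn : top ≤ n) (δ : ℝ) (hδ : 0 ≤ δ)
    (h1 : δ ≤ cubeE n (fun x => if top ≤ wt x then 1 else 0))
    (h2 : δ ≤ cubeE n (fun x => if wt x ≤ bot then 1 else 0)) :
    δ ^ 2 * (slA f top - slA f bot) ≤ cubeCov n f (Maj n) := by
  set p := cubeE n (Maj n) with hp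
  set m := slA f (n / 2) with hmdef
  set M : ℕ → ℝ := fun k => if n / 2 < k then 1 else 0 with hM
  have hMaj : Maj n = fun x => M (wt x) := by funext x; rw [Maj_eq]
  have hp1 : δ ≤ p := by
    refine h1.trans (cubeE_mono n fun x => ?_)
    rw [hMaj]; simp only [hM]
    split_ifs <;> first | omega | norm_num
  have hp2 : δ ≤ 1 - p := by
    have : 1 - p = cubeE n (fun x => 1 - Maj n x) := by
      rw [cubeE_sub, cubeE_const]
    rw [this]
    refine h2.trans (cubeE_mono n fun x => ?_)
    rw [hMaj]; simp only [hM]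
    split_ifs <;> first | omega | norm_num
  have mt : m ≤ slA f top := slA_mono f hm ht.le htn
  have mb : slA f bot ≤ m := slA_mono f hm hb (Nat.div_le_self _ _)
  have c1 : cubeCov n f (Maj n) = cubeE n (fun x => (slA f (wt x) - m) * (M (wt x) - p)) := by
    have a1 : cubeCov n f (Maj n) = cubeE n (fun x => f x * (M (wt x) - p)) := by
      unfold cubeCov
      have : (fun x => f x * (M (wt x) - p)) = fun x => f x * Maj n x - p * f x := by
        funext x; rw [hMaj]; ring
      rw [this, cubeE_sub, cubeE_mul_left]; ring
    have a2 : cubeE n (fun x => f x * (M (wt x) - p))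
        = cubeE n (fun x => slA f (wt x) * (M (wt x) - p)) := by
      unfold cubeE
      rw [sum_slA f (fun k => M k - p)]
    have a3 : cubeE n (fun x => M (wt x) - p) = 0 := by
      rw [cubeE_sub, cubeE_const, hp, hMaj, sub_self]
    have a4 : (fun x : Fin n → Bool => (slA f (wt x) - m) * (M (wt x) - p))
        = fun x => slA f (wt x) * (M (wt x) - p) - m * (M (wt x) - p) := by
      funext x; ring
    rw [a1, a2, a4, cubeE_sub, cubeE_mul_left, a3, mul_zero, sub_zero]
  have c2 : cubeE n (fun x => ((slA f top - m) * δ) * (if top ≤ wt x then 1 else 0)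
      + ((m - slA f bot) * δ) * (if wt x ≤ bot then 1 else 0))
      ≤ cubeE n (fun x => (slA f (wt x) - m) * (M (wt x) - p)) := by
    refine cubeE_mono n fun x => ?_
    simp only [hM]
    by_cases hx : n / 2 < wt x
    · rw [if_pos hx, if_neg (show ¬ wt x ≤ bot by omega)]
      have g1 : m ≤ slA f (wt x) := slA_mono f hm hx.le (wt_le x)
      split_ifs with h
      · have g2 : slA f top ≤ slA f (wt x) := slA_mono f hm h (wt_le x)
        rw [mul_one, mul_zero, add_zero]
        exact mul_le_mul (by linarith) hp2 hδ (by linarith)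
      · rw [mul_zero, mul_zero, add_zero]
        exact mul_nonneg (by linarith) (by linarith)
    · rw [if_neg hx, if_neg (show ¬ top ≤ wt x by omega)]
      have g1 : slA f (wt x) ≤ m := slA_mono f hm (by omega) (Nat.div_le_self _ _)
      have e : (slA f (wt x) - m) * (0 - p) = (m - slA f (wt x)) * p := by ring
      rw [e]
      split_ifs with h
      · have g2 : slA f (wt x) ≤ slA f bot := slA_mono f hm h (by omega)
        rw [mul_one, mul_zero, zero_add]
        exact mul_le_mul (by linarith) hp1 hδ (by linarith)
      · rw [mul_zero, mul_zero, add_zero]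
        exact mul_nonneg (by linarith) (by linarith)
  rw [c1]
  refine le_trans ?_ c2
  rw [cubeE_add, cubeE_mul_left, cubeE_mul_left]
  have k1 := mul_le_mul_of_nonneg_left h1 (mul_nonneg (sub_nonneg.2 mt) hδ)
  have k2 := mul_le_mul_of_nonneg_left h2 (mul_nonneg (sub_nonneg.2 mb) hδ)
  nlinarith [k1, k2]

lemma cov_coord {n : ℕ} (f : (Fin n → Bool) → ℝ) (hf : ∀ x, f x = 0 ∨ f x = 1)
    (hm : ∀ x i, x i = false → f x ≤ f (cflip i x)) (i : Fin n) :
    cubeCov n f (fun x => if x i then (1:ℝ) else 0)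
      = 1 / 4 * cubeE n (fun x => (f x - f (cflip i x)) ^ 2) := by
  have hx : ∀ x : Fin n → Bool, (if x i then (1:ℝ) else 0) = 1 / 2 + 1 / 2 * sg (x i) := by
    intro x; cases x i <;> norm_num [sg]
  have s0 : cubeE n (fun x => sg (x i)) = 0 := by
    have := cubeE_odd i (fun _ => 1) (fun _ => rfl)
    simpa using this
  have e1 : cubeE n (fun x => if x i then (1:ℝ) else 0) = 1 / 2 := by
    simp only [hx]
    rw [cubeE_add, cubeE_const, cubeE_mul_left, s0]; ring
  have e2 : cubeE n (fun x => f x * (if x i then (1:ℝ) else 0))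
      = 1 / 2 * cubeE n f + 1 / 2 * cubeE n (fun x => f x * sg (x i)) := by
    rw [← cubeE_mul_left, ← cubeE_mul_left, ← cubeE_add]
    congr 1; funext x; rw [hx]; ring
  have e3 : cubeE n (fun x => f (cflip i x) * sg (x i)) = - cubeE n (fun x => f x * sg (x i)) := by
    rw [← cubeE_cflip i (fun x => f (cflip i x) * sg (x i))]
    have : (fun x => f (cflip i (cflip i x)) * sg (cflip i x i))
        = fun x => (-1) * (f x * sg (x i)) := by
      funext x; rw [cflip_cflip, cflip_same, sg_not]; ring
    rw [this, cubeE_mul_left]; ring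
  have e4 : (fun x => (f x - f (cflip i x)) ^ 2)
      = fun x => f x * sg (x i) - f (cflip i x) * sg (x i) := by
    funext x
    cases hb : x i
    · have := hm x i hb
      rcases hf x with g | g <;> rcases hf (cflip i x) with g2 | g2 <;>
        rw [g, g2] at this ⊢ <;> first | (exfalso; linarith) | norm_num [sg]
    · have := hm (cflip i x) i (by rw [cflip_same, hb]; rfl)
      rw [cflip_cflip] at this
      rcases hf x with g | g <;> rcases hf (cflip i x) with g2 | g2 <;>
        rw [g, g2] at this ⊢ <;> first | (exfalso; linarith) | norm_num [sg]
  unfold cubeCov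
  rw [e1, e2, e4, cubeE_sub, e3]; ring

lemma bdy_le_inf {n : ℕ} (f : (Fin n → Bool) → ℝ) (hf : ∀ x, f x = 0 ∨ f x = 1) (i : Fin n) :
    cubeE n (bdy f i) ≤ cubeE n (fun x => (f x - f (cflip i x)) ^ 2) := by
  refine cubeE_mono n fun x => ?_
  unfold bdy
  split_ifs with h
  · have h1 := h.1
    rcases hf x with g | g <;> rcases hf (cflip i x) with g2 | g2 <;>
        rw [g, g2] at h1 ⊢ <;> first | exact absurd rfl h1 | norm_num
  · positivity

/-! ### Final assembly -/

lemma numer (n d : ℕ) (hn : 0 < n) (L : ℝ) (hL : L = Real.log n) (hL2 : 1152 ≤ L)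
    (hd : (d:ℝ) ≤ L / 16) :
    3 ^ d * (√(L / √n) * (3 * (d:ℝ) / 32)) ≤ 1 / 64 := by
  have hn0 : (0:ℝ) < n := by exact_mod_cast hn
  have hsq : √(n:ℝ) = Real.exp (L / 2) := by
    have : (n:ℝ) = Real.exp (L / 2) ^ 2 := by
      rw [← Real.exp_nat_mul]
      rw [show ((2:ℕ):ℝ) * (L / 2) = L by push_cast; ring, hL, Real.exp_log hn0]
    rw [this, Real.sqrt_sq (Real.exp_pos _).le]
  have h1 : √(L / √n) ≤ L * Real.exp (-(L / 4)) := by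
    apply Real.sqrt_le_iff.2
    refine ⟨by positivity, ?_⟩
    rw [hsq, div_eq_mul_inv, ← Real.exp_neg, mul_pow, ← Real.exp_nat_mul]
    rw [show ((2:ℕ):ℝ) * (-(L / 4)) = -(L / 2) by push_cast; ring]
    gcongr
    nlinarith
  have h2 : (3:ℝ) ^ d ≤ Real.exp (L / 8) := by
    have : (3:ℝ) ≤ Real.exp 2 := by have := Real.add_one_le_exp (2:ℝ); linarith
    calc (3:ℝ) ^ d ≤ Real.exp 2 ^ d := by gcongr
      _ = Real.exp (d * 2) := by rw [← Real.exp_nat_mul]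
      _ ≤ Real.exp (L / 8) := by apply Real.exp_le_exp.2; linarith
  have h3 : (L / 8) ^ 3 / 6 ≤ Real.exp (L / 8) := by
    have := Real.pow_div_factorial_le_exp (L / 8) (by linarith) 3
    norm_num [Nat.factorial] at this
    exact this
  have h4 : Real.exp (L / 8) * Real.exp (-(L / 4)) = (Real.exp (L / 8))⁻¹ := by
    rw [← Real.exp_add, ← Real.exp_neg]; congr 1; ring
  calc 3 ^ d * (√(L / √n) * (3 * (d:ℝ) / 32))
      ≤ Real.exp (L / 8) * (L * Real.exp (-(L / 4)) * (3 * (L / 16) / 32)) := by gcongr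
    _ = (Real.exp (L / 8) * Real.exp (-(L / 4))) * (3 * L ^ 2 / 512) := by ring
    _ = 3 * L ^ 2 / 512 / Real.exp (L / 8) := by rw [h4]; ring
    _ ≤ 1 / 64 := by
      rw [div_le_iff₀ (Real.exp_pos _)]
      have : L ^ 2 * 1152 ≤ L ^ 2 * L := by gcongr
      nlinarith

lemma large_case {n : ℕ} (f : (Fin n → Bool) → ℝ) (hf : ∀ x, f x = 0 ∨ f x = 1)
    (hm : ∀ x i, x i = false → f x ≤ f (cflip i x)) (hE : cubeE n f = 1 / 2) (L : ℝ)
    (hL : L = Real.log n) (hL2 : 1152 ≤ L)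
    (hP : ∀ j, cubeE n (bdy f j) ≤ L / √n) :
    Real.exp (-1152) ^ 2 * (3 * L / (2048 * √n)) ≤ cubeCov n f (Maj n) := by
  have hn : 0 < n := by
    rcases Nat.eq_zero_or_pos n with h | h
    · subst h; simp at hL; linarith
    · exact h
  have hn0 : (0:ℝ) < n := by exact_mod_cast hn
  have hn1 : (1152:ℝ) ≤ n := by
    have := Real.log_le_sub_one_of_pos hn0
    linarith
  have hn2 : 1152 ≤ n := by exact_mod_cast hn1
  have hs0 : 0 < √(n:ℝ) := Real.sqrt_pos.2 hn0
  have hss : √(n:ℝ) * √(n:ℝ) = n := Real.mul_self_sqrt hn0.le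
  have hs32 : 32 ≤ √(n:ℝ) := by
    apply Real.le_sqrt_of_sq_le; linarith
  set s := √(n:ℝ) with hs
  have hP0 : ∀ j, 0 ≤ cubeE n (bdy f j) := fun j => cubeE_nonneg n fun x => by
    unfold bdy; split_ifs <;> norm_num
  obtain ⟨d, hd1, hd2⟩ : ∃ d : ℕ, (d:ℝ) ≤ L / 16 ∧ L / 32 ≤ d := by
    refine ⟨⌊L / 16⌋₊, Nat.floor_le (by linarith), ?_⟩
    have := Nat.lt_floor_add_one (L / 16)
    linarith
  have kkl : 3 * (d:ℝ) / 32 ≤ ∑ j, cubeE n (bdy f j) := by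
    by_contra hcon
    push Not at hcon
    refine absurd (local_kkl hn f hf hE d ?_) (not_le.2 hcon)
    calc ∑ j, 3 ^ d * (cubeE n (bdy f j) * √(cubeE n (bdy f j)))
        ≤ ∑ j, 3 ^ d * (cubeE n (bdy f j) * √(L / s)) := by
          refine Finset.sum_le_sum fun j _ => ?_
          have := Real.sqrt_le_sqrt (hP j)
          have := hP0 j
          gcongr
      _ = 3 ^ d * (√(L / s) * ∑ j, cubeE n (bdy f j)) := by
          rw [← Finset.mul_sum, ← Finset.sum_mul]; ring
      _ ≤ 3 ^ d * (√(L / s) * (3 * (d:ℝ) / 32)) := by gcongr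
      _ ≤ 1 / 64 := numer n d hn L hL hL2 hd1
  obtain ⟨r, hr1, hr2⟩ : ∃ r : ℕ, 2 * s + 1 ≤ r ∧ (r:ℝ) ≤ 2 * s + 2 := by
    refine ⟨⌈2 * s⌉₊ + 1, ?_, ?_⟩
    · have := Nat.le_ceil (2 * s); push_cast; linarith
    · have := Nat.ceil_lt_add_one (show 0 ≤ 2 * s by linarith); push_cast; linarith
  have hrn : 2 * r + 4 ≤ n := by
    have : 2 * (r:ℝ) + 4 ≤ n := by nlinarith
    exact_mod_cast this
  obtain ⟨q, hq⟩ : ∃ q, q = n / 2 := ⟨_, rfl⟩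
  have hq1 : (2:ℝ) * q ≤ n := by exact_mod_cast (show 2 * q ≤ n by omega)
  have hq2 : (n:ℝ) ≤ 2 * q + 1 := by exact_mod_cast (show n ≤ 2 * q + 1 by omega)
  obtain ⟨bot, hbot⟩ : ∃ b, b + r = q := ⟨q - r, by omega⟩
  have hbotr : (bot:ℝ) + r = q := by exact_mod_cast hbot
  have hb := bdy_sum_le f hf hm bot (q + r + 1) (by omega) (by omega) (by
    intro k hk
    rw [← hs, abs_lt] at hk
    constructor
    · have : (bot:ℝ) < k := by linarith [hk.1]
      exact_mod_cast this
    · have : (k:ℝ) < (q + r + 1 : ℕ) := by push_cast; linarith [hk.2]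
      exact_mod_cast this)
  have t1 := tail_bound n (by omega) 1 (Or.inl rfl)
  have t2 := tail_bound n (by omega) (-1) (Or.inr rfl)
  have u1 : Real.exp (-1152) ≤ cubeE n (fun x => if q + r + 1 ≤ wt x then 1 else 0) := by
    refine t1.trans (cubeE_mono n fun x => ?_)
    split_ifs with g1 g2 g2
    · exact le_rfl
    · exfalso; apply g2
      rw [ms_eq, ← hs] at g1
      have : ((q + r + 1 : ℕ) : ℝ) ≤ wt x := by push_cast; linarith
      exact_mod_cast this
    · norm_num
    · exact le_rfl
  have u2 : Real.exp (-1152) ≤ cubeE n (fun x => if wt x ≤ bot then 1 else 0) := by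
    refine t2.trans (cubeE_mono n fun x => ?_)
    split_ifs with g1 g2 g2
    · exact le_rfl
    · exfalso; apply g2
      rw [ms_eq, ← hs] at g1
      have : (wt x : ℝ) ≤ bot := by linarith
      exact_mod_cast this
    · norm_num
    · exact le_rfl
  have cm := cov_maj f hm bot (q + r + 1) (by omega) (by omega) (by omega) _
    (Real.exp_pos _).le u1 u2
  refine le_trans ?_ cm
  gcongr
  rw [div_le_iff₀ (by positivity)]
  rw [← hs] at hb
  linarith

lemma small_case {n : ℕ} (hn : 0 < n) (f : (Fin n → Bool) → ℝ) (hf : ∀ x, f x = 0 ∨ f x = 1)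
    (hm : ∀ x i, x i = false → f x ≤ f (cflip i x)) (hE : cubeE n f = 1 / 2) :
    ∃ i : Fin n, 1 / (4 * n) ≤ cubeCov n f (fun x => if x i then (1:ℝ) else 0) := by
  have hn0 : (0:ℝ) < n := by exact_mod_cast hn
  by_contra hcon
  push Not at hcon
  have hp := poincare f hf hE
  have : ∑ j : Fin n, cubeE n (fun x => (f x - f (cflip j x)) ^ 2) < ∑ j : Fin n, 1 / (n:ℝ) := by
    refine Finset.sum_lt_sum_of_nonempty ⟨⟨0, hn⟩, Finset.mem_univ _⟩ fun j _ => ?_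
    have := hcon j
    rw [cov_coord f hf hm j] at this
    have e : 1 / (4 * (n:ℝ)) = 1 / 4 * (1 / n) := by field_simp
    rw [e] at this
    linarith
  have e : ∑ j : Fin n, 1 / (n:ℝ) = 1 := by
    simp
    field_simp
  linarith

/-- For every increasing balanced family `A ⊆ {0,1}^n` there is a Boolean function `h`
which is a coordinate projection or the majority function with
`Cov_μ(1_A, h) ≥ c log n / √n`. -/
theorem stmt1 :
    ∃ c : ℝ, 0 < c ∧ ∀ (n : ℕ), 2 ≤ n → ∀ A : Set (Fin n → Bool),
      (∀ x y : Fin n → Bool, (∀ i, x i ≤ y i) → x ∈ A → y ∈ A) →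
      cubeMu n A = 1 / 2 →
      ∃ h : (Fin n → Bool) → ℝ,
        ((∃ i : Fin n, h = fun x => if x i then (1 : ℝ) else 0) ∨ h = Maj n) ∧
        cubeCov n (A.indicator fun _ => 1) h ≥ c * Real.log n / Real.sqrt n := by
  set c1 : ℝ := Real.exp (-1152) / (4 * 1152) with hc1
  set c2 : ℝ := Real.exp (-1152) ^ 2 * (3 / 2048) with hc2
  have hc1p : 0 < c1 := by positivity
  have hc2p : 0 < c2 := by positivity
  refine ⟨min (min c1 c2) (1 / 4), by positivity, ?_⟩
  intro n hn A hA hmu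
  set c := min (min c1 c2) (1 / 4) with hc
  have hcc1 : c ≤ c1 := (min_le_left _ _).trans (min_le_left _ _)
  have hcc2 : c ≤ c2 := (min_le_left _ _).trans (min_le_right _ _)
  have hcc3 : c ≤ 1 / 4 := min_le_right _ _
  set f : (Fin n → Bool) → ℝ := A.indicator fun _ => 1 with hfdef
  have hE : cubeE n f = 1 / 2 := hmu
  have hf : ∀ x, f x = 0 ∨ f x = 1 := by
    intro x
    by_cases hx : x ∈ A
    · right; simp [hfdef, hx]
    · left; simp [hfdef, hx]
  have hm : ∀ x i, x i = false → f x ≤ f (cflip i x) := by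
    intro x i hxi
    by_cases hx : x ∈ A
    · have : cflip i x ∈ A := by
        refine hA x _ (fun j => ?_) hx
        by_cases hj : j = i
        · subst hj; rw [hxi]; exact Bool.false_le _
        · rw [cflip_ne hj]
      simp [hfdef, hx, this]
    · have h0 : f x = 0 := by simp [hfdef, hx]
      rw [h0]
      rcases hf (cflip i x) with g | g <;> rw [g] <;> norm_num
  have hn0 : (0:ℝ) < n := by exact_mod_cast (show 0 < n by omega)
  have hn1 : (1:ℝ) ≤ n := by exact_mod_cast (show 1 ≤ n by omega)
  have hs1 : 1 ≤ √(n:ℝ) := Real.one_le_sqrt.2 hn1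
  have hlog0 : 0 ≤ Real.log n := Real.log_nonneg hn1
  by_cases hL : 1152 ≤ Real.log n
  · by_cases hex : ∃ i : Fin n,
        c * Real.log n / √n ≤ cubeCov n f (fun x => if x i then (1:ℝ) else 0)
    · obtain ⟨i, hi⟩ := hex
      exact ⟨_, Or.inl ⟨i, rfl⟩, hi⟩
    · push Not at hex
      refine ⟨Maj n, Or.inr rfl, ?_⟩
      have hP : ∀ j, cubeE n (bdy f j) ≤ Real.log n / √n := by
        intro j
        have h1 := hex j
        rw [cov_coord f hf hm j] at h1
        have h2 := bdy_le_inf f hf j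
        have h3 : c * Real.log n / √n ≤ 1 / 4 * (Real.log n / √n) := by
          rw [mul_div_assoc]; gcongr
        linarith
      have h := large_case f hf hm hE _ rfl hL hP
      refine le_trans ?_ h
      calc c * Real.log n / √n ≤ c2 * Real.log n / √n := by gcongr
        _ = _ := by rw [hc2]; field_simp
  · push Not at hL
    obtain ⟨i, hi⟩ := small_case (by omega) f hf hm hE
    refine ⟨_, Or.inl ⟨i, rfl⟩, le_trans ?_ hi⟩
    have hne : (n:ℝ) ≤ Real.exp 1152 := by
      rw [← Real.exp_log hn0]; exact Real.exp_le_exp.2 hL.le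
    calc c * Real.log n / √n ≤ c1 * 1152 / 1 := by gcongr
      _ = 1 / (4 * Real.exp 1152) := by
        rw [hc1, Real.exp_neg]; field_simp
      _ ≤ 1 / (4 * n) := by gcongr
end

section
/- There exists a universal constant c > 0 with the following property. Let w, v ∈ ℝ^n be unit vectors (‖w‖₂ = ‖v‖₂ = 1) with ρ = ⟨w, v⟩ ≥ 0, let t, s ∈ ℝ, and define the halfspaces A = {x ∈ ℝ^n : ⟨w,x⟩ > t} and B = {x ∈ ℝ^n : ⟨v,x⟩ > s}. Then Cov_γ(1_A, 1_B) ≥ c · W₁^γ(A,B) / ( √(log(e / W₁^γ(A,A))) · √(log(e / W₁^γ(B,B))) ). -/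
open Finset MeasureTheory ProbabilityTheory

/-- The standard Gaussian measure `N(0, I_n)` on `ℝ^n`. -/
noncomputable def stdGaussian (n : ℕ) : Measure (Fin n → ℝ) :=
  Measure.pi fun _ => gaussianReal 0 1

/-- Covariance of two functions under the standard Gaussian measure. -/
noncomputable def gaussCov (n : ℕ) (f g : (Fin n → ℝ) → ℝ) : ℝ :=
  (∫ x, f x * g x ∂stdGaussian n) -
    (∫ x, f x ∂stdGaussian n) * (∫ x, g x ∂stdGaussian n)

/-- Gaussian influence of coordinate `k` on the set `A`: `I_k^γ(A) = E_γ[1_A · x_k]`. -/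
noncomputable def gaussInfluence (n : ℕ) (A : Set (Fin n → ℝ)) (k : Fin n) : ℝ :=
  ∫ x, A.indicator (fun _ => (1 : ℝ)) x * x k ∂stdGaussian n

/-- `W₁^γ(A, B) = ∑ₖ I_k^γ(A) I_k^γ(B)`. -/
noncomputable def gaussW1 (n : ℕ) (A B : Set (Fin n → ℝ)) : ℝ :=
  ∑ k, gaussInfluence n A k * gaussInfluence n B k

lemma cf_pi (n : ℕ) (c : Fin n → ℝ) :
    ∫ x, Complex.exp (((∑ i, c i * x i : ℝ) : ℂ) * Complex.I)
      ∂(Measure.pi fun _ : Fin n => gaussianReal 0 1) =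
    Complex.exp (((-(∑ i, c i ^ 2) / 2 : ℝ) : ℂ)) := by
  simp_rw [Complex.ofReal_sum, Finset.sum_mul, Complex.exp_sum]
  rw [integral_fintype_prod_eq_prod (f := fun i x ↦ Complex.exp (((c i * x : ℝ) : ℂ) * Complex.I))]
  simp_rw [Complex.ofReal_mul, ← charFun_apply_real, charFun_gaussianReal]
  rw [← Complex.exp_sum]
  congr 1
  push_cast
  rw [neg_div, Finset.sum_div, ← Finset.sum_neg_distrib]
  refine Finset.sum_congr rfl fun i _ => ?_
  simp

lemma cf_prod (c d : ℝ) :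
    ∫ p, Complex.exp (((c * p.1 + d * p.2 : ℝ) : ℂ) * Complex.I)
      ∂((gaussianReal 0 1).prod (gaussianReal 0 1)) =
    Complex.exp (((-(c ^ 2 + d ^ 2) / 2 : ℝ) : ℂ)) := by
  simp_rw [Complex.ofReal_add, add_mul, Complex.exp_add]
  rw [integral_prod_mul (fun x : ℝ => Complex.exp (((c * x : ℝ) : ℂ) * Complex.I))
    (fun x : ℝ => Complex.exp (((d * x : ℝ) : ℂ) * Complex.I))]
  simp_rw [Complex.ofReal_mul, ← charFun_apply_real, charFun_gaussianReal]
  rw [← Complex.exp_add]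
  congr 1
  push_cast
  simp
  ring

lemma pair_law (n : ℕ) (w v : Fin n → ℝ) (hw : ∑ i, w i ^ 2 = 1) (hv : ∑ i, v i ^ 2 = 1)
    (r : ℝ) (hr : ∑ i, w i * v i = r) (hr2 : r ^ 2 ≤ 1) :
    (Measure.pi fun _ : Fin n => gaussianReal 0 1).map
        (fun x => (∑ i, w i * x i, ∑ i, v i * x i)) =
    ((gaussianReal 0 1).prod (gaussianReal 0 1)).map
        (fun p : ℝ × ℝ => (p.1, r * p.1 + Real.sqrt (1 - r ^ 2) * p.2)) := by
  have : IsProbabilityMeasure ((Measure.pi fun _ : Fin n => gaussianReal 0 1).map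
        (fun x => (∑ i, w i * x i, ∑ i, v i * x i))) :=
    Measure.isProbabilityMeasure_map (Measurable.aemeasurable (by fun_prop))
  have : IsProbabilityMeasure (((gaussianReal 0 1).prod (gaussianReal 0 1)).map
        (fun p : ℝ × ℝ => (p.1, r * p.1 + Real.sqrt (1 - r ^ 2) * p.2))) :=
    Measure.isProbabilityMeasure_map (Measurable.aemeasurable (by fun_prop))
  refine Measure.ext_of_charFunDual ?_
  ext L
  obtain ⟨a, b, hL⟩ : ∃ a b : ℝ, ∀ x y : ℝ, L (x, y) = a * x + b * y := by
    refine ⟨L (1, 0), L (0, 1), fun x y => ?_⟩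
    have : ((x, y) : ℝ × ℝ) = x • ((1, 0) : ℝ × ℝ) + y • ((0, 1) : ℝ × ℝ) := by simp
    rw [this, map_add, map_smul, map_smul]
    simp [mul_comm]
  rw [charFunDual_apply, charFunDual_apply,
    integral_map (Measurable.aemeasurable (by fun_prop))
      (Measurable.aestronglyMeasurable (by fun_prop)),
    integral_map (Measurable.aemeasurable (by fun_prop))
      (Measurable.aestronglyMeasurable (by fun_prop))]
  simp_rw [hL]
  have e1 : ∀ x : Fin n → ℝ, a * ∑ i, w i * x i + b * ∑ i, v i * x i
      = ∑ i, (a * w i + b * v i) * x i := by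
    intro x
    rw [Finset.mul_sum, Finset.mul_sum, ← Finset.sum_add_distrib]
    exact Finset.sum_congr rfl fun i _ => by ring
  have e2 : ∀ p : ℝ × ℝ, a * p.1 + b * (r * p.1 + Real.sqrt (1 - r ^ 2) * p.2)
      = (a + b * r) * p.1 + (b * Real.sqrt (1 - r ^ 2)) * p.2 := by
    intro p; ring
  simp_rw [e1, e2]
  rw [cf_pi, cf_prod]
  congr 3
  rw [mul_pow, Real.sq_sqrt (by linarith)]
  have : ∑ i, (a * w i + b * v i) ^ 2 =
      a ^ 2 * ∑ i, w i ^ 2 + 2 * a * b * ∑ i, w i * v i + b ^ 2 * ∑ i, v i ^ 2 := by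
    simp_rw [Finset.mul_sum]
    rw [← Finset.sum_add_distrib, ← Finset.sum_add_distrib]
    exact Finset.sum_congr rfl fun i _ => by ring
  rw [this, hw, hv, hr]
  ring

lemma rho_sq (n : ℕ) (w v : Fin n → ℝ) (hw : ∑ i, w i ^ 2 = 1) (hv : ∑ i, v i ^ 2 = 1) :
    (∑ i, w i * v i) ^ 2 ≤ 1 := by
  have := Finset.sum_mul_sq_le_sq_mul_sq Finset.univ w v
  rwa [hw, hv, mul_one] at this

/-- conditional probability -/
noncomputable def gfun (s r x : ℝ) : ℝ :=
  (gaussianReal 0 1).real {z | s < r * x + Real.sqrt (1 - r ^ 2) * z}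

lemma gfun_meas (s r : ℝ) : Measurable (gfun s r) := by
  have hS : MeasurableSet {p : ℝ × ℝ | s < r * p.1 + Real.sqrt (1 - r ^ 2) * p.2} :=
    measurableSet_lt (by fun_prop) (by fun_prop)
  exact (measurable_measure_prodMk_left (ν := gaussianReal 0 1) hS).ennreal_toReal

lemma gfun_int (s r : ℝ) : Integrable (gfun s r) (gaussianReal 0 1) := by
  refine Integrable.of_bound (C := 1) (gfun_meas s r).aestronglyMeasurable ?_
  refine Filter.Eventually.of_forall fun x => ?_
  rw [Real.norm_eq_abs, gfun, abs_of_nonneg measureReal_nonneg]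
  exact measureReal_le_one

lemma gfun_setInt (s r : ℝ) (A : Set ℝ) (hA : MeasurableSet A) :
    ((gaussianReal 0 1).prod (gaussianReal 0 1)).real
      {p : ℝ × ℝ | p.1 ∈ A ∧ s < r * p.1 + Real.sqrt (1 - r ^ 2) * p.2} =
    ∫ x in A, gfun s r x ∂(gaussianReal 0 1) := by
  have hS : MeasurableSet {p : ℝ × ℝ | s < r * p.1 + Real.sqrt (1 - r ^ 2) * p.2} :=
    measurableSet_lt (by fun_prop) (by fun_prop)
  have hS' : MeasurableSet {p : ℝ × ℝ | p.1 ∈ A ∧ s < r * p.1 + Real.sqrt (1 - r ^ 2) * p.2} :=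
    (measurable_fst hA).inter hS
  rw [← integral_indicator hA, ← integral_indicator_one hS', integral_prod]
  · refine integral_congr_ae (Filter.Eventually.of_forall fun x => ?_)
    by_cases hx : x ∈ A
    · rw [Set.indicator_of_mem hx]
      have hm : MeasurableSet {z : ℝ | s < r * x + Real.sqrt (1 - r ^ 2) * z} :=
        measurableSet_lt (by fun_prop) (by fun_prop)
      rw [gfun, ← integral_indicator_one hm]
      refine integral_congr_ae (Filter.Eventually.of_forall fun z => ?_)
      simp [Set.indicator, hx]
    · rw [Set.indicator_of_notMem hx]
      simp [Set.indicator, hx]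
  · exact (integrable_const (1 : ℝ)).indicator hS'

lemma joint (n : ℕ) (w v : Fin n → ℝ) (hw : ∑ i, w i ^ 2 = 1) (hv : ∑ i, v i ^ 2 = 1)
    (A : Set ℝ) (hA : MeasurableSet A) (s : ℝ) :
    (Measure.pi fun _ : Fin n => gaussianReal 0 1).real
      {x | (∑ i, w i * x i) ∈ A ∧ s < ∑ i, v i * x i} =
    ∫ x in A, gfun s (∑ i, w i * v i) x ∂(gaussianReal 0 1) := by
  have h := pair_law n w v hw hv _ rfl (rho_sq n w v hw hv)
  rw [← gfun_setInt s _ A hA]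
  have hS : MeasurableSet {p : ℝ × ℝ | p.1 ∈ A ∧ s < p.2} :=
    (measurable_fst hA).inter (measurableSet_lt measurable_const measurable_snd)
  have h2 := congrArg (fun μ => μ.real {p : ℝ × ℝ | p.1 ∈ A ∧ s < p.2}) h
  rw [map_measureReal_apply (by fun_prop) hS, map_measureReal_apply (by fun_prop) hS] at h2
  exact h2

lemma marg (n : ℕ) (v : Fin n → ℝ) (hv : ∑ i, v i ^ 2 = 1) (s : ℝ) :
    (Measure.pi fun _ : Fin n => gaussianReal 0 1).real {x | s < ∑ i, v i * x i} =
    (gaussianReal 0 1).real (Set.Ioi s) := by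
  have h := joint n v v hv hv (Set.Ioi s) measurableSet_Ioi s
  have e : ∑ i, v i * v i = 1 := by rw [← hv]; exact Finset.sum_congr rfl fun i _ => by ring
  simp only [Set.mem_Ioi, and_self] at h
  rw [h, e]
  have : ∀ x ∈ Set.Ioi s, gfun s 1 x = 1 := by
    intro x hx
    simp only [Set.mem_Ioi] at hx
    simp [gfun, hx]
  rw [setIntegral_congr_fun measurableSet_Ioi this]
  simp

lemma gfun_total (s r : ℝ) (hr : r ^ 2 ≤ 1) :
    ∫ x, gfun s r x ∂(gaussianReal 0 1) = (gaussianReal 0 1).real (Set.Ioi s) := by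
  have hw : ∑ i, (![1, 0] : Fin 2 → ℝ) i ^ 2 = 1 := by simp
  have hv : ∑ i, (![r, Real.sqrt (1 - r ^ 2)] : Fin 2 → ℝ) i ^ 2 = 1 := by
    simp [Real.sq_sqrt (show 0 ≤ 1 - r ^ 2 by linarith)]
  have h := joint 2 _ _ hw hv Set.univ MeasurableSet.univ s
  have h2 := marg 2 _ hv s
  simp only [Set.mem_univ, true_and] at h
  rw [h] at h2
  simpa using h2

lemma phi_eq (x : ℝ) : gaussianPDFReal 0 1 x = (Real.sqrt (2 * Real.pi))⁻¹ * Real.exp (-(x ^ 2 / 2)) := by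
  simp [gaussianPDFReal, neg_div]

lemma phi_pos (x : ℝ) : 0 < gaussianPDFReal 0 1 x := gaussianPDFReal_pos 0 1 x (by simp)

lemma phi_le (x y C : ℝ) (h : y ^ 2 ≤ x ^ 2 + 2 * C) :
    Real.exp (-C) * gaussianPDFReal 0 1 x ≤ gaussianPDFReal 0 1 y := by
  rw [phi_eq, phi_eq, mul_left_comm, ← Real.exp_add]
  gcongr
  linarith

lemma int_phi (t : ℝ) :
    ∫ x, (Set.Ioi t).indicator (fun _ => (1 : ℝ)) x * x ∂(gaussianReal 0 1)
      = gaussianPDFReal 0 1 t := by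
  rw [integral_gaussianReal_eq_integral_smul (by simp)]
  have e : ∀ x, gaussianPDFReal 0 1 x • ((Set.Ioi t).indicator (fun _ => (1 : ℝ)) x * x) =
      (Set.Ioi t).indicator (fun x => gaussianPDFReal 0 1 x * x) x := by
    intro x
    by_cases hx : x ∈ Set.Ioi t <;> simp [Set.indicator, hx]
  simp_rw [e]
  rw [integral_indicator measurableSet_Ioi]
  have hd : ∀ x : ℝ, HasDerivAt (fun x => -gaussianPDFReal 0 1 x) (gaussianPDFReal 0 1 x * x) x := by
    intro x
    have h1 : HasDerivAt (fun x : ℝ => -(x ^ 2 / 2)) (-x) x := by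
      have h0 := ((hasDerivAt_pow 2 x).div_const 2).neg
      exact h0.congr_deriv (by norm_num)
    have h2 := ((h1.exp).const_mul (Real.sqrt (2 * Real.pi))⁻¹).neg
    have e3 : (fun x => -gaussianPDFReal 0 1 x) =
        fun x => -((Real.sqrt (2 * Real.pi))⁻¹ * Real.exp (-(x ^ 2 / 2))) := by
      funext y; rw [phi_eq]
    rw [e3, phi_eq]
    exact h2.congr_deriv (by ring)
  have hi : Integrable (fun x => gaussianPDFReal 0 1 x * x) := by
    have := (integrable_mul_exp_neg_mul_sq (b := 1 / 2) (by norm_num)).const_mul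
      (Real.sqrt (2 * Real.pi))⁻¹
    refine this.congr (Filter.Eventually.of_forall fun x => ?_)
    simp only
    rw [phi_eq, show -(1 / 2) * x ^ 2 = -(x ^ 2 / 2) by ring]
    ring
  have ht : Filter.Tendsto (fun x => -gaussianPDFReal 0 1 x) Filter.atTop (nhds 0) := by
    have h1 : Filter.Tendsto (fun x : ℝ => Real.exp (-(x ^ 2 / 2))) Filter.atTop (nhds 0) := by
      refine Real.tendsto_exp_neg_atTop_nhds_zero.comp ?_
      exact (Filter.tendsto_pow_atTop (two_ne_zero)).atTop_div_const (by norm_num)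
    have h2 := (h1.const_mul (Real.sqrt (2 * Real.pi))⁻¹).neg
    simp only [mul_zero, neg_zero] at h2
    refine h2.congr fun x => ?_
    rw [phi_eq]
  rw [integral_Ioi_of_hasDerivAt_of_tendsto' (fun x _ => hd x) hi.integrableOn ht]
  simp

lemma influence_s2 (n : ℕ) (w : Fin n → ℝ) (hw : ∑ i, w i ^ 2 = 1) (t : ℝ) (k : Fin n) :
    ∫ x, Set.indicator {x : Fin n → ℝ | t < ∑ i, w i * x i} (fun _ => (1 : ℝ)) x * x k
      ∂(Measure.pi fun _ : Fin n => gaussianReal 0 1) = w k * gaussianPDFReal 0 1 t := by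
  have hv : ∑ i, (Pi.single k 1 : Fin n → ℝ) i ^ 2 = 1 := by
    simp [Pi.single_apply]
  have hr : ∑ i, w i * (Pi.single k 1 : Fin n → ℝ) i = w k := by
    simp [Pi.single_apply]
  have h := pair_law n w _ hw hv _ hr (hr ▸ rho_sq n w _ hw hv)
  have hm : Measurable (fun p : ℝ × ℝ => (Set.Ioi t).indicator (fun _ => (1 : ℝ)) p.1 * p.2) :=
    ((measurable_const.indicator measurableSet_Ioi).comp measurable_fst).mul measurable_snd
  have h2 := congrArg (fun μ => ∫ p, (Set.Ioi t).indicator (fun _ => (1 : ℝ)) p.1 * p.2 ∂μ) h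
  rw [integral_map (Measurable.aemeasurable (by fun_prop)) hm.aestronglyMeasurable,
    integral_map (Measurable.aemeasurable (by fun_prop)) hm.aestronglyMeasurable] at h2
  have e1 : ∀ x : Fin n → ℝ, ∑ i, (Pi.single k 1 : Fin n → ℝ) i * x i = x k := by
    intro x; simp [Pi.single_apply]
  simp only [e1] at h2
  have e2 : ∀ x : Fin n → ℝ, Set.indicator {x : Fin n → ℝ | t < ∑ i, w i * x i} (fun _ => (1 : ℝ)) x
      = (Set.Ioi t).indicator (fun _ => (1 : ℝ)) (∑ i, w i * x i) := by
    intro x; simp [Set.indicator]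
  simp only [e2]
  rw [h2]
  have e3 : ∀ p : ℝ × ℝ, (Set.Ioi t).indicator (fun _ => (1 : ℝ)) p.1 *
      (w k * p.1 + Real.sqrt (1 - w k ^ 2) * p.2) =
      w k * (((Set.Ioi t).indicator (fun _ => (1 : ℝ)) p.1 * p.1) * 1) +
      Real.sqrt (1 - w k ^ 2) * ((Set.Ioi t).indicator (fun _ => (1 : ℝ)) p.1 * p.2) := by
    intro p; ring
  simp only [e3]
  have hid : Integrable (fun x : ℝ => x) (gaussianReal 0 1) :=
    (memLp_id_gaussianReal 1).integrable (by simp)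
  have hi1 : Integrable ((Set.Ioi t).indicator (fun _ => (1 : ℝ))) (gaussianReal 0 1) :=
    (integrable_const 1).indicator measurableSet_Ioi
  have hi2 : Integrable (fun x => (Set.Ioi t).indicator (fun _ => (1 : ℝ)) x * x)
      (gaussianReal 0 1) := by
    refine (hid.indicator (measurableSet_Ioi (a := t))).congr (Filter.Eventually.of_forall fun x => ?_)
    simp [Set.indicator]
  rw [integral_add, integral_const_mul, integral_const_mul,
    integral_prod_mul (fun x => (Set.Ioi t).indicator (fun _ => (1 : ℝ)) x * x) (fun _ => (1 : ℝ)),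
    integral_prod_mul ((Set.Ioi t).indicator (fun _ => (1 : ℝ))) (fun z : ℝ => z),
    int_phi, integral_id_gaussianReal]
  · simp
  · exact (hi2.mul_prod (integrable_const (1 : ℝ))).const_mul _
  · exact (hi1.mul_prod hid).const_mul _

lemma gint (a b m : ℝ) (hab : a ≤ b) (h : ∀ x ∈ Set.Ioc a b, m ≤ gaussianPDFReal 0 1 x) :
    (b - a) * m ≤ (gaussianReal 0 1).real (Set.Ioc a b) := by
  rw [measureReal_def, gaussianReal_apply_eq_integral 0 (by simp), ENNReal.toReal_ofReal
    (integral_nonneg fun x => gaussianPDFReal_nonneg 0 1 x)]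
  have h1 : ∫ x in Set.Ioc a b, m = (b - a) * m := by
    simp [hab]
  rw [← h1]
  exact setIntegral_mono_on (integrable_const m) (integrable_gaussianPDFReal 0 1).integrableOn
    measurableSet_Ioc h

lemma gfun_mono_r (s r ρ t : ℝ) (hr0 : 0 ≤ r) (hrρ : r < ρ) (hρ : ρ ≤ 1) :
    ∫ x in Set.Ioi t, gfun s r x ∂(gaussianReal 0 1) ≤
    ∫ x in Set.Ioi t, gfun s ρ x ∂(gaussianReal 0 1) := by
  have hσr : 0 < Real.sqrt (1 - r ^ 2) := Real.sqrt_pos.2 (by nlinarith)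
  have hσρ : 0 ≤ Real.sqrt (1 - ρ ^ 2) := Real.sqrt_nonneg _
  have hσ : Real.sqrt (1 - ρ ^ 2) ≤ Real.sqrt (1 - r ^ 2) := Real.sqrt_le_sqrt (by nlinarith)
  have hT : ∫ x, gfun s r x ∂(gaussianReal 0 1) = ∫ x, gfun s ρ x ∂(gaussianReal 0 1) := by
    rw [gfun_total s r (by nlinarith), gfun_total s ρ (by nlinarith)]
  have key1 : ∀ x, s * (Real.sqrt (1 - r ^ 2) - Real.sqrt (1 - ρ ^ 2)) <
      x * (ρ * Real.sqrt (1 - r ^ 2) - r * Real.sqrt (1 - ρ ^ 2)) → gfun s r x ≤ gfun s ρ x := by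
    intro x hx
    refine measureReal_mono ?_
    intro z hz
    simp only [Set.mem_ofPred_eq] at hz ⊢
    generalize Real.sqrt (1 - r ^ 2) = p at *
    generalize Real.sqrt (1 - ρ ^ 2) = q at *
    have : q * s ≤ q * (r * x + p * z) := mul_le_mul_of_nonneg_left hz.le hσρ
    have h3 : p * s < p * (ρ * x + q * z) := by nlinarith
    exact lt_of_mul_lt_mul_left h3 hσr.le
  have key2 : ∀ x, x * (ρ * Real.sqrt (1 - r ^ 2) - r * Real.sqrt (1 - ρ ^ 2)) ≤
      s * (Real.sqrt (1 - r ^ 2) - Real.sqrt (1 - ρ ^ 2)) → gfun s ρ x ≤ gfun s r x := by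
    intro x hx
    refine measureReal_mono ?_
    intro z hz
    simp only [Set.mem_ofPred_eq] at hz ⊢
    generalize Real.sqrt (1 - r ^ 2) = p at *
    generalize Real.sqrt (1 - ρ ^ 2) = q at *
    by_contra hc
    push Not at hc
    have : q * (r * x + p * z) ≤ q * s := mul_le_mul_of_nonneg_left hc hσρ
    have h3 : p * s < p * (ρ * x + q * z) := mul_lt_mul_of_pos_left hz hσr
    nlinarith
  have hD : 0 < ρ * Real.sqrt (1 - r ^ 2) - r * Real.sqrt (1 - ρ ^ 2) := by nlinarith
  by_cases hc : s * (Real.sqrt (1 - r ^ 2) - Real.sqrt (1 - ρ ^ 2)) ≤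
      t * (ρ * Real.sqrt (1 - r ^ 2) - r * Real.sqrt (1 - ρ ^ 2))
  · refine setIntegral_mono_on (gfun_int s r).integrableOn (gfun_int s ρ).integrableOn
      measurableSet_Ioi fun x hx => key1 x ?_
    exact hc.trans_lt (mul_lt_mul_of_pos_right hx hD)
  · push Not at hc
    have h1 := integral_add_compl (measurableSet_Ioi (a := t)) (gfun_int s r)
    have h2 := integral_add_compl (measurableSet_Ioi (a := t)) (gfun_int s ρ)
    have h3 : ∫ x in (Set.Ioi t)ᶜ, gfun s ρ x ∂(gaussianReal 0 1) ≤
        ∫ x in (Set.Ioi t)ᶜ, gfun s r x ∂(gaussianReal 0 1) := by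
      refine setIntegral_mono_on (gfun_int s ρ).integrableOn (gfun_int s r).integrableOn
        measurableSet_Ioi.compl fun x hx => key2 x ?_
      simp only [Set.mem_compl_iff, Set.mem_Ioi, not_lt] at hx
      exact (mul_le_mul_of_nonneg_right hx hD.le).trans hc.le
    linarith

lemma gfun_mono_x (s r : ℝ) (hr : 0 ≤ r) : Monotone (gfun s r) := by
  intro x y hxy
  refine measureReal_mono ?_
  intro z hz
  simp only [Set.mem_ofPred_eq] at hz ⊢
  nlinarith [mul_le_mul_of_nonneg_left hxy hr]

lemma gfun_diff (s r x y M : ℝ) (hr : 0 ≤ r) (hxy : x ≤ y) (hx : |x| ≤ M) (hy : |y| ≤ M)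
    (hM : r * M ≤ 1 / (4 * (1 + |s|))) (hM1 : 1 ≤ M) :
    r * (y - x) * (Real.exp (-1) * gaussianPDFReal 0 1 s) ≤ gfun s r y - gfun s r x := by
  have hs : 0 ≤ |s| := abs_nonneg s
  have hM' : r * M * (1 + |s|) ≤ 1 / 4 := by
    rw [le_div_iff₀ (by positivity)] at hM
    linarith
  have hrM : r ≤ r * M := by nlinarith
  have hrs : r * (1 + |s|) ≤ 1 / 4 := by nlinarith
  have hr4 : r ≤ 1 / 4 := by nlinarith
  have h1 : 0 < 1 - r ^ 2 := by nlinarith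
  have hσ : 0 < Real.sqrt (1 - r ^ 2) := Real.sqrt_pos.2 h1
  have hσ2 : Real.sqrt (1 - r ^ 2) ^ 2 = 1 - r ^ 2 := Real.sq_sqrt h1.le
  have hσ1 : Real.sqrt (1 - r ^ 2) ≤ 1 := by
    rw [Real.sqrt_le_left (by norm_num)]; nlinarith [sq_nonneg r]
  have hg : ∀ u, gfun s r u = (gaussianReal 0 1).real (Set.Ioi ((s - r * u) / Real.sqrt (1 - r ^ 2))) := by
    intro u
    unfold gfun
    congr 1
    ext z
    simp only [Set.mem_ofPred_eq, Set.mem_Ioi]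
    rw [div_lt_iff₀ hσ]
    constructor <;> intro h <;> linarith
  set σ := Real.sqrt (1 - r ^ 2) with hσdef
  have hle : (s - r * y) / σ ≤ (s - r * x) / σ := by
    gcongr
  rw [hg, hg, ← measureReal_sdiff (Set.Ioi_subset_Ioi hle) measurableSet_Ioi,
    Set.Ioi_sdiff_Ioi]
  have hb : ∀ z ∈ Set.Ioc ((s - r * y) / σ) ((s - r * x) / σ),
      Real.exp (-1) * gaussianPDFReal 0 1 s ≤ gaussianPDFReal 0 1 z := by
    rintro z ⟨hz1, hz2⟩
    refine phi_le s z 1 ?_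
    rw [div_lt_iff₀ hσ] at hz1
    rw [le_div_iff₀ hσ] at hz2
    have hy' : r * y ≤ r * M := mul_le_mul_of_nonneg_left ((le_abs_self y).trans hy) hr
    have hx' : -(r * M) ≤ r * x := by nlinarith [neg_abs_le x]
    have hz : |z * σ| ≤ |s| + r * M := by
      rw [abs_le]
      constructor
      · linarith [neg_abs_le s]
      · linarith [le_abs_self s]
    have hrM0 : 0 ≤ r * M := by positivity
    have hz' : (z * σ) ^ 2 ≤ (|s| + r * M) ^ 2 := by
      rw [← sq_abs (z * σ)]
      gcongr
    have hss : |s| ^ 2 = s ^ 2 := sq_abs s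
    have h5 : (|s| + r * M) ^ 2 ≤ s ^ 2 + 1 := by nlinarith
    rw [mul_pow, hσ2] at hz'
    have h6 : z ^ 2 * (1 - r ^ 2) ≤ s ^ 2 + 1 := hz'.trans h5
    have h7 : (r * (1 + |s|)) ^ 2 ≤ 1 / 16 := by
      have : 0 ≤ r * (1 + |s|) := by positivity
      nlinarith
    have h8 : s ^ 2 + 1 ≤ (s ^ 2 + 2 * 1) * (1 - r ^ 2) := by
      nlinarith [mul_nonneg (sq_nonneg r) hs]
    exact le_of_mul_le_mul_right (h6.trans h8) h1
  refine le_trans ?_ (gint _ _ _ hle hb)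
  have hpos := phi_pos s
  gcongr
  rw [← sub_div, le_div_iff₀ hσ]
  have : 0 ≤ r * (y - x) := mul_nonneg hr (by linarith)
  nlinarith

lemma cov_low (g : ℝ → ℝ) (hg : Monotone g) (hgi : Integrable g (gaussianReal 0 1))
    (t p pe q qe : ℝ) (hp : t ≤ p) (hq : q ≤ t) :
    (gaussianReal 0 1).real (Set.Ioc p pe) * (gaussianReal 0 1).real (Set.Ioc qe q) * (g p - g q) ≤
    ∫ x in Set.Ioi t, g x ∂(gaussianReal 0 1) -
      (gaussianReal 0 1).real (Set.Ioi t) * ∫ x, g x ∂(gaussianReal 0 1) := by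
  have hP1 : Set.Ioc p pe ⊆ Set.Ioi t := fun x hx => lt_of_le_of_lt hp hx.1
  have hP2 : Set.Ioc qe q ⊆ (Set.Ioi t)ᶜ := fun x hx => by
    simp only [Set.mem_compl_iff, Set.mem_Ioi, not_lt]; exact hx.2.trans hq
  have hc1 : (gaussianReal 0 1).real (Set.Ioc p pe) ≤ (gaussianReal 0 1).real (Set.Ioi t) :=
    measureReal_mono hP1
  have hc2 : (gaussianReal 0 1).real (Set.Ioc qe q) ≤ (gaussianReal 0 1).real (Set.Ioi t)ᶜ :=
    measureReal_mono hP2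
  have hac : (gaussianReal 0 1).real (Set.Ioi t)ᶜ = 1 - (gaussianReal 0 1).real (Set.Ioi t) :=
    probReal_compl_eq_one_sub measurableSet_Ioi
  have htot := integral_add_compl (measurableSet_Ioi (a := t)) hgi
  have hgp : 0 ≤ g p - g t := sub_nonneg.2 (hg hp)
  have hgq : 0 ≤ g t - g q := sub_nonneg.2 (hg hq)
  have hI : ∀ (P : Set ℝ) (c d : ℝ), MeasurableSet P →
      Integrable (fun x => d + P.indicator (fun _ => c) x) (gaussianReal 0 1) := fun P c d hP =>
    (integrable_const d).add ((integrable_const c).indicator hP)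
  have hE : ∀ (S P : Set ℝ) (c d : ℝ), MeasurableSet P → P ⊆ S →
      ∫ x in S, (d + P.indicator (fun _ => c) x) ∂(gaussianReal 0 1) =
      (gaussianReal 0 1).real S * d + (gaussianReal 0 1).real P * c := by
    intro S P c d hP hPS
    rw [integral_add (integrable_const d) ((integrable_const c).indicator hP),
      integral_indicator hP, Measure.restrict_restrict hP, Set.inter_eq_left.2 hPS]
    simp
  have h1 : (gaussianReal 0 1).real (Set.Ioi t) * g t +
      (gaussianReal 0 1).real (Set.Ioc p pe) * (g p - g t) ≤
      ∫ x in Set.Ioi t, g x ∂(gaussianReal 0 1) := by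
    rw [← hE _ _ _ _ measurableSet_Ioc hP1]
    refine setIntegral_mono_on (hI _ _ _ measurableSet_Ioc).integrableOn hgi.integrableOn
      measurableSet_Ioi fun x hx => ?_
    by_cases hxP : x ∈ Set.Ioc p pe
    · rw [Set.indicator_of_mem hxP]
      have := hg hxP.1.le
      linarith
    · rw [Set.indicator_of_notMem hxP, add_zero]
      exact hg (le_of_lt hx)
  have h2 : ∫ x in (Set.Ioi t)ᶜ, g x ∂(gaussianReal 0 1) ≤
      (gaussianReal 0 1).real (Set.Ioi t)ᶜ * g t +
      (gaussianReal 0 1).real (Set.Ioc qe q) * (g q - g t) := by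
    rw [← hE _ _ _ _ measurableSet_Ioc hP2]
    refine setIntegral_mono_on hgi.integrableOn (hI _ _ _ measurableSet_Ioc).integrableOn
      measurableSet_Ioi.compl fun x hx => ?_
    by_cases hxP : x ∈ Set.Ioc qe q
    · rw [Set.indicator_of_mem hxP]
      have := hg hxP.2
      linarith
    · rw [Set.indicator_of_notMem hxP, add_zero]
      simp only [Set.mem_compl_iff, Set.mem_Ioi, not_lt] at hx
      exact hg hx
  have n1 : 0 ≤ (gaussianReal 0 1).real (Set.Ioc p pe) := measureReal_nonneg
  have n2 : 0 ≤ (gaussianReal 0 1).real (Set.Ioc qe q) := measureReal_nonneg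
  rw [← htot]
  rw [hac] at h2 hc2
  generalize (gaussianReal 0 1).real (Set.Ioc p pe) = P1 at *
  generalize (gaussianReal 0 1).real (Set.Ioc qe q) = P2 at *
  generalize (gaussianReal 0 1).real (Set.Ioi t) = a at *
  generalize ∫ x in Set.Ioi t, g x ∂(gaussianReal 0 1) = J1 at *
  generalize ∫ x in (Set.Ioi t)ᶜ, g x ∂(gaussianReal 0 1) = J2 at *
  have ha : 0 ≤ a := n1.trans hc1
  have ha' : 0 ≤ 1 - a := n2.trans hc2
  have i1 := mul_le_mul_of_nonneg_left h1 ha'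
  have i2 := mul_le_mul_of_nonneg_left h2 ha
  have i3 := mul_le_mul_of_nonneg_right hc2 (mul_nonneg n1 hgp)
  have i4 := mul_le_mul_of_nonneg_right hc1 (mul_nonneg n2 hgq)
  nlinarith

/-- the constant -/
noncomputable def KK : ℝ := Real.exp (-(3 / 2)) * gaussianPDFReal 0 1 2 * Real.exp (-1)

lemma KK_pos : 0 < KK := by
  have := phi_pos 2
  unfold KK; positivity

lemma near_one (a b : ℝ) (hab : b - a = 1) (ha : -2 ≤ a) (hb : b ≤ 2) :
    gaussianPDFReal 0 1 2 ≤ (gaussianReal 0 1).real (Set.Ioc a b) := by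
  have := gint a b (gaussianPDFReal 0 1 2) (by linarith) ?_
  · rwa [hab, one_mul] at this
  · intro x hx
    have := phi_le 2 x 0 (by nlinarith [hx.1, hx.2])
    simpa using this

lemma near_t (t a b : ℝ) (hab : b - a = 1 / (1 + |t|)) (h : ∀ x ∈ Set.Ioc a b, |x - t| ≤ 1 / (1 + |t|)) :
    1 / (1 + |t|) * (Real.exp (-(3 / 2)) * gaussianPDFReal 0 1 t) ≤
      (gaussianReal 0 1).real (Set.Ioc a b) := by
  have ht : 0 ≤ |t| := abs_nonneg t
  have hpos : 0 < 1 / (1 + |t|) := by positivity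
  rw [← hab]
  refine gint a b _ (by linarith) fun x hx => phi_le t x _ ?_
  have hx' := h x hx
  rw [le_div_iff₀ (by positivity)] at hx'
  have h0 : 0 ≤ |x - t| := abs_nonneg _
  have h1 : |x - t| ≤ 1 := by nlinarith
  have h2 : |t| * |x - t| ≤ 1 := by nlinarith
  have h3 : t * (x - t) ≤ |t| * |x - t| := by rw [← abs_mul]; exact le_abs_self _
  have h4 : (x - t) ^ 2 = |x - t| ^ 2 := (sq_abs _).symm
  nlinarith

lemma direct (s r t : ℝ) (hr : 0 ≤ r) (hr1 : r ≤ 1 / (4 * (1 + |t|) * (1 + |s|))) :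
    KK * r * gaussianPDFReal 0 1 t * gaussianPDFReal 0 1 s ≤
    ∫ x in Set.Ioi t, gfun s r x ∂(gaussianReal 0 1) -
      (gaussianReal 0 1).real (Set.Ioi t) * (gaussianReal 0 1).real (Set.Ioi s) := by
  have ht : 0 ≤ |t| := abs_nonneg t
  have hs : 0 ≤ |s| := abs_nonneg s
  have hM : r * (1 + |t|) ≤ 1 / (4 * (1 + |s|)) := by
    rw [le_div_iff₀ (by positivity)] at hr1 ⊢
    linarith
  have hr2 : r ^ 2 ≤ 1 := by
    rw [le_div_iff₀ (by positivity)] at hr1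
    have h1 : 0 ≤ r * |t| := by positivity
    have h2 : 0 ≤ r * |s| := by positivity
    have h3 : 0 ≤ r * |t| * |s| := by positivity
    have : r ≤ 1 := by nlinarith
    nlinarith
  have hphit := phi_pos t
  have hphis := phi_pos s
  have hphi2 := phi_pos 2
  have main : ∀ p pe q qe : ℝ, t ≤ p → q ≤ t → p - q = 1 + |t| → |p| ≤ 1 + |t| → |q| ≤ 1 + |t| →
      1 / (1 + |t|) * (Real.exp (-(3 / 2)) * gaussianPDFReal 0 1 t) * gaussianPDFReal 0 1 2 ≤
        (gaussianReal 0 1).real (Set.Ioc p pe) * (gaussianReal 0 1).real (Set.Ioc qe q) →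
      KK * r * gaussianPDFReal 0 1 t * gaussianPDFReal 0 1 s ≤
    ∫ x in Set.Ioi t, gfun s r x ∂(gaussianReal 0 1) -
      (gaussianReal 0 1).real (Set.Ioi t) * (gaussianReal 0 1).real (Set.Ioi s) := by
    intro p pe q qe hp hq hpq hpa hqa hprod
    have h1 := cov_low _ (gfun_mono_x s r hr) (gfun_int s r) t p pe q qe hp hq
    rw [gfun_total s r hr2] at h1
    refine le_trans ?_ h1
    have h2 := gfun_diff s r q p (1 + |t|) hr (by linarith) hqa hpa hM (by linarith)
    rw [hpq] at h2
    have h3 := mul_le_mul hprod h2 (by positivity) (by positivity)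
    refine le_trans (le_of_eq ?_) h3
    unfold KK
    field_simp
  by_cases h0 : 0 ≤ t
  · have habs : |t| = t := abs_of_nonneg h0
    refine main t (t + 1 / (1 + |t|)) (-1) (-2) le_rfl (by linarith) (by rw [habs]; ring)
      (by linarith) (by norm_num) ?_
    have a1 := near_t t t (t + 1 / (1 + |t|)) (by ring) (by
      rintro x ⟨hx1, hx2⟩
      rw [abs_le]; constructor <;> linarith)
    have a2 := near_one (-2) (-1) (by norm_num) (by norm_num) (by norm_num)
    exact mul_le_mul a1 a2 hphi2.le measureReal_nonneg
  · push Not at h0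
    have habs : |t| = -t := abs_of_neg h0
    refine main 1 2 t (t - 1 / (1 + |t|)) (by linarith) le_rfl (by rw [habs]; ring)
      (by norm_num) (by linarith) ?_
    have a1 := near_t t (t - 1 / (1 + |t|)) t (by ring) (by
      rintro x ⟨hx1, hx2⟩
      rw [abs_le]; constructor <;> linarith)
    have a2 := near_one 1 2 (by norm_num) (by norm_num) (by norm_num)
    rw [mul_comm ((gaussianReal 0 1).real (Set.Ioc 1 2))]
    exact mul_le_mul a1 a2 hphi2.le measureReal_nonneg

lemma log_low (t : ℝ) :
    (1 + |t|) / 2 ≤ Real.sqrt (Real.log (Real.exp 1 / (gaussianPDFReal 0 1 t * gaussianPDFReal 0 1 t)))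
      ∧ 1 ≤ Real.sqrt (Real.log (Real.exp 1 / (gaussianPDFReal 0 1 t * gaussianPDFReal 0 1 t))) := by
  have hpi : 1 ≤ Real.sqrt (2 * Real.pi) := by
    rw [Real.one_le_sqrt]; linarith [Real.pi_gt_three]
  have hφ := phi_pos t
  have h1 : gaussianPDFReal 0 1 t * gaussianPDFReal 0 1 t ≤ Real.exp (-t ^ 2) := by
    have : gaussianPDFReal 0 1 t ≤ Real.exp (-(t ^ 2 / 2)) := by
      rw [phi_eq]
      exact mul_le_of_le_one_left (Real.exp_pos _).le (inv_le_one_of_one_le₀ hpi)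
    calc _ ≤ Real.exp (-(t ^ 2 / 2)) * Real.exp (-(t ^ 2 / 2)) := by gcongr
      _ = _ := by rw [← Real.exp_add]; congr 1; ring
  have h2 : 1 + t ^ 2 ≤ Real.log (Real.exp 1 / (gaussianPDFReal 0 1 t * gaussianPDFReal 0 1 t)) := by
    rw [Real.le_log_iff_exp_le (by positivity), le_div_iff₀ (by positivity), Real.exp_add]
    calc Real.exp 1 * Real.exp (t ^ 2) * (gaussianPDFReal 0 1 t * gaussianPDFReal 0 1 t)
        ≤ Real.exp 1 * Real.exp (t ^ 2) * Real.exp (-t ^ 2) := by gcongr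
      _ = Real.exp 1 := by rw [mul_assoc, ← Real.exp_add]; simp
  constructor
  · refine Real.le_sqrt_of_sq_le (le_trans ?_ h2)
    nlinarith [sq_abs t, sq_nonneg (|t| - 1)]
  · refine Real.le_sqrt_of_sq_le (le_trans ?_ h2)
    nlinarith [sq_nonneg t]

lemma W1_eq (n : ℕ) (w v : Fin n → ℝ) (hw : ∑ i, w i ^ 2 = 1) (hv : ∑ i, v i ^ 2 = 1) (t s : ℝ) :
    gaussW1 n {x | t < ∑ i, w i * x i} {x | s < ∑ i, v i * x i} =
    (∑ i, w i * v i) * (gaussianPDFReal 0 1 t * gaussianPDFReal 0 1 s) := by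
  unfold gaussW1 gaussInfluence _root_.stdGaussian
  simp_rw [influence_s2 n w hw, influence_s2 n v hv]
  rw [Finset.sum_mul]
  exact Finset.sum_congr rfl fun i _ => by ring

lemma cov_eq (n : ℕ) (w v : Fin n → ℝ) (hw : ∑ i, w i ^ 2 = 1) (hv : ∑ i, v i ^ 2 = 1) (t s : ℝ) :
    gaussCov n (Set.indicator {x | t < ∑ i, w i * x i} fun _ => 1)
            (Set.indicator {x | s < ∑ i, v i * x i} fun _ => 1) =
    ∫ x in Set.Ioi t, gfun s (∑ i, w i * v i) x ∂(gaussianReal 0 1) -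
      (gaussianReal 0 1).real (Set.Ioi t) * (gaussianReal 0 1).real (Set.Ioi s) := by
  have mA : ∀ (u : Fin n → ℝ) (a : ℝ), MeasurableSet {x : Fin n → ℝ | a < ∑ i, u i * x i} :=
    fun u a => measurableSet_lt (by fun_prop) (by fun_prop)
  have e : ∀ (S : Set (Fin n → ℝ)), MeasurableSet S →
      ∫ x, S.indicator (fun _ => (1 : ℝ)) x ∂(Measure.pi fun _ : Fin n => gaussianReal 0 1) =
      (Measure.pi fun _ : Fin n => gaussianReal 0 1).real S := fun S hS =>
    integral_indicator_one hS
  unfold gaussCov _root_.stdGaussian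
  rw [e _ (mA w t), e _ (mA v s), marg n w hw, marg n v hv,
    ← joint n w v hw hv (Set.Ioi t) measurableSet_Ioi s,
    ← e {x | (∑ i, w i * x i) ∈ Set.Ioi t ∧ s < ∑ i, v i * x i} ((mA w t).inter (mA v s))]
  congr 1
  refine integral_congr_ae (Filter.Eventually.of_forall fun x => ?_)
  by_cases h1 : t < ∑ i, w i * x i <;> by_cases h2 : s < ∑ i, v i * x i <;>
    simp [Set.indicator, h1, h2]

/-- KKM-type Gaussian correlation lower bound for halfspaces. -/
theorem stmt2 :
    ∃ c : ℝ, 0 < c ∧ ∀ (n : ℕ) (w v : Fin n → ℝ),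
      (∑ i, w i ^ 2) = 1 → (∑ i, v i ^ 2) = 1 → 0 ≤ ∑ i, w i * v i →
      ∀ t s : ℝ,
        gaussCov n (Set.indicator {x | t < ∑ i, w i * x i} fun _ => 1)
            (Set.indicator {x | s < ∑ i, v i * x i} fun _ => 1) ≥
          c * gaussW1 n {x | t < ∑ i, w i * x i} {x | s < ∑ i, v i * x i} /
            (Real.sqrt (Real.log (Real.exp 1 /
                gaussW1 n {x | t < ∑ i, w i * x i} {x | t < ∑ i, w i * x i})) *
             Real.sqrt (Real.log (Real.exp 1 /
                gaussW1 n {x | s < ∑ i, v i * x i} {x | s < ∑ i, v i * x i}))) := by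
  refine ⟨KK / 16, by have := KK_pos; positivity, ?_⟩
  intro n w v hw hv hρ t s
  have hρ2 := rho_sq n w v hw hv
  have ew : ∑ i, w i * w i = 1 := by rw [← hw]; exact Finset.sum_congr rfl fun i _ => by ring
  have ev : ∑ i, v i * v i = 1 := by rw [← hv]; exact Finset.sum_congr rfl fun i _ => by ring
  rw [cov_eq n w v hw hv, W1_eq n w v hw hv, W1_eq n w w hw hw, W1_eq n v v hv hv, ew, ev,
    one_mul, one_mul, ge_iff_le]
  obtain ⟨a1, a2⟩ := log_low t
  obtain ⟨b1, b2⟩ := log_low s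
  generalize ∑ i, w i * v i = ρ at *
  generalize Real.sqrt (Real.log (Real.exp 1 /
    (gaussianPDFReal 0 1 t * gaussianPDFReal 0 1 t))) = Lt at *
  generalize Real.sqrt (Real.log (Real.exp 1 /
    (gaussianPDFReal 0 1 s * gaussianPDFReal 0 1 s))) = Ls at *
  have hρ1 : ρ ≤ 1 := by nlinarith
  have hK := KK_pos
  have ht := phi_pos t
  have hs := phi_pos s
  have hLt : 0 < Lt := by linarith
  have hLs : 0 < Ls := by linarith
  have hLL : 1 ≤ Lt * Ls := by nlinarith
  have hta : 0 ≤ |t| := abs_nonneg t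
  have hsa : 0 ≤ |s| := abs_nonneg s
  have hX : 0 < KK * (gaussianPDFReal 0 1 t * gaussianPDFReal 0 1 s) := by positivity
  by_cases hc : ρ ≤ 1 / (4 * (1 + |t|) * (1 + |s|))
  · refine le_trans ?_ (direct s ρ t hρ hc)
    rw [div_le_iff₀ (by positivity)]
    have : 0 ≤ ρ * (KK * (gaussianPDFReal 0 1 t * gaussianPDFReal 0 1 s)) :=
      mul_nonneg hρ hX.le
    nlinarith
  · push Not at hc
    set r := 1 / (4 * (1 + |t|) * (1 + |s|)) with hr
    have hr0 : 0 < r := by positivity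
    have h1 := direct s r t hr0.le le_rfl
    have h2 := gfun_mono_r s r ρ t hr0.le hc hρ1
    have h3 : KK / 16 * (ρ * (gaussianPDFReal 0 1 t * gaussianPDFReal 0 1 s)) / (Lt * Ls) ≤
        KK * r * gaussianPDFReal 0 1 t * gaussianPDFReal 0 1 s := by
      rw [div_le_iff₀ (by positivity)]
      have h4 : 1 / 16 ≤ r * (Lt * Ls) := by
        rw [hr, one_div_mul_eq_div, le_div_iff₀ (by positivity)]
        have := mul_le_mul a1 b1 (by positivity) hLt.le
        nlinarith
      have h5 := mul_le_mul_of_nonneg_left h4 hX.le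
      have h6 := mul_le_mul_of_nonneg_left hρ1 hX.le
      nlinarith
    linarith
end
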